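/- arXiv:2605.10595 — 2 statements merged into one kernel-verified Lean document; each statement's English description precedes it below -/
import Mathlib

section
/- Fix p ≥ 3 and let (x_t) be the exact-line-search Frank–Wolfe trajectory on B_p for f(x) = ‖x - e₁‖₂² started from the slow-start initialization x₀^slow(u₀) with u₀ sufficiently small. Define r_t = ‖x_t - e₁‖₂ and s_t = r_{t+1}/r_t. Then, as t → ∞, 1 - s_t = a_p·r_t^κ·(1 + o(1)), where a_p = 2·C_p² = 2·(p/(p+1))^{2(p-1)/p} and κ = 2 - 2/p. -/
/-!
STATEMENT 12: Asymptotic contraction law along the slow-start trajectory: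
with r_t = ‖x_t - e₁‖₂ and s_t = r_{t+1}/r_t, one has
1 - s_t = a_p·r_t^κ·(1 + o(1)) as t → ∞, where a_p = 2·C_p² and κ = 2 - 2/p.
-/

noncomputable section
open Real

namespace Stmt12

/-- Hölder conjugate q = p/(p-1). -/
def qc (p : ℝ) : ℝ := p / (p - 1)

/-- α = (p-1)/p = 1/q. -/
def alphac (p : ℝ) : ℝ := (p - 1) / p

/-- M = (u^q + |w|^q)^{1/q}. -/
def Mv (p u w : ℝ) : ℝ := (u ^ qc p + |w| ^ qc p) ^ (1 / qc p)

/-- First coordinate of the LMO output: v₁ = u^{q-1}/M^{q-1}. -/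
def v1f (p u w : ℝ) : ℝ := u ^ (qc p - 1) / Mv p u w ^ (qc p - 1)

/-- Second coordinate of the LMO output: v₂ = -sign(w)·|w|^{q-1}/M^{q-1}. -/
def v2f (p u w : ℝ) : ℝ := -(Real.sign w) * |w| ^ (qc p - 1) / Mv p u w ^ (qc p - 1)

/-- d₁ = v₁ - 1 + u. -/
def d1f (p u w : ℝ) : ℝ := v1f p u w - 1 + u

/-- d₂ = v₂ - w. -/
def d2f (p u w : ℝ) : ℝ := v2f p u w - w

/-- Exact line-search step size γ = (M - u + u² + w²)/(d₁² + d₂²). -/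
def gamf (p u w : ℝ) : ℝ :=
  (Mv p u w - u + u ^ 2 + w ^ 2) / (d1f p u w ^ 2 + d2f p u w ^ 2)

/-- u' = u - γ·d₁. -/
def uN (p u w : ℝ) : ℝ := u - gamf p u w * d1f p u w

/-- w' = w + γ·d₂. -/
def wN (p u w : ℝ) : ℝ := w + gamf p u w * d2f p u w

/-- Scaled one-step map Φ(u,y) = |w'|/(u')^{1+α} where w = y·u^{1+α}. -/
def Phi (p u y : ℝ) : ℝ :=
  |wN p u (y * u ^ (1 + alphac p))| /
    (uN p u (y * u ^ (1 + alphac p))) ^ (1 + alphac p)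

/-- C_p = (p/(p+1))^{1/q}. -/
def Cp (p : ℝ) : ℝ := (p / (p + 1)) ^ (1 / qc p)

/-- D_p = C_p·(p-1)(3p+1)/(2p(p+1)²). -/
def Dp (p : ℝ) : ℝ := Cp p * ((p - 1) * (3 * p + 1)) / (2 * p * (p + 1) ^ 2)

/-- Membership in the closed unit ℓ_p ball of ℝ². -/
def inBp (p : ℝ) (z : ℝ × ℝ) : Prop := |z.1| ^ p + |z.2| ^ p ≤ 1

/-- The objective f(x) = ‖x - e₁‖₂² on ℝ². -/
def fobj (z : ℝ × ℝ) : ℝ := (z.1 - 1) ^ 2 + z.2 ^ 2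

/-- The point a + s·(b - a). -/
def seg (a b : ℝ × ℝ) (s : ℝ) : ℝ × ℝ := (a.1 + s * (b.1 - a.1), a.2 + s * (b.2 - a.2))

/-- `IsFWTraj p x v γ`: (x,v,γ) is an exact-line-search Frank–Wolfe trajectory on B_p
for f(x) = ‖x - e₁‖₂² (whose gradient at z is (2(z₁-1), 2z₂)). -/
def IsFWTraj (p : ℝ) (x v : ℕ → ℝ × ℝ) (γ : ℕ → ℝ) : Prop :=
  (∀ t, inBp p (v t) ∧ ∀ b : ℝ × ℝ, inBp p b →
      2 * ((x t).1 - 1) * (v t).1 + 2 * (x t).2 * (v t).2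
        ≤ 2 * ((x t).1 - 1) * b.1 + 2 * (x t).2 * b.2) ∧
  (∀ t, γ t ∈ Set.Icc (0:ℝ) 1 ∧ ∀ s ∈ Set.Icc (0:ℝ) 1,
      fobj (seg (x t) (v t) (γ t)) ≤ fobj (seg (x t) (v t) s)) ∧
  (∀ t, x (t + 1) = seg (x t) (v t) (γ t))

/-- The slow-start initialization x₀^slow(u₀) = (1-u₀, (C_p + D_p·u₀)·u₀^{1+α}). -/
def xslow (p u₀ : ℝ) : ℝ × ℝ := (1 - u₀, (Cp p + Dp p * u₀) * u₀ ^ (1 + alphac p))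

/-- u_t = 1 - (x_t)₁. -/
def ucoord (x : ℕ → ℝ × ℝ) (t : ℕ) : ℝ := 1 - (x t).1

/-- y_t = |(x_t)₂| / u_t^{1+α}. -/
def ycoord (p : ℝ) (x : ℕ → ℝ × ℝ) (t : ℕ) : ℝ :=
  |(x t).2| / (ucoord x t) ^ (1 + alphac p)

/-- r_t = ‖x_t - e₁‖₂. -/
def rdist (x : ℕ → ℝ × ℝ) (t : ℕ) : ℝ := Real.sqrt (fobj (x t))

section Trajectory

open Filter Asymptotics Topology

section Asymptotics

variable {ι : Type*} {l : Filter ι}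

lemma isBigO_log_sub_one {f : ι → ℝ} (hf : Tendsto f l (𝓝 1)) :
    (fun i => log (f i)) =O[l] fun i => f i - 1 := by
  simpa [Function.comp_def] using
    (hasDerivAt_log one_ne_zero).isBigO_sub.comp_tendsto hf

lemma isBigO_log_sub_log {f g : ι → ℝ} {c : ℝ} (hc : 0 < c)
    (hf : Tendsto f l (𝓝 c)) (hg : Tendsto g l (𝓝 c)) :
    (fun i => log (f i) - log (g i)) =O[l] fun i => f i - g i := by
  have h := (hasStrictDerivAt_log hc.ne').hasStrictFDerivAt.isBigO_sub
  simpa [Function.comp_def] using h.comp_tendsto (hf.prodMk_nhds hg)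

lemma isBigO_log_sub_sub_one {f : ι → ℝ} (hf : Tendsto f l (𝓝 1)) :
    (fun i => log (f i) - (f i - 1)) =O[l] fun i => (f i - 1) ^ 2 := by
  refine IsBigO.of_bound 2 ?_
  filter_upwards [hf.eventually (lt_mem_nhds (show (1 / 2 : ℝ) < 1 by norm_num))] with i hi
  have h0 : 0 < f i := by linarith
  have h1 := log_le_sub_one_of_pos h0
  have h2 := one_sub_inv_le_log_of_pos h0
  rw [norm_eq_abs, norm_eq_abs, abs_of_nonpos (by linarith), abs_of_nonneg (sq_nonneg _)]
  have h3 : (f i - 1) - (1 - (f i)⁻¹) = (f i - 1) ^ 2 * (f i)⁻¹ := by field_simp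
  have h4 : (f i)⁻¹ ≤ 2 := by rw [inv_le_comm₀ h0 two_pos]; linarith
  nlinarith [mul_le_mul_of_nonneg_left h4 (sq_nonneg (f i - 1))]

lemma isBigO_exp_sub_one {f : ι → ℝ} (hf : Tendsto f l (𝓝 0)) :
    (fun i => exp (f i) - 1) =O[l] f := by
  simpa [Function.comp_def] using (hasDerivAt_exp 0).isBigO_sub.comp_tendsto hf

lemma isBigO_exp_sub_one_sub {f : ι → ℝ} (hf : Tendsto f l (𝓝 0)) :
    (fun i => exp (f i) - 1 - f i) =O[l] fun i => f i ^ 2 := by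
  have h := (exp_sub_sum_range_isBigO_pow 2).comp_tendsto hf
  simpa [Function.comp_def, Finset.sum_range_succ, sub_sub] using h

lemma isBigO_one_add_rpow (a : ℝ) (n : ℕ) {f : ι → ℝ} (hf : Tendsto f l (𝓝 0)) :
    (fun i => (1 + f i) ^ a - ∑ k ∈ Finset.range n, Ring.choose a k * f i ^ k)
      =O[l] fun i => f i ^ n := by
  have h := ((one_add_rpow_hasFPowerSeriesAt_zero (a := a)).isBigO_sub_partialSum_pow n).comp_tendsto hf
  have h2 := h.trans (isBigO_of_le l (g := fun i => f i ^ n) (fun i => by simp))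
  simpa [Function.comp_def, FormalMultilinearSeries.partialSum, binomialSeries,
    FormalMultilinearSeries.coeff_ofScalars, mul_comm] using h2

end Asymptotics

lemma one_add_rpow_sub_le {s x y : ℝ} (hs0 : 0 ≤ s) (hs1 : s ≤ 1) (hx : 0 ≤ x) (hxy : x ≤ y) :
    (1 + y) ^ s - (1 + x) ^ s ≤ s * (y - x) := by
  have hb : (0:ℝ) < 1 + x := by linarith
  have h := rpow_one_add_le_one_add_mul_self (s := (y - x) / (1 + x))
    (by have : 0 ≤ (y - x) / (1 + x) := by apply div_nonneg <;> linarith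
        linarith) hs0 hs1
  have e : 1 + y = (1 + x) * (1 + (y - x) / (1 + x)) := by field_simp; ring
  have hq : 0 ≤ (y - x) / (1 + x) := by apply div_nonneg <;> linarith
  rw [e, mul_rpow hb.le (by linarith)]
  have hA : (1 + x) ^ s ≤ 1 + x := by
    simpa using rpow_le_rpow_of_exponent_le (show 1 ≤ 1 + x by linarith) hs1
  have hA0 : 0 < (1 + x) ^ s := rpow_pos_of_pos hb _
  calc (1 + x) ^ s * (1 + (y - x) / (1 + x)) ^ s - (1 + x) ^ s
      ≤ (1 + x) ^ s * (1 + s * ((y - x) / (1 + x))) - (1 + x) ^ s := by gcongr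
    _ = (1 + x) ^ s * (s * ((y - x) / (1 + x))) := by ring
    _ ≤ (1 + x) * (s * ((y - x) / (1 + x))) := by gcongr
    _ = s * (y - x) := by field_simp

lemma exists_one_add_rpow_sub {s x y : ℝ} (hs0 : 0 ≤ s) (hs1 : s ≤ 1) (hx : 0 ≤ x) (hy : 0 ≤ y) :
    ∃ θ ∈ Set.Icc (0:ℝ) s, (1 + y) ^ s - (1 + x) ^ s = θ * (y - x) := by
  rcases eq_or_ne x y with rfl | hne
  · exact ⟨0, ⟨le_rfl, hs0⟩, by simp⟩
  have key : ∀ {x y : ℝ}, 0 ≤ x → x < y →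
      ((1 + y) ^ s - (1 + x) ^ s) / (y - x) ∈ Set.Icc (0:ℝ) s := by
    intro x y hx h
    have h0 : 0 < y - x := by linarith
    refine ⟨div_nonneg (sub_nonneg.2 (rpow_le_rpow (by linarith) (by linarith) hs0)) h0.le, ?_⟩
    rw [div_le_iff₀ h0]
    exact one_add_rpow_sub_le hs0 hs1 hx h.le
  have hn : y - x ≠ 0 := sub_ne_zero.2 hne.symm
  refine ⟨_, ?_, (div_mul_cancel₀ _ hn).symm⟩
  rcases lt_or_gt_of_ne hne with h | h
  · exact key hx h
  · have := key hy h
    rwa [← neg_sub ((1 + y) ^ s), ← neg_sub y x, neg_div_neg_eq] at this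

/-- `ρ²`, where `ρ = (Y u)^α` is the slope `|w| / u` of the iterate. -/
def nuf (p u Y : ℝ) : ℝ := (Y * u) ^ (2 - 2 / p)

/-- The quotient `(1 - (1 - u) (1 + z)^{1/p}) / u` with `z = Y u`. -/
def kf (p u Y : ℝ) : ℝ := (1 - (1 - u) * (1 + Y * u) ^ (1 / p)) / u

/-- The relative size of `|w|` against `|v₂|`. -/
def nf (p u Y : ℝ) : ℝ := nuf p u Y * (1 + Y * u) ^ (1 / p) / Y

/-- The quotient of consecutive slopes. -/
def Rf (p u Y : ℝ) : ℝ := kf p u Y / (Y * (1 + nf p u Y))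

/-- The quotient `u' / u`. -/
def sigf (p u Y : ℝ) : ℝ :=
  (1 - Rf p u Y * nuf p u Y) / (1 + Rf p u Y ^ 2 * nuf p u Y)

/-- The next value of `u`. -/
def uf (p u Y : ℝ) : ℝ := u * sigf p u Y

/-- The next value of `Y = (|w| / u)^q / u`. -/
def Yf (p u Y : ℝ) : ℝ := Y * Rf p u Y ^ qc p / sigf p u Y

/-- The logarithmic increment `log (Y' / Y)`. -/
def ef (p u Y : ℝ) : ℝ := qc p * log (Rf p u Y) - log (sigf p u Y)

section Step

variable {ι : Type*} {l : Filter ι} {u Y : ι → ℝ} {p : ℝ}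

lemma isLittleO_rpow_five_fourths (hu : Tendsto u l (𝓝[>] 0)) :
    (fun i => u i ^ (5 / 4 : ℝ)) =o[l] u := by
  have hpos : ∀ᶠ i in l, 0 < u i := hu.eventually self_mem_nhdsWithin
  have h0 : Tendsto u l (𝓝 0) := hu.mono_right nhdsWithin_le_nhds
  have h1 : Tendsto (fun i => u i ^ (1 / 4 : ℝ)) l (𝓝 0) := by
    simpa using h0.rpow_const (p := 1 / 4) (Or.inr (by norm_num))
  have h2 := ((isLittleO_one_iff ℝ).2 h1).mul_isBigO (isBigO_refl u l)
  refine h2.congr' ?_ (by simp)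
  filter_upwards [hpos] with i hi
  rw [← rpow_add_one hi.ne']; norm_num

lemma isLittleO_nuf (hp : 3 ≤ p) (hu : Tendsto u l (𝓝[>] 0))
    (hY : ∀ᶠ i in l, Y i ∈ Set.Icc (1 / 2) 1) :
    (fun i => nuf p (u i) (Y i)) =o[l] fun i => u i ^ (5 / 4 : ℝ) := by
  have hpos : ∀ᶠ i in l, 0 < u i := hu.eventually self_mem_nhdsWithin
  have h0 : Tendsto u l (𝓝 0) := hu.mono_right nhdsWithin_le_nhds
  have h1 : Tendsto (fun i => u i ^ (1 / 12 : ℝ)) l (𝓝 0) := by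
    simpa using h0.rpow_const (p := 1 / 12) (Or.inr (by norm_num))
  have h2 := ((isLittleO_one_iff ℝ).2 h1).mul_isBigO (isBigO_refl (fun i => u i ^ (5 / 4 : ℝ)) l)
  simp only [one_mul] at h2
  refine IsBigO.trans_isLittleO (IsBigO.of_bound 1 ?_) h2
  filter_upwards [hpos, hY, h0.eventually (gt_mem_nhds zero_lt_one)] with i hi hYi hi1
  have hz : 0 < Y i * u i := mul_pos (by linarith [hYi.1]) hi
  rw [nuf, norm_of_nonneg (rpow_nonneg hz.le _), ← rpow_add hi, norm_of_nonneg (by positivity),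
    one_mul]
  have hκ : (1 / 12 + 5 / 4 : ℝ) ≤ 2 - 2 / p := by
    have : 2 / p ≤ 2 / 3 := by gcongr
    linarith
  calc (Y i * u i) ^ (2 - 2 / p) ≤ u i ^ (2 - 2 / p) := by
        apply rpow_le_rpow hz.le _ (by linarith)
        nlinarith [hYi.2]
    _ ≤ _ := rpow_le_rpow_of_exponent_ge hi hi1.le hκ

lemma isBigO_Y_mul (hY : ∀ᶠ i in l, Y i ∈ Set.Icc (1 / 2) 1) :
    (fun i => Y i * u i) =O[l] u := by
  refine IsBigO.of_bound 1 ?_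
  filter_upwards [hY] with i hYi
  rw [norm_mul, norm_of_nonneg (by linarith [hYi.1] : 0 ≤ Y i)]
  gcongr
  exact hYi.2

lemma tendsto_Y_mul (hu : Tendsto u l (𝓝[>] 0)) (hY : ∀ᶠ i in l, Y i ∈ Set.Icc (1 / 2) 1) :
    Tendsto (fun i => Y i * u i) l (𝓝 0) :=
  (isBigO_Y_mul hY).trans_tendsto (hu.mono_right nhdsWithin_le_nhds)

lemma tendsto_nuf (hp : 3 ≤ p) (hu : Tendsto u l (𝓝[>] 0))
    (hY : ∀ᶠ i in l, Y i ∈ Set.Icc (1 / 2) 1) :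
    Tendsto (fun i => nuf p (u i) (Y i)) l (𝓝 0) :=
  ((isLittleO_nuf hp hu hY).trans (isLittleO_rpow_five_fourths hu)).isBigO.trans_tendsto
    (hu.mono_right nhdsWithin_le_nhds)

lemma tendsto_one_add_rpow (hu : Tendsto u l (𝓝[>] 0))
    (hY : ∀ᶠ i in l, Y i ∈ Set.Icc (1 / 2) 1) :
    Tendsto (fun i => (1 + Y i * u i) ^ (1 / p)) l (𝓝 1) := by
  have h := (tendsto_Y_mul hu hY).const_add 1
  simpa using h.rpow_const (p := 1 / p) (Or.inl (by norm_num))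

lemma isBigO_kf_sub (hu : Tendsto u l (𝓝[>] 0)) (hY : ∀ᶠ i in l, Y i ∈ Set.Icc (1 / 2) 1) :
    (fun i => kf p (u i) (Y i) - (1 - Y i / p)) =O[l] u := by
  have hpos : ∀ᶠ i in l, 0 < u i := hu.eventually self_mem_nhdsWithin
  have hz := tendsto_Y_mul hu hY
  have h1 := isBigO_one_add_rpow (1 / p) 1 hz
  have h2 := isBigO_one_add_rpow (1 / p) 2 hz
  simp only [Finset.sum_range_succ, Finset.sum_range_zero, pow_zero, pow_one, Ring.choose_zero_right,
    Ring.choose_one_right, mul_one, zero_add] at h1 h2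
  have h1' := h1.trans (isBigO_Y_mul hY)
  have h2' := (h2.trans ((isBigO_Y_mul hY).pow 2)).mul (isBigO_refl (fun i => (u i)⁻¹) l)
  have h3 : (fun i => u i ^ 2 * (u i)⁻¹) =ᶠ[l] u := by
    filter_upwards [hpos] with i hi
    field_simp
  refine (h1'.sub (h2'.trans_eventuallyEq h3)).congr' ?_ EventuallyEq.rfl
  filter_upwards [hpos] with i hi
  rw [kf]
  field_simp
  ring

lemma eventually_kf_mem (hp : 3 ≤ p) (hu : Tendsto u l (𝓝[>] 0))
    (hY : ∀ᶠ i in l, Y i ∈ Set.Icc (1 / 2) 1) :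
    ∀ᶠ i in l, kf p (u i) (Y i) ∈ Set.Icc (1 / 2) 2 := by
  have h := (isBigO_kf_sub (p := p) hu hY).trans_tendsto (hu.mono_right nhdsWithin_le_nhds)
  filter_upwards [h.eventually (Icc_mem_nhds (show (-1/6 : ℝ) < 0 by norm_num)
    (show (0:ℝ) < 1 by norm_num)), hY] with i hi hYi
  have h1 : Y i / p ≤ 1 / 3 := by
    have := hYi.2
    gcongr
  have h2 : 0 ≤ Y i / p := div_nonneg (by linarith [hYi.1]) (by linarith)
  constructor <;> linarith [hi.1, hi.2]

lemma isBigO_nf (hu : Tendsto u l (𝓝[>] 0))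
    (hY : ∀ᶠ i in l, Y i ∈ Set.Icc (1 / 2) 1) :
    (fun i => nf p (u i) (Y i)) =O[l] fun i => nuf p (u i) (Y i) := by
  refine IsBigO.of_bound 4 ?_
  filter_upwards [(tendsto_one_add_rpow (p := p) hu hY).eventually
    (Icc_mem_nhds (show (0 : ℝ) < 1 by norm_num) (show (1:ℝ) < 2 by norm_num)), hY] with i hi hYi
  have h0 : 0 < Y i := by linarith [hYi.1]
  rw [nf, mul_div_assoc, norm_mul, mul_comm, norm_of_nonneg (div_nonneg hi.1 h0.le)]
  gcongr
  rw [div_le_iff₀ h0]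
  linarith [hYi.1, hi.2]

lemma eventually_nf_nonneg (hu : Tendsto u l (𝓝[>] 0))
    (hY : ∀ᶠ i in l, Y i ∈ Set.Icc (1 / 2) 1) :
    ∀ᶠ i in l, 0 ≤ nf p (u i) (Y i) := by
  have hpos : ∀ᶠ i in l, 0 < u i := hu.eventually self_mem_nhdsWithin
  filter_upwards [hpos, hY] with i hi hYi
  have h0 : 0 < Y i := by linarith [hYi.1]
  rw [nf, nuf]
  positivity

lemma eventually_Rf_mem (hp : 3 ≤ p) (hu : Tendsto u l (𝓝[>] 0))
    (hY : ∀ᶠ i in l, Y i ∈ Set.Icc (1 / 2) 1) :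
    ∀ᶠ i in l, Rf p (u i) (Y i) ∈ Set.Ioc 0 4 := by
  filter_upwards [eventually_kf_mem hp hu hY, eventually_nf_nonneg (p := p) hu hY, hY]
    with i hk hn hYi
  have h0 : 0 < Y i := by linarith [hYi.1]
  have hk0 := hk.1
  refine ⟨div_pos (by linarith) (by positivity), ?_⟩
  rw [Rf, div_le_iff₀ (by positivity)]
  nlinarith [hk.2, hYi.1, mul_nonneg h0.le hn]

lemma isBigO_sigf_sub_one (hp : 3 ≤ p) (hu : Tendsto u l (𝓝[>] 0))
    (hY : ∀ᶠ i in l, Y i ∈ Set.Icc (1 / 2) 1) :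
    (fun i => sigf p (u i) (Y i) - 1) =O[l] fun i => nuf p (u i) (Y i) := by
  have hpos : ∀ᶠ i in l, 0 < u i := hu.eventually self_mem_nhdsWithin
  refine IsBigO.of_bound 20 ?_
  filter_upwards [eventually_Rf_mem hp hu hY, hY, hpos] with i hR hYi hi
  have h0 : 0 < Y i := by linarith [hYi.1]
  have hν : 0 < nuf p (u i) (Y i) := rpow_pos_of_pos (by positivity) _
  obtain ⟨hR0, hR4⟩ := hR
  have hd : 0 < 1 + Rf p (u i) (Y i) ^ 2 * nuf p (u i) (Y i) := by positivity
  have e : sigf p (u i) (Y i) - 1 = -((Rf p (u i) (Y i) + Rf p (u i) (Y i) ^ 2) *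
      nuf p (u i) (Y i) / (1 + Rf p (u i) (Y i) ^ 2 * nuf p (u i) (Y i))) := by
    rw [sigf]; field_simp; ring
  rw [e, norm_neg, norm_of_nonneg (by positivity), norm_of_nonneg hν.le, div_le_iff₀ hd]
  have : Rf p (u i) (Y i) + Rf p (u i) (Y i) ^ 2 ≤ 20 := by nlinarith
  have h2 := mul_le_mul_of_nonneg_right this hν.le
  have h3 : 0 ≤ Rf p (u i) (Y i) ^ 2 * nuf p (u i) (Y i) := by positivity
  nlinarith [mul_nonneg hν.le h3]

lemma tendsto_sigf (hp : 3 ≤ p) (hu : Tendsto u l (𝓝[>] 0))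
    (hY : ∀ᶠ i in l, Y i ∈ Set.Icc (1 / 2) 1) :
    Tendsto (fun i => sigf p (u i) (Y i)) l (𝓝 1) := by
  have := (isBigO_sigf_sub_one hp hu hY).trans_tendsto (tendsto_nuf hp hu hY)
  simpa using this.add_const 1

lemma isBigO_log_sigf (hp : 3 ≤ p) (hu : Tendsto u l (𝓝[>] 0))
    (hY : ∀ᶠ i in l, Y i ∈ Set.Icc (1 / 2) 1) :
    (fun i => log (sigf p (u i) (Y i))) =O[l] fun i => nuf p (u i) (Y i) :=
  (isBigO_log_sub_one (tendsto_sigf hp hu hY)).trans (isBigO_sigf_sub_one hp hu hY)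

lemma tendsto_uf (hp : 3 ≤ p) (hu : Tendsto u l (𝓝[>] 0))
    (hY : ∀ᶠ i in l, Y i ∈ Set.Icc (1 / 2) 1) :
    Tendsto (fun i => uf p (u i) (Y i)) l (𝓝[>] 0) := by
  have hpos : ∀ᶠ i in l, 0 < u i := hu.eventually self_mem_nhdsWithin
  have hs := tendsto_sigf hp hu hY
  rw [tendsto_nhdsWithin_iff]
  refine ⟨by simpa [uf] using (hu.mono_right nhdsWithin_le_nhds).mul hs, ?_⟩
  filter_upwards [hpos, hs.eventually (lt_mem_nhds zero_lt_one)] with i hi hsi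
  exact mul_pos hi hsi

end Step

lemma one_add_rpow_le_tangent {s x y : ℝ} (hs0 : 0 ≤ s) (hs1 : s ≤ 1) (hx : 0 ≤ x) (hy : 0 ≤ y) :
    (1 + y) ^ s ≤ (1 + x) ^ s + (y - x) * (s * (1 + x) ^ s / (1 + x)) := by
  have hb : (0:ℝ) < 1 + x := by linarith
  have h1 : -1 ≤ (y - x) / (1 + x) := by rw [le_div_iff₀ hb]; linarith
  have h := rpow_one_add_le_one_add_mul_self h1 hs0 hs1
  have e : 1 + y = (1 + x) * (1 + (y - x) / (1 + x)) := by field_simp; ring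
  rw [e, mul_rpow hb.le (by linarith)]
  have hA0 : 0 < (1 + x) ^ s := rpow_pos_of_pos hb _
  calc (1 + x) ^ s * (1 + (y - x) / (1 + x)) ^ s
      ≤ (1 + x) ^ s * (1 + s * ((y - x) / (1 + x))) := by gcongr
    _ = _ := by field_simp

lemma abs_one_add_rpow_div_sub_le {s x y : ℝ} (hs0 : 0 ≤ s) (hs1 : s ≤ 1) (hx : 0 < x)
    (hxy : x ≤ y) :
    |((1 + x) ^ s - 1) / x - ((1 + y) ^ s - 1) / y| ≤ s * (y - x) := by
  have hy : 0 < y := hx.trans_le hxy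
  have h1 := one_add_rpow_le_tangent hs0 hs1 hy.le hx.le
  have h2 := one_add_rpow_le_tangent hs0 hs1 hx.le hy.le
  have h3 := one_add_rpow_le_tangent hs0 hs1 hx.le le_rfl
  have h4 : (1 + x) ^ s ≤ 1 + s * x :=
    rpow_one_add_le_one_add_mul_self (by linarith) hs0 hs1
  have h5 : 1 ≤ (1 + y) ^ s := one_le_rpow (by linarith) hs0
  have h6 : s * (1 - y) ≤ s * (1 + y) ^ s / (1 + y) := by
    rw [le_div_iff₀ (by linarith)]
    have := mul_le_mul_of_nonneg_left h5 hs0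
    nlinarith [mul_nonneg hs0 (sq_nonneg y)]
  simp only [add_zero, one_rpow, zero_sub] at h3
  set A := (1 + x) ^ s
  set B := (1 + y) ^ s
  set a := s * A / (1 + x)
  have e : (A - 1) / x - (B - 1) / y = ((A - 1) * y - (B - 1) * x) / (x * y) := by
    field_simp
  have hxy' : 0 ≤ y - x := by linarith
  rw [e, abs_of_nonneg, div_le_iff₀ (by positivity)]
  · have h7 := mul_le_mul_of_nonneg_left h6 hxy'
    have h8 : B - 1 ≥ (A - 1) + (y - x) * (s * (1 - y)) := by nlinarith
    have h9 := mul_le_mul_of_nonneg_left h8 hx.le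
    have h10 := mul_le_mul_of_nonneg_left h4 hxy'
    nlinarith
  · apply div_nonneg _ (by positivity)
    have h7 := mul_le_mul_of_nonneg_left h2 hx.le
    have h8 := mul_le_mul_of_nonneg_left h3 hxy'
    nlinarith

lemma abs_kf_sub_le {p u v Y : ℝ} (hp : 3 ≤ p) (hu : 0 < u) (huv : u ≤ v) (hY0 : 0 < Y)
    (hY1 : Y ≤ 1) : |kf p u Y - kf p v Y| ≤ 2 * (v - u) := by
  have hv : 0 < v := hu.trans_le huv
  have hs0 : 0 ≤ 1 / p := by positivity
  have hs1 : 1 / p ≤ 1 := by rw [div_le_one (by linarith)]; linarith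
  have hxy : Y * u ≤ Y * v := by gcongr
  have h1 := abs_one_add_rpow_div_sub_le hs0 hs1 (mul_pos hY0 hu) hxy
  have h2 := one_add_rpow_sub_le hs0 hs1 (mul_pos hY0 hu).le hxy
  have h3 : (1 + Y * u) ^ (1 / p) ≤ (1 + Y * v) ^ (1 / p) := by gcongr
  have e : kf p u Y - kf p v Y = -((1 + Y * v) ^ (1 / p) - (1 + Y * u) ^ (1 / p))
      - Y * (((1 + Y * u) ^ (1 / p) - 1) / (Y * u) - ((1 + Y * v) ^ (1 / p) - 1) / (Y * v)) := by
    rw [kf, kf]; field_simp; ring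
  have h4 : 1 / p * (Y * v - Y * u) ≤ v - u := by
    rw [← mul_sub, ← mul_assoc]
    have : 1 / p * Y ≤ 1 := mul_le_one₀ hs1 hY0.le hY1
    nlinarith
  rw [e]
  have h5 : |Y * (((1 + Y * u) ^ (1 / p) - 1) / (Y * u) - ((1 + Y * v) ^ (1 / p) - 1) / (Y * v))|
      ≤ v - u := by
    rw [abs_mul, abs_of_pos hY0]
    calc _ ≤ 1 * _ := mul_le_mul_of_nonneg_right hY1 (abs_nonneg _)
      _ ≤ v - u := by linarith
  have h6 := abs_le.1 h5
  rw [abs_le]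
  constructor <;> linarith [h6.1, h6.2]

lemma exists_kf_sub {p u Y Z : ℝ} (hp : 3 ≤ p) (hu : 0 < u) (hY : 0 ≤ Y) (hZ : 0 ≤ Z) :
    ∃ θ ∈ Set.Icc 0 (1 / p), kf p u Z - kf p u Y = -((1 - u) * θ * (Z - Y)) := by
  obtain ⟨θ, hθ, h⟩ := exists_one_add_rpow_sub (s := 1 / p) (x := Y * u) (y := Z * u)
    (by positivity) (by rw [div_le_one (by linarith)]; linarith) (by positivity) (by positivity)
  refine ⟨θ, hθ, ?_⟩
  have : (1 + Z * u) ^ (1 / p) = (1 + Y * u) ^ (1 / p) + θ * (Z * u - Y * u) := by linarith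
  rw [kf, kf, this]
  field_simp
  ring

lemma qc_pos {p : ℝ} (hp : 3 ≤ p) : 0 < qc p := div_pos (by linarith) (by linarith)

lemma nuf_uf_Yf {p u Y : ℝ} (hp : 3 ≤ p) (h0 : 0 ≤ Y * u) (hR : 0 < Rf p u Y)
    (hs : 0 < sigf p u Y) : nuf p (uf p u Y) (Yf p u Y) = Rf p u Y ^ 2 * nuf p u Y := by
  have e : Yf p u Y * uf p u Y = Rf p u Y ^ qc p * (Y * u) := by
    rw [Yf, uf]; field_simp
  have e2 : qc p * (2 - 2 / p) = (2 : ℕ) := by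
    have : p - 1 ≠ 0 := by linarith
    have : p ≠ 0 := by linarith
    rw [qc]; push_cast; field_simp
  rw [nuf, e, mul_rpow (rpow_nonneg hR.le _) h0, ← rpow_mul hR.le, e2, rpow_natCast, nuf]

section Region

variable {ι : Type*} {l : Filter ι} {u Y : ι → ℝ} {p : ℝ}

lemma isBigO_log_Rf (hp : 3 ≤ p) (hu : Tendsto u l (𝓝[>] 0))
    (hY : ∀ᶠ i in l, Y i ∈ Set.Icc (1 / 2) 1)
    (he : (fun i => ef p (u i) (Y i)) =O[l] fun i => u i ^ (5 / 4 : ℝ)) :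
    (fun i => log (Rf p (u i) (Y i))) =O[l] fun i => u i ^ (5 / 4 : ℝ) := by
  have hq := qc_pos hp
  have h1 := (isBigO_log_sigf hp hu hY).trans (isLittleO_nuf hp hu hY).isBigO
  refine ((he.add h1).const_mul_left (qc p)⁻¹).congr_left fun i => ?_
  rw [ef]; field_simp; ring

lemma isBigO_Rf_sub_one (hp : 3 ≤ p) (hu : Tendsto u l (𝓝[>] 0))
    (hY : ∀ᶠ i in l, Y i ∈ Set.Icc (1 / 2) 1)
    (he : (fun i => ef p (u i) (Y i)) =O[l] fun i => u i ^ (5 / 4 : ℝ)) :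
    (fun i => Rf p (u i) (Y i) - 1) =O[l] fun i => u i ^ (5 / 4 : ℝ) := by
  have h := isBigO_log_Rf hp hu hY he
  have h0 := (h.trans (isLittleO_rpow_five_fourths hu).isBigO).trans_tendsto
    (hu.mono_right nhdsWithin_le_nhds)
  refine ((isBigO_exp_sub_one h0).trans h).congr' ?_ EventuallyEq.rfl
  filter_upwards [eventually_Rf_mem hp hu hY] with i hi
  rw [exp_log hi.1]

lemma tendsto_rpow_five_fourths (hu : Tendsto u l (𝓝[>] 0)) :
    Tendsto (fun i => u i ^ (5 / 4 : ℝ)) l (𝓝 0) :=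
  (isLittleO_rpow_five_fourths hu).isBigO.trans_tendsto (hu.mono_right nhdsWithin_le_nhds)

lemma tendsto_Rf (hp : 3 ≤ p) (hu : Tendsto u l (𝓝[>] 0))
    (hY : ∀ᶠ i in l, Y i ∈ Set.Icc (1 / 2) 1)
    (he : (fun i => ef p (u i) (Y i)) =O[l] fun i => u i ^ (5 / 4 : ℝ)) :
    Tendsto (fun i => Rf p (u i) (Y i)) l (𝓝 1) := by
  have := (isBigO_Rf_sub_one hp hu hY he).trans_tendsto (tendsto_rpow_five_fourths hu)
  simpa using this.add_const 1

lemma isBigO_one_of_mem_Icc (hY : ∀ᶠ i in l, Y i ∈ Set.Icc (1 / 2) 1) :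
    Y =O[l] fun _ => (1 : ℝ) := by
  refine IsBigO.of_bound 1 ?_
  filter_upwards [hY] with i hi
  rw [norm_of_nonneg (by linarith [hi.1])]
  simpa using hi.2

lemma isBigO_kf_sub_Y (hp : 3 ≤ p) (hu : Tendsto u l (𝓝[>] 0))
    (hY : ∀ᶠ i in l, Y i ∈ Set.Icc (1 / 2) 1)
    (he : (fun i => ef p (u i) (Y i)) =O[l] fun i => u i ^ (5 / 4 : ℝ)) :
    (fun i => kf p (u i) (Y i) - Y i) =O[l] fun i => u i ^ (5 / 4 : ℝ) := by
  have h1 := isBigO_Rf_sub_one hp hu hY he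
  have h2 := (isBigO_nf (p := p) hu hY).trans (isLittleO_nuf hp hu hY).isBigO
  have h3 := ((tendsto_Rf hp hu hY he).isBigO_one ℝ).mul h2
  simp only [one_mul] at h3
  have h4 := (isBigO_one_of_mem_Icc hY).mul (h1.add h3)
  simp only [one_mul] at h4
  refine h4.congr' ?_ EventuallyEq.rfl
  filter_upwards [hY, eventually_nf_nonneg (p := p) hu hY] with i hi hn
  have h0 : Y i ≠ 0 := by linarith [hi.1]
  have h5 : 1 + nf p (u i) (Y i) ≠ 0 := by positivity
  rw [Rf]; field_simp; ring

lemma tendsto_Y (hp : 3 ≤ p) (hu : Tendsto u l (𝓝[>] 0))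
    (hY : ∀ᶠ i in l, Y i ∈ Set.Icc (1 / 2) 1)
    (he : (fun i => ef p (u i) (Y i)) =O[l] fun i => u i ^ (5 / 4 : ℝ)) :
    Tendsto Y l (𝓝 (p / (p + 1))) := by
  have h1 := (isBigO_kf_sub_Y hp hu hY he).trans_tendsto (tendsto_rpow_five_fourths hu)
  have h2 := (isBigO_kf_sub (p := p) hu hY).trans_tendsto (hu.mono_right nhdsWithin_le_nhds)
  have h3 := ((h2.sub h1).const_add 1).mul_const (p / (p + 1))
  simp only [sub_zero, add_zero, one_mul] at h3
  refine h3.congr fun i => ?_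
  have : p ≠ 0 := by linarith
  have : p + 1 ≠ 0 := by linarith
  field_simp
  ring

lemma star_mem {p : ℝ} (hp : 3 ≤ p) : 1 / 2 < p / (p + 1) ∧ p / (p + 1) < 1 := by
  constructor
  · rw [lt_div_iff₀ (by linarith)]; linarith
  · rw [div_lt_one (by linarith)]; linarith

lemma tendsto_kf (hp : 3 ≤ p) (hu : Tendsto u l (𝓝[>] 0))
    (hY : ∀ᶠ i in l, Y i ∈ Set.Icc (1 / 2) 1)
    (he : (fun i => ef p (u i) (Y i)) =O[l] fun i => u i ^ (5 / 4 : ℝ)) :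
    Tendsto (fun i => kf p (u i) (Y i)) l (𝓝 (p / (p + 1))) := by
  have h1 := (isBigO_kf_sub_Y hp hu hY he).trans_tendsto (tendsto_rpow_five_fourths hu)
  simpa using h1.add (tendsto_Y hp hu hY he)

lemma Yf_eventuallyEq (hp : 3 ≤ p) (hu : Tendsto u l (𝓝[>] 0))
    (hY : ∀ᶠ i in l, Y i ∈ Set.Icc (1 / 2) 1) :
    (fun i => Yf p (u i) (Y i)) =ᶠ[l] fun i => Y i * exp (ef p (u i) (Y i)) := by
  filter_upwards [eventually_Rf_mem hp hu hY,
    (tendsto_sigf hp hu hY).eventually (lt_mem_nhds zero_lt_one)] with i hR hs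
  rw [Yf, ef, exp_sub, exp_log hs, mul_comm (qc p), exp_mul, exp_log hR.1, mul_div_assoc]

lemma tendsto_ef (hu : Tendsto u l (𝓝[>] 0))
    (he : (fun i => ef p (u i) (Y i)) =O[l] fun i => u i ^ (5 / 4 : ℝ)) :
    Tendsto (fun i => ef p (u i) (Y i)) l (𝓝 0) :=
  he.trans_tendsto (tendsto_rpow_five_fourths hu)

lemma isBigO_Yf_sub (hp : 3 ≤ p) (hu : Tendsto u l (𝓝[>] 0))
    (hY : ∀ᶠ i in l, Y i ∈ Set.Icc (1 / 2) 1)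
    (he : (fun i => ef p (u i) (Y i)) =O[l] fun i => u i ^ (5 / 4 : ℝ)) :
    (fun i => Yf p (u i) (Y i) - Y i) =O[l] fun i => u i ^ (5 / 4 : ℝ) := by
  have h := (isBigO_one_of_mem_Icc hY).mul ((isBigO_exp_sub_one (tendsto_ef hu he)).trans he)
  simp only [one_mul] at h
  refine h.congr' ?_ EventuallyEq.rfl
  filter_upwards [Yf_eventuallyEq hp hu hY] with i hi
  rw [hi]; ring

lemma tendsto_Yf (hp : 3 ≤ p) (hu : Tendsto u l (𝓝[>] 0))
    (hY : ∀ᶠ i in l, Y i ∈ Set.Icc (1 / 2) 1)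
    (he : (fun i => ef p (u i) (Y i)) =O[l] fun i => u i ^ (5 / 4 : ℝ)) :
    Tendsto (fun i => Yf p (u i) (Y i)) l (𝓝 (p / (p + 1))) := by
  have h1 := (isBigO_Yf_sub hp hu hY he).trans_tendsto (tendsto_rpow_five_fourths hu)
  simpa using h1.add (tendsto_Y hp hu hY he)

lemma eventually_Yf_mem (hp : 3 ≤ p) (hu : Tendsto u l (𝓝[>] 0))
    (hY : ∀ᶠ i in l, Y i ∈ Set.Icc (1 / 2) 1)
    (he : (fun i => ef p (u i) (Y i)) =O[l] fun i => u i ^ (5 / 4 : ℝ)) :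
    ∀ᶠ i in l, Yf p (u i) (Y i) ∈ Set.Icc (1 / 2) 1 :=
  (tendsto_Yf hp hu hY he).eventually (Icc_mem_nhds (star_mem hp).1 (star_mem hp).2)

lemma nuf_next (hp : 3 ≤ p) (hu : Tendsto u l (𝓝[>] 0))
    (hY : ∀ᶠ i in l, Y i ∈ Set.Icc (1 / 2) 1) :
    (fun i => nuf p (uf p (u i) (Y i)) (Yf p (u i) (Y i))) =ᶠ[l]
      fun i => Rf p (u i) (Y i) ^ 2 * nuf p (u i) (Y i) := by
  have hpos : ∀ᶠ i in l, 0 < u i := hu.eventually self_mem_nhdsWithin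
  filter_upwards [eventually_Rf_mem hp hu hY, hpos, hY,
    (tendsto_sigf hp hu hY).eventually (lt_mem_nhds zero_lt_one)] with i hR hi hYi hs
  exact nuf_uf_Yf hp (mul_nonneg (by linarith [hYi.1]) hi.le) hR.1 hs

lemma isBigO_mul_sub_mul {f f' g g' b : ι → ℝ} (hf : (fun i => f' i - f i) =O[l] b)
    (hg : (fun i => g' i - g i) =O[l] b) (h1 : f' =O[l] fun _ => (1 : ℝ))
    (h2 : g =O[l] fun _ => (1 : ℝ)) : (fun i => f' i * g' i - f i * g i) =O[l] b := by
  have h3 := h1.mul hg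
  have h4 := hf.mul h2
  simp only [one_mul, mul_one] at h3 h4
  exact (h3.add h4).congr_left fun i => by ring

/-- The change of `log kf` over one step, to first order in the logarithmic increment `ef`. -/
lemma exists_log_kf_next (hp : 3 ≤ p) (hu : Tendsto u l (𝓝[>] 0))
    (hY : ∀ᶠ i in l, Y i ∈ Set.Icc (1 / 2) 1)
    (he : (fun i => ef p (u i) (Y i)) =O[l] fun i => u i ^ (5 / 4 : ℝ)) :
    (fun i => kf p (uf p (u i) (Y i)) (Yf p (u i) (Y i)) - kf p (u i) (Y i))
      =O[l] (fun i => u i ^ (5 / 4 : ℝ)) ∧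
    ∃ θ : ι → ℝ, (∀ᶠ i in l, θ i ∈ Set.Icc 0 (1 / p)) ∧
      (fun i => log (kf p (uf p (u i) (Y i)) (Yf p (u i) (Y i))) - log (kf p (u i) (Y i))
        + (1 - u i) * θ i * ef p (u i) (Y i)) =o[l] fun i => u i * u i ^ (5 / 4 : ℝ) := by
  have hpos : ∀ᶠ i in l, 0 < u i := hu.eventually self_mem_nhdsWithin
  have hu0 : Tendsto u l (𝓝 0) := hu.mono_right nhdsWithin_le_nhds
  have hb0 := tendsto_rpow_five_fourths hu
  have hY' := eventually_Yf_mem hp hu hY he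
  have hYd := isBigO_Yf_sub hp hu hY he
  have hk := tendsto_kf hp hu hY he
  have hc : 0 < p / (p + 1) := by linarith [(star_mem hp).1]
  have hex : ∀ i, ∃ θ, 0 < u i → 0 ≤ Y i → 0 ≤ Yf p (u i) (Y i) → θ ∈ Set.Icc 0 (1 / p) ∧
      kf p (u i) (Yf p (u i) (Y i)) - kf p (u i) (Y i)
        = -((1 - u i) * θ * (Yf p (u i) (Y i) - Y i)) := by
    intro i
    by_cases h : 0 < u i ∧ 0 ≤ Y i ∧ 0 ≤ Yf p (u i) (Y i)
    · obtain ⟨θ, h1, h2⟩ := exists_kf_sub hp h.1 h.2.1 h.2.2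
      exact ⟨θ, fun _ _ _ => ⟨h1, h2⟩⟩
    · exact ⟨0, fun h1 h2 h3 => absurd ⟨h1, h2, h3⟩ h⟩
  choose θ hθ using hex
  have hθ' : ∀ᶠ i in l, θ i ∈ Set.Icc 0 (1 / p) ∧
      kf p (u i) (Yf p (u i) (Y i)) - kf p (u i) (Y i)
        = -((1 - u i) * θ i * (Yf p (u i) (Y i) - Y i)) := by
    filter_upwards [hpos, hY, hY'] with i h1 h2 h3
    exact hθ i h1 (by linarith [h2.1]) (by linarith [h3.1])
  have hm : (fun i => (1 - u i) * θ i) =O[l] fun _ => (1 : ℝ) := by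
    refine IsBigO.of_bound 1 ?_
    filter_upwards [hpos, hθ', hu0.eventually (gt_mem_nhds zero_lt_one)] with i h1 h2 h3
    have h4 : θ i ≤ 1 := h2.1.2.trans (by rw [div_le_one (by linarith)]; linarith)
    rw [norm_of_nonneg (mul_nonneg (by linarith) h2.1.1)]
    simp only [norm_one, mul_one]
    exact mul_le_one₀ (by linarith) h2.1.1 h4
  -- the intermediate value, with the old `u` and the new `Y`
  have hk1 : (fun i => kf p (u i) (Yf p (u i) (Y i)) - kf p (u i) (Y i))
      =O[l] fun i => u i ^ (5 / 4 : ℝ) := by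
    have h := (hm.mul hYd).neg_left
    simp only [one_mul] at h
    refine h.congr' ?_ EventuallyEq.rfl
    filter_upwards [hθ'] with i hi
    exact hi.2.symm
  have hk1t : Tendsto (fun i => kf p (u i) (Yf p (u i) (Y i))) l (𝓝 (p / (p + 1))) := by
    simpa using (hk1.trans_tendsto hb0).add hk
  have hk2 : (fun i => kf p (uf p (u i) (Y i)) (Yf p (u i) (Y i)) - kf p (u i) (Yf p (u i) (Y i)))
      =o[l] fun i => u i * u i ^ (5 / 4 : ℝ) := by
    have h1 := (isBigO_refl u l).mul_isLittleO
      ((isBigO_sigf_sub_one hp hu hY).trans_isLittleO (isLittleO_nuf hp hu hY))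
    refine IsBigO.trans_isLittleO (IsBigO.of_bound 2 ?_) h1
    filter_upwards [hpos, hY, hY', eventually_Rf_mem hp hu hY,
      (tendsto_uf hp hu hY).eventually self_mem_nhdsWithin] with i h1 h2 h3 h4 h5
    have h0 : 0 < Y i := by linarith [h2.1]
    have hν : 0 < nuf p (u i) (Y i) := rpow_pos_of_pos (by positivity) _
    have hR := h4.1
    have h6 : sigf p (u i) (Y i) ≤ 1 := by
      rw [sigf, div_le_one (by positivity)]
      have : 0 < Rf p (u i) (Y i) * nuf p (u i) (Y i) := by positivity
      have : 0 < Rf p (u i) (Y i) ^ 2 * nuf p (u i) (Y i) := by positivity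
      linarith
    have h7 : uf p (u i) (Y i) ≤ u i := mul_le_of_le_one_right h1.le h6
    have h8 := abs_kf_sub_le hp h5 h7 (by linarith [h3.1]) h3.2
    rw [norm_eq_abs]
    refine h8.trans ?_
    rw [norm_mul, norm_of_nonneg h1.le, norm_of_nonpos (by linarith), uf]
    linarith
  have hub : (fun i => u i * u i ^ (5 / 4 : ℝ)) =O[l] fun i => u i ^ (5 / 4 : ℝ) := by
    simpa using (hu0.isBigO_one ℝ).mul (isBigO_refl (fun i => u i ^ (5 / 4 : ℝ)) l)
  have hbb : (fun i => (u i ^ (5 / 4 : ℝ)) ^ 2) =o[l] fun i => u i * u i ^ (5 / 4 : ℝ) := by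
    simpa [pow_two] using (isLittleO_rpow_five_fourths hu).mul_isBigO
      (isBigO_refl (fun i => u i ^ (5 / 4 : ℝ)) l)
  have hk3 := hk2.isBigO.trans hub
  refine ⟨(hk3.add hk1).congr_left fun i => by ring, θ, hθ'.mono fun i h => h.1, ?_⟩
  have hk't : Tendsto (fun i => kf p (uf p (u i) (Y i)) (Yf p (u i) (Y i))) l
      (𝓝 (p / (p + 1))) := by
    simpa using (hk3.trans_tendsto hb0).add hk1t
  have L1 := (isBigO_log_sub_log hc hk't hk1t).trans_isLittleO hk2
  have hkinv : (fun i => (kf p (u i) (Y i))⁻¹) =O[l] fun _ => (1 : ℝ) :=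
    (hk.inv₀ hc.ne').isBigO_one ℝ
  have hkne : ∀ᶠ i in l, 0 < kf p (u i) (Y i) := hk.eventually (lt_mem_nhds hc)
  have hk1ne : ∀ᶠ i in l, 0 < kf p (u i) (Yf p (u i) (Y i)) := hk1t.eventually (lt_mem_nhds hc)
  have hq : Tendsto (fun i => kf p (u i) (Yf p (u i) (Y i)) / kf p (u i) (Y i)) l (𝓝 1) := by
    have := hk1t.div hk hc.ne'
    rwa [div_self hc.ne'] at this
  have hq1 : (fun i => kf p (u i) (Yf p (u i) (Y i)) / kf p (u i) (Y i) - 1)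
      =O[l] fun i => u i ^ (5 / 4 : ℝ) := by
    have h := hk1.mul hkinv
    simp only [mul_one] at h
    refine h.congr' ?_ EventuallyEq.rfl
    filter_upwards [hkne] with i hi
    field_simp
  have L2 := ((isBigO_log_sub_sub_one hq).trans (hq1.pow 2)).trans_isLittleO hbb
  have L3 : (fun i => ef p (u i) (Y i) - (Yf p (u i) (Y i) - Y i) / kf p (u i) (Y i))
      =o[l] fun i => u i * u i ^ (5 / 4 : ℝ) := by
    have e0 := tendsto_ef hu he
    have h1 := ((isBigO_exp_sub_one_sub e0).trans (he.pow 2)).neg_left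
    have h2 := (((isBigO_exp_sub_one e0).trans he).mul (isBigO_kf_sub_Y hp hu hY he)).mul hkinv
    simp only [mul_one, ← pow_two] at h2
    refine ((h1.add h2).trans_isLittleO hbb).congr' ?_ EventuallyEq.rfl
    filter_upwards [hkne, Yf_eventuallyEq hp hu hY] with i hi h3
    rw [h3]
    field_simp
    ring
  have L4 := hm.mul_isLittleO L3
  simp only [one_mul] at L4
  refine ((L1.add L2).add L4).congr' ?_ EventuallyEq.rfl
  filter_upwards [hkne, hk1ne, hθ'] with i h1 h2 h3
  have h4 : kf p (u i) (Yf p (u i) (Y i)) / kf p (u i) (Y i) - 1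
      = -((1 - u i) * θ i * (Yf p (u i) (Y i) - Y i)) / kf p (u i) (Y i) := by
    rw [← h3.2]; field_simp
  rw [h4, log_div h2.ne' h1.ne']
  ring

lemma isLittleO_nf_next_sub (hp : 3 ≤ p) (hu : Tendsto u l (𝓝[>] 0))
    (hY : ∀ᶠ i in l, Y i ∈ Set.Icc (1 / 2) 1)
    (he : (fun i => ef p (u i) (Y i)) =O[l] fun i => u i ^ (5 / 4 : ℝ)) :
    (fun i => nf p (uf p (u i) (Y i)) (Yf p (u i) (Y i)) - nf p (u i) (Y i))
      =o[l] fun i => u i * u i ^ (5 / 4 : ℝ) := by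
  have hpos : ∀ᶠ i in l, 0 < u i := hu.eventually self_mem_nhdsWithin
  have hu0 : Tendsto u l (𝓝 0) := hu.mono_right nhdsWithin_le_nhds
  have hY' := eventually_Yf_mem hp hu hY he
  have hu' := tendsto_uf hp hu hY
  have hc : 0 < p / (p + 1) := by linarith [(star_mem hp).1]
  have hνu : (fun i => nuf p (u i) (Y i)) =o[l] u :=
    (isLittleO_nuf hp hu hY).trans (isLittleO_rpow_five_fourths hu)
  have hνb := isLittleO_nuf hp hu hY
  have hR1 := isBigO_Rf_sub_one hp hu hY he
  have hRb := (tendsto_Rf hp hu hY he).isBigO_one ℝ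
  have hR2 : (fun i => Rf p (u i) (Y i) ^ 2 - 1) =O[l] fun i => u i ^ (5 / 4 : ℝ) := by
    have h := (hRb.add (isBigO_refl (fun _ => (1:ℝ)) l)).mul hR1
    simp only [one_mul] at h
    exact h.congr_left fun i => by ring
  have hA1 := (tendsto_one_add_rpow (p := p) hu hY).isBigO_one ℝ
  have hA2 := (tendsto_one_add_rpow (p := p) hu' hY').isBigO_one ℝ
  have hz : (fun i => Yf p (u i) (Y i) * uf p (u i) (Y i) - Y i * u i)
      =O[l] fun i => u i ^ (5 / 4 : ℝ) := by
    have hs : (fun i => uf p (u i) (Y i) - u i) =O[l] fun i => u i ^ (5 / 4 : ℝ) := by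
      have h := (hu0.isBigO_one ℝ).mul ((isBigO_sigf_sub_one hp hu hY).trans hνb.isBigO)
      simp only [one_mul] at h
      exact h.congr_left fun i => by rw [uf]; ring
    exact isBigO_mul_sub_mul (isBigO_Yf_sub hp hu hY he) hs
      ((tendsto_Yf hp hu hY he).isBigO_one ℝ) (hu0.isBigO_one ℝ)
  have hA : (fun i => (1 + Yf p (u i) (Y i) * uf p (u i) (Y i)) ^ (1 / p)
      - (1 + Y i * u i) ^ (1 / p)) =O[l] fun i => u i ^ (5 / 4 : ℝ) := by
    refine IsBigO.trans (IsBigO.of_bound 1 ?_) hz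
    filter_upwards [hpos, hY, hY', hu'.eventually self_mem_nhdsWithin] with i h1 h2 h3 h4
    have h4' : 0 < uf p (u i) (Y i) := h4
    have hs1 : 1 / p ≤ 1 := by rw [div_le_one (by linarith)]; linarith
    obtain ⟨θ, hθ, h5⟩ := exists_one_add_rpow_sub (s := 1 / p) (by positivity) hs1
      (mul_nonneg (by linarith [h2.1] : 0 ≤ Y i) h1.le)
      (mul_nonneg (by linarith [h3.1] : 0 ≤ Yf p (u i) (Y i)) h4'.le)
    rw [h5, norm_mul, norm_of_nonneg hθ.1]
    exact mul_le_mul_of_nonneg_right (hθ.2.trans hs1) (norm_nonneg _)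
  have hYi : (fun i => (Yf p (u i) (Y i))⁻¹ - (Y i)⁻¹) =O[l] fun i => u i ^ (5 / 4 : ℝ) := by
    have h := ((isBigO_Yf_sub hp hu hY he).neg_left.mul
      (((tendsto_Yf hp hu hY he).inv₀ hc.ne').isBigO_one ℝ)).mul
      (((tendsto_Y hp hu hY he).inv₀ hc.ne').isBigO_one ℝ)
    simp only [mul_one] at h
    refine h.congr' ?_ EventuallyEq.rfl
    filter_upwards [hY, hY'] with i h2 h3
    have : Y i ≠ 0 := by linarith [h2.1]
    have : Yf p (u i) (Y i) ≠ 0 := by linarith [h3.1]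
    field_simp
    ring
  have h1 := isBigO_mul_sub_mul (g := fun i => (1 + Y i * u i) ^ (1 / p)) hR2 hA
    (by simpa using hRb.pow 2) hA1
  have h1' : (fun i => Rf p (u i) (Y i) ^ 2 * (1 + Yf p (u i) (Y i) * uf p (u i) (Y i)) ^ (1 / p))
      =O[l] fun _ => (1 : ℝ) := by
    simpa using (hRb.pow 2).mul hA2
  have h2 := isBigO_mul_sub_mul h1 hYi h1' (((tendsto_Y hp hu hY he).inv₀ hc.ne').isBigO_one ℝ)
  refine (hνu.mul_isBigO h2).congr' ?_ EventuallyEq.rfl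
  filter_upwards [nuf_next hp hu hY] with i hi
  rw [nf, nf, hi]
  ring

lemma isBigO_uf_rpow (hp : 3 ≤ p) (hu : Tendsto u l (𝓝[>] 0))
    (hY : ∀ᶠ i in l, Y i ∈ Set.Icc (1 / 2) 1) :
    (fun i => uf p (u i) (Y i) ^ (5 / 4 : ℝ)) =O[l] fun i => u i ^ (5 / 4 : ℝ) := by
  have hpos : ∀ᶠ i in l, 0 < u i := hu.eventually self_mem_nhdsWithin
  have hs : Tendsto (fun i => sigf p (u i) (Y i) ^ (5 / 4 : ℝ)) l (𝓝 1) := by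
    simpa using (tendsto_sigf hp hu hY).rpow_const (p := 5 / 4) (Or.inr (by norm_num))
  have h := (isBigO_refl (fun i => u i ^ (5 / 4 : ℝ)) l).mul (hs.isBigO_one ℝ)
  simp only [mul_one] at h
  refine h.congr' ?_ EventuallyEq.rfl
  filter_upwards [hpos, (tendsto_sigf hp hu hY).eventually (lt_mem_nhds zero_lt_one)] with i h1 h2
  rw [uf, mul_rpow h1.le h2.le]

lemma isBigO_Rf_next_sub_one (hp : 3 ≤ p) (hu : Tendsto u l (𝓝[>] 0))
    (hY : ∀ᶠ i in l, Y i ∈ Set.Icc (1 / 2) 1)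
    (he : (fun i => ef p (u i) (Y i)) =O[l] fun i => u i ^ (5 / 4 : ℝ)) :
    (fun i => Rf p (uf p (u i) (Y i)) (Yf p (u i) (Y i)) - 1)
      =O[l] fun i => u i ^ (5 / 4 : ℝ) := by
  have hY' := eventually_Yf_mem hp hu hY he
  have hu' := tendsto_uf hp hu hY
  have hc : 0 < p / (p + 1) := by linarith [(star_mem hp).1]
  have hk' := (exists_log_kf_next hp hu hY he).1
  have h1 := (hk'.add (isBigO_kf_sub_Y hp hu hY he)).sub (isBigO_Yf_sub hp hu hY he)
  have hR : (fun i => Rf p (uf p (u i) (Y i)) (Yf p (u i) (Y i))) =O[l] fun _ => (1 : ℝ) := by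
    refine IsBigO.of_bound 4 ?_
    filter_upwards [eventually_Rf_mem hp hu' hY'] with i hi
    rw [norm_of_nonneg hi.1.le]
    simpa using hi.2
  have hYb := (tendsto_Yf hp hu hY he).isBigO_one ℝ
  have hn := ((isBigO_nf (p := p) hu' hY').trans (isLittleO_nuf hp hu' hY').isBigO).trans
    (isBigO_uf_rpow hp hu hY)
  have h2 := (hR.mul hYb).mul hn
  simp only [one_mul] at h2
  have h3 := (h1.sub h2).mul (((tendsto_Yf hp hu hY he).inv₀ hc.ne').isBigO_one ℝ)
  simp only [mul_one] at h3
  refine h3.congr' ?_ EventuallyEq.rfl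
  filter_upwards [hY', eventually_nf_nonneg (p := p) hu' hY'] with i hYi hni
  have h5 : Yf p (u i) (Y i) ≠ 0 := by linarith [hYi.1]
  have h6 : 1 + nf p (uf p (u i) (Y i)) (Yf p (u i) (Y i)) ≠ 0 := by positivity
  rw [Rf]
  field_simp
  ring

lemma isLittleO_log_sigf_next_sub (hp : 3 ≤ p) (hu : Tendsto u l (𝓝[>] 0))
    (hY : ∀ᶠ i in l, Y i ∈ Set.Icc (1 / 2) 1)
    (he : (fun i => ef p (u i) (Y i)) =O[l] fun i => u i ^ (5 / 4 : ℝ)) :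
    (fun i => log (sigf p (uf p (u i) (Y i)) (Yf p (u i) (Y i))) - log (sigf p (u i) (Y i)))
      =o[l] fun i => u i * u i ^ (5 / 4 : ℝ) := by
  have hpos : ∀ᶠ i in l, 0 < u i := hu.eventually self_mem_nhdsWithin
  have hY' := eventually_Yf_mem hp hu hY he
  have hu' := tendsto_uf hp hu hY
  have hνu : (fun i => nuf p (u i) (Y i)) =o[l] u :=
    (isLittleO_nuf hp hu hY).trans (isLittleO_rpow_five_fourths hu)
  have hν := tendsto_nuf hp hu hY
  have hR := isBigO_Rf_sub_one hp hu hY he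
  have hR' := isBigO_Rf_next_sub_one hp hu hY he
  have hRb := (tendsto_Rf hp hu hY he).isBigO_one ℝ
  have hRb' : (fun i => Rf p (uf p (u i) (Y i)) (Yf p (u i) (Y i))) =O[l] fun _ => (1 : ℝ) := by
    have := (hR'.trans_tendsto (tendsto_rpow_five_fourths hu)).add_const 1
    simpa using this.isBigO_one ℝ
  have hRR : (fun i => Rf p (uf p (u i) (Y i)) (Yf p (u i) (Y i)) * Rf p (u i) (Y i) - 1 * 1)
      =O[l] fun i => u i ^ (5 / 4 : ℝ) :=
    isBigO_mul_sub_mul hR' hR hRb' (isBigO_refl _ _)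
  have hRRb : (fun i => Rf p (uf p (u i) (Y i)) (Yf p (u i) (Y i)) * Rf p (u i) (Y i))
      =O[l] fun _ => (1 : ℝ) := by simpa using hRb'.mul hRb
  -- the two differences `R' ν' - R ν` and `R'² ν' - R² ν`, divided by `ν`
  have h1 := (isBigO_mul_sub_mul hRR hR hRRb (isBigO_refl _ _)).sub hR
  have h2 := (isBigO_mul_sub_mul hRR hRR hRRb (isBigO_refl (fun _ => (1:ℝ) * 1) l |>.trans
    (by simpa using isBigO_refl (fun _ => (1:ℝ)) l))).sub
    (isBigO_mul_sub_mul hR hR hRb (isBigO_refl (fun _ => (1:ℝ)) l))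
  have k1 := hνu.mul_isBigO h1
  have k2 := hνu.mul_isBigO h2
  have t1 : Tendsto (fun i => 1 - Rf p (u i) (Y i) * nuf p (u i) (Y i)) l (𝓝 1) := by
    simpa using ((tendsto_Rf hp hu hY he).mul hν).const_sub 1
  have t2 : Tendsto (fun i => 1 + Rf p (u i) (Y i) ^ 2 * nuf p (u i) (Y i)) l (𝓝 1) := by
    simpa using (((tendsto_Rf hp hu hY he).pow 2).mul hν).const_add 1
  have htR' : Tendsto (fun i => Rf p (uf p (u i) (Y i)) (Yf p (u i) (Y i))) l (𝓝 1) := by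
    have := (hR'.trans_tendsto (tendsto_rpow_five_fourths hu)).add_const 1
    simpa using this
  have hν' := tendsto_nuf hp hu' hY'
  have t1' : Tendsto (fun i => 1 - Rf p (uf p (u i) (Y i)) (Yf p (u i) (Y i))
      * nuf p (uf p (u i) (Y i)) (Yf p (u i) (Y i))) l (𝓝 1) := by
    simpa using (htR'.mul hν').const_sub 1
  have t2' : Tendsto (fun i => 1 + Rf p (uf p (u i) (Y i)) (Yf p (u i) (Y i)) ^ 2
      * nuf p (uf p (u i) (Y i)) (Yf p (u i) (Y i))) l (𝓝 1) := by
    simpa using ((htR'.pow 2).mul hν').const_add 1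
  have d1 := (isBigO_log_sub_log one_pos t1' t1).trans_isLittleO
    (k1.neg_left.congr' (f₂ := fun i => (1 - Rf p (uf p (u i) (Y i)) (Yf p (u i) (Y i))
      * nuf p (uf p (u i) (Y i)) (Yf p (u i) (Y i)))
      - (1 - Rf p (u i) (Y i) * nuf p (u i) (Y i))) (by
        filter_upwards [nuf_next hp hu hY] with i hi
        rw [hi]; ring) EventuallyEq.rfl)
  have d2 := (isBigO_log_sub_log one_pos t2' t2).trans_isLittleO
    (k2.congr' (f₂ := fun i => (1 + Rf p (uf p (u i) (Y i)) (Yf p (u i) (Y i)) ^ 2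
      * nuf p (uf p (u i) (Y i)) (Yf p (u i) (Y i)))
      - (1 + Rf p (u i) (Y i) ^ 2 * nuf p (u i) (Y i))) (by
        filter_upwards [nuf_next hp hu hY] with i hi
        rw [hi]; ring) EventuallyEq.rfl)
  refine (d1.sub d2).congr' ?_ EventuallyEq.rfl
  filter_upwards [t1.eventually_ne one_ne_zero, t2.eventually_ne one_ne_zero,
    t1'.eventually_ne one_ne_zero, t2'.eventually_ne one_ne_zero] with i e1 e2 e3 e4
  rw [sigf, sigf, log_div e3 e4, log_div e1 e2]
  ring

lemma exists_ef_next (hp : 3 ≤ p) (hu : Tendsto u l (𝓝[>] 0))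
    (hY : ∀ᶠ i in l, Y i ∈ Set.Icc (1 / 2) 1)
    (he : (fun i => ef p (u i) (Y i)) =O[l] fun i => u i ^ (5 / 4 : ℝ)) :
    ∃ θ : ι → ℝ, (∀ᶠ i in l, θ i ∈ Set.Icc 0 (1 / p)) ∧
      (fun i => ef p (uf p (u i) (Y i)) (Yf p (u i) (Y i))
        + (qc p - 1 + qc p * ((1 - u i) * θ i)) * ef p (u i) (Y i))
        =o[l] fun i => u i * u i ^ (5 / 4 : ℝ) := by
  obtain ⟨-, θ, hθ, hk⟩ := exists_log_kf_next hp hu hY he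
  refine ⟨θ, hθ, ?_⟩
  have hY' := eventually_Yf_mem hp hu hY he
  have hu' := tendsto_uf hp hu hY
  have hn := tendsto_nuf hp hu hY
  have t : Tendsto (fun i => 1 + nf p (u i) (Y i)) l (𝓝 1) := by
    simpa using ((isBigO_nf (p := p) hu hY).trans_tendsto (tendsto_nuf hp hu hY)).const_add 1
  have t' : Tendsto (fun i => 1 + nf p (uf p (u i) (Y i)) (Yf p (u i) (Y i))) l (𝓝 1) := by
    simpa using ((isBigO_nf (p := p) hu' hY').trans_tendsto (tendsto_nuf hp hu' hY')).const_add 1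
  have h1 := (isBigO_log_sub_log one_pos t' t).trans_isLittleO
    ((isLittleO_nf_next_sub hp hu hY he).congr_left (fun i => (add_sub_add_left_eq_sub _ _ 1).symm))
  have h2 := isLittleO_log_sigf_next_sub hp hu hY he
  refine (((hk.sub h1).const_mul_left (qc p)).sub h2).congr' ?_ EventuallyEq.rfl
  filter_upwards [hY, hY', eventually_kf_mem hp hu hY, eventually_kf_mem hp hu' hY',
    eventually_nf_nonneg (p := p) hu hY, eventually_nf_nonneg (p := p) hu' hY',
    Yf_eventuallyEq hp hu hY] with i y1 y2 k1 k2 n1 n2 hYe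
  have hy1 : 0 < Y i := by linarith [y1.1]
  have hy2 : 0 < Yf p (u i) (Y i) := by linarith [y2.1]
  have hk1 : kf p (u i) (Y i) ≠ 0 := by linarith [k1.1]
  have hk2 : kf p (uf p (u i) (Y i)) (Yf p (u i) (Y i)) ≠ 0 := by linarith [k2.1]
  have e1 : log (Rf p (u i) (Y i)) = log (kf p (u i) (Y i)) - (log (Y i)
      + log (1 + nf p (u i) (Y i))) := by
    rw [Rf, log_div hk1 (by positivity), log_mul hy1.ne' (by positivity)]
  have e2 : log (Rf p (uf p (u i) (Y i)) (Yf p (u i) (Y i)))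
      = log (kf p (uf p (u i) (Y i)) (Yf p (u i) (Y i))) - (log (Yf p (u i) (Y i))
      + log (1 + nf p (uf p (u i) (Y i)) (Yf p (u i) (Y i)))) := by
    rw [Rf, log_div hk2 (by positivity), log_mul hy2.ne' (by positivity)]
  have e3 : log (Yf p (u i) (Y i)) = log (Y i) + ef p (u i) (Y i) := by
    rw [hYe, log_mul hy1.ne' (exp_pos _).ne', log_exp]
  have e4 : ef p (u i) (Y i) = qc p * log (Rf p (u i) (Y i)) - log (sigf p (u i) (Y i)) := rfl
  have e5 : ef p (uf p (u i) (Y i)) (Yf p (u i) (Y i))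
      = qc p * log (Rf p (uf p (u i) (Y i)) (Yf p (u i) (Y i)))
        - log (sigf p (uf p (u i) (Y i)) (Yf p (u i) (Y i))) := rfl
  rw [e5, e2, e3]
  rw [e1] at e4
  linear_combination e4

/-- The region `|log (Y' / Y)| ≤ u ^ (5/4)` is eventually preserved by the step. -/
lemma eventually_abs_ef_next_le (hp : 3 ≤ p) (hu : Tendsto u l (𝓝[>] 0))
    (hY : ∀ᶠ i in l, Y i ∈ Set.Icc (1 / 2) 1)
    (he : ∀ᶠ i in l, |ef p (u i) (Y i)| ≤ u i ^ (5 / 4 : ℝ)) :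
    ∀ᶠ i in l, |ef p (uf p (u i) (Y i)) (Yf p (u i) (Y i))| ≤ uf p (u i) (Y i) ^ (5 / 4 : ℝ) := by
  have hpos : ∀ᶠ i in l, 0 < u i := hu.eventually self_mem_nhdsWithin
  have hu0 : Tendsto u l (𝓝 0) := hu.mono_right nhdsWithin_le_nhds
  have he' : (fun i => ef p (u i) (Y i)) =O[l] fun i => u i ^ (5 / 4 : ℝ) := by
    refine IsBigO.of_bound 1 ?_
    filter_upwards [he] with i hi
    rw [one_mul]
    exact hi.trans (le_abs_self _)
  obtain ⟨θ, hθ, h⟩ := exists_ef_next hp hu hY he'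
  have hνu : (fun i => nuf p (u i) (Y i)) =o[l] u :=
    (isLittleO_nuf hp hu hY).trans (isLittleO_rpow_five_fourths hu)
  have hs := ((isBigO_sigf_sub_one hp hu hY).trans_isLittleO hνu).bound
    (show (0:ℝ) < 1 / 8 by norm_num)
  filter_upwards [hpos, hu0.eventually (gt_mem_nhds zero_lt_one), he, hθ,
    h.bound (show (0:ℝ) < 1 / 8 by norm_num), hs,
    hY, eventually_Rf_mem hp hu hY] with i h0 h1 hei hθi hi hsi hYi hRi
  have hb : 0 < u i ^ (5 / 4 : ℝ) := rpow_pos_of_pos h0 _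
  rw [norm_of_nonneg (by positivity : 0 ≤ u i * u i ^ (5 / 4 : ℝ)), norm_eq_abs] at hi
  rw [norm_of_nonneg h0.le, norm_eq_abs] at hsi
  have hp1 : 0 < p - 1 := by linarith
  have hq : qc p - 1 = 1 / (p - 1) := by rw [qc]; field_simp; ring
  have hτ : 1 / (p - 1) ≤ 1 / 2 := by gcongr; linarith
  have hqθ : qc p * θ i ≤ 1 / (p - 1) := by
    calc qc p * θ i ≤ qc p * (1 / p) := mul_le_mul_of_nonneg_left hθi.2 (qc_pos hp).le
      _ = 1 / (p - 1) := by rw [qc]; field_simp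
  have hqθ0 : 0 ≤ qc p * θ i := mul_nonneg (qc_pos hp).le hθi.1
  set m := qc p - 1 + qc p * ((1 - u i) * θ i) with hm
  have hm0 : 0 ≤ m := by
    have : 0 ≤ 1 / (p - 1) := by positivity
    have : 0 ≤ (1 - u i) * (qc p * θ i) := mul_nonneg (by linarith) hqθ0
    rw [hm, hq]; linarith
  have hm1 : m ≤ 1 - u i / 2 := by
    have h3 : (1 - u i) * (qc p * θ i) ≤ (1 - u i) * (1 / 2) :=
      mul_le_mul_of_nonneg_left (hqθ.trans hτ) (by linarith)
    rw [hm, hq]; linarith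
  have hme : |m * ef p (u i) (Y i)| ≤ (1 - u i / 2) * u i ^ (5 / 4 : ℝ) := by
    rw [abs_mul, abs_of_nonneg hm0]
    exact mul_le_mul hm1 hei (abs_nonneg _) (by linarith)
  have hstep : |ef p (uf p (u i) (Y i)) (Yf p (u i) (Y i))| ≤ (1 - u i / 4) * u i ^ (5 / 4 : ℝ) := by
    rw [abs_le] at hi hme ⊢
    have := mul_pos h0 hb
    constructor <;> linarith [hi.1, hi.2, hme.1, hme.2]
  refine hstep.trans ?_
  have hsi' := (abs_le.1 hsi).1
  have hσ0 : 0 < sigf p (u i) (Y i) := by linarith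
  have hσ1 : sigf p (u i) (Y i) ≤ 1 := by
    have hY0 : 0 < Y i := by linarith [hYi.1]
    have hν : 0 < nuf p (u i) (Y i) := rpow_pos_of_pos (by positivity) _
    have hR := hRi.1
    rw [sigf, div_le_one (by positivity)]
    have : 0 < Rf p (u i) (Y i) * nuf p (u i) (Y i) := by positivity
    have : 0 < Rf p (u i) (Y i) ^ 2 * nuf p (u i) (Y i) := by positivity
    linarith
  have hσ : sigf p (u i) (Y i) ^ 2 ≤ sigf p (u i) (Y i) ^ (5 / 4 : ℝ) := by
    rw [← rpow_natCast]
    exact rpow_le_rpow_of_exponent_ge hσ0 hσ1 (by norm_num)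
  rw [uf, mul_rpow h0.le hσ0.le, mul_comm]
  refine mul_le_mul_of_nonneg_left ?_ hb.le
  nlinarith

end Region

/-- The region in which the slow-start trajectory stays. -/
def Region (p u Y : ℝ) : Prop := Y ∈ Set.Icc (1 / 2) 1 ∧ |ef p u Y| ≤ u ^ (5 / 4 : ℝ)

lemma exists_region_step {p : ℝ} (hp : 3 ≤ p) :
    ∃ δ > 0, ∀ u ∈ Set.Ioc 0 δ, ∀ Y, Region p u Y → u < 1 ∧ 0 < kf p u Y ∧ 0 < sigf p u Y ∧
      Rf p u Y * nuf p u Y * (1 + Y * u) ^ (1 / p) ≤ Y ∧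
      Region p (uf p u Y) (Yf p u Y) := by
  set l : Filter (ℝ × ℝ) := comap Prod.fst (𝓝[>] 0) ⊓ 𝓟 {a | Region p a.1 a.2}
  have hu : Tendsto Prod.fst l (𝓝[>] (0:ℝ)) := tendsto_comap.mono_left inf_le_left
  have hreg : ∀ᶠ a in l, Region p a.1 a.2 := mem_inf_of_right (mem_principal_self _)
  have hY : ∀ᶠ a in l, a.2 ∈ Set.Icc (1 / 2) 1 := hreg.mono fun _ h => h.1
  have he := hreg.mono fun _ h => h.2
  have heO : (fun a : ℝ × ℝ => ef p a.1 a.2) =O[l] fun a => a.1 ^ (5 / 4 : ℝ) := by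
    refine IsBigO.of_bound 1 (he.mono fun a ha => ?_)
    rw [one_mul]
    exact ha.trans (le_abs_self _)
  have hls : Tendsto (fun a : ℝ × ℝ => Rf p a.1 a.2 * nuf p a.1 a.2 * (1 + a.2 * a.1) ^ (1 / p))
      l (𝓝 0) := by
    simpa using ((tendsto_Rf hp hu hY heO).mul (tendsto_nuf hp hu hY)).mul
      (tendsto_one_add_rpow (p := p) hu hY)
  have key : ∀ᶠ a in l, a.1 < 1 ∧ 0 < kf p a.1 a.2 ∧ 0 < sigf p a.1 a.2 ∧
      Rf p a.1 a.2 * nuf p a.1 a.2 * (1 + a.2 * a.1) ^ (1 / p) ≤ a.2 ∧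
      Region p (uf p a.1 a.2) (Yf p a.1 a.2) := by
    filter_upwards [(hu.mono_right nhdsWithin_le_nhds).eventually (gt_mem_nhds zero_lt_one),
      eventually_kf_mem hp hu hY,
      (tendsto_sigf hp hu hY).eventually (lt_mem_nhds zero_lt_one),
      hls.eventually (gt_mem_nhds (show (0:ℝ) < 1 / 2 by norm_num)), hY,
      eventually_Yf_mem hp hu hY heO, eventually_abs_ef_next_le hp hu hY he]
      with a h1 h2 h3 h4 h5 h6 h7
    exact ⟨h1, by linarith [h2.1], h3, h4.le.trans h5.1, h6, h7⟩
  rw [eventually_inf_principal, eventually_comap] at key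
  obtain ⟨δ, hδ, h⟩ := mem_nhdsGT_iff_exists_Ioc_subset.1 key
  exact ⟨δ, hδ, fun u hu Y hR => h hu (u, Y) rfl hR⟩

section Initial

variable {p : ℝ}

lemma Cp_pos (hp : 3 ≤ p) : 0 < Cp p := rpow_pos_of_pos (by positivity) _

lemma Cp_rpow_qc (hp : 3 ≤ p) : Cp p ^ qc p = p / (p + 1) := by
  rw [Cp, ← rpow_mul (by positivity), one_div_mul_cancel (qc_pos hp).ne', rpow_one]

lemma tendsto_id_nhdsGT : Tendsto (fun u : ℝ => u) (𝓝[>] 0) (𝓝 0) :=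
  tendsto_id.mono_right nhdsWithin_le_nhds

/-- The initial value of `Y = (|w| / u)^q / u`, to second order. -/
lemma isBigO_initial_sub (hp : 3 ≤ p) :
    (fun u => (Cp p + Dp p * u) ^ qc p
      - p / (p + 1) * (1 + (3 * p + 1) / (2 * (p + 1) ^ 2) * u)) =O[𝓝[>] 0] fun u => u ^ 2 := by
  have hC := Cp_pos hp
  set d := Dp p / Cp p with hd
  have hd0 : 0 ≤ d := by
    have : 0 < p - 1 := by linarith
    rw [hd, Dp]; positivity
  have hqd : qc p * d = (3 * p + 1) / (2 * (p + 1) ^ 2) := by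
    have : p - 1 ≠ 0 := by linarith
    have : p ≠ 0 := by linarith
    rw [hd, Dp, qc]; field_simp
  have hf : Tendsto (fun u : ℝ => d * u) (𝓝[>] 0) (𝓝 0) := by
    simpa using tendsto_id_nhdsGT.const_mul d
  have h := (isBigO_one_add_rpow (qc p) 2 hf).trans
    (((isBigO_refl (fun u : ℝ => u) (𝓝[>] 0)).const_mul_left d).pow 2)
  refine (h.const_mul_left (p / (p + 1))).congr' ?_ EventuallyEq.rfl
  filter_upwards [self_mem_nhdsWithin] with u (hu : 0 < u)
  have e : Cp p + Dp p * u = Cp p * (1 + d * u) := by rw [hd]; field_simp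
  rw [e, mul_rpow hC.le (by positivity), Cp_rpow_qc hp]
  simp only [Finset.sum_range_succ, Finset.sum_range_zero, Ring.choose_zero_right,
    Ring.choose_one_right, pow_zero, pow_one]
  linear_combination -(p / (p + 1) * u) * hqd

lemma choose_two_right (a : ℝ) : Ring.choose a 2 = a * (a - 1) / 2 := by
  rw [Ring.choose_eq_smul, descPochhammer_succ_right, descPochhammer_one]
  simp [Polynomial.smeval_mul, Polynomial.smeval_sub, Polynomial.smeval_X]
  ring

lemma tendsto_initial (hp : 3 ≤ p) :
    Tendsto (fun u => (Cp p + Dp p * u) ^ qc p) (𝓝[>] 0) (𝓝 (p / (p + 1))) := by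
  have h := (tendsto_id_nhdsGT.const_mul (Dp p)).const_add (Cp p)
  have := h.rpow_const (p := qc p) (Or.inr (qc_pos hp).le)
  rwa [mul_zero, add_zero, Cp_rpow_qc hp] at this

lemma isBigO_kf_initial_sub (hp : 3 ≤ p) :
    (fun u => kf p u ((Cp p + Dp p * u) ^ qc p) - (Cp p + Dp p * u) ^ qc p)
      =O[𝓝[>] 0] fun u => u ^ 2 := by
  have hp0 : p ≠ 0 := by linarith
  have hp1 : p + 1 ≠ 0 := by linarith
  set l : Filter ℝ := 𝓝[>] 0
  set Y : ℝ → ℝ := fun u => (Cp p + Dp p * u) ^ qc p with hYdef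
  have hu : Tendsto (fun u : ℝ => u) l (𝓝[>] 0) := tendsto_id
  have hu0 : Tendsto (fun u : ℝ => u) l (𝓝 0) := tendsto_id_nhdsGT
  have hYt : Tendsto Y l (𝓝 (p / (p + 1))) := tendsto_initial hp
  have hY1 : Y =O[l] fun _ => (1:ℝ) := hYt.isBigO_one ℝ
  have hz : Tendsto (fun u => Y u * u) l (𝓝 0) := by simpa using hYt.mul hu0
  have hzO : (fun u => Y u * u) =O[l] fun u => u := by
    simpa using hY1.mul (isBigO_refl (fun u : ℝ => u) l)
  have hE1 := (isBigO_one_add_rpow (1 / p) 3 hz).trans (hzO.pow 3)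
  have hE2 : (fun u => Y u - p / (p + 1) * (1 + (3 * p + 1) / (2 * (p + 1) ^ 2) * u)) =O[l]
      fun u => u ^ 2 := isBigO_initial_sub hp
  have h1 : (fun u : ℝ => 1 - u) =O[l] fun _ => (1:ℝ) := (hu0.const_sub 1).isBigO_one ℝ
  have hdY : (fun u => Y u - p / (p + 1)) =O[l] fun u => u := by
    have a : (fun u : ℝ => u ^ 2) =O[l] fun u => u := by
      simpa [sq] using (hu0.isBigO_one ℝ).mul (isBigO_refl (fun u : ℝ => u) l)
    refine ((hE2.trans a).add ((isBigO_refl (fun u : ℝ => u) l).const_mul_left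
      (p / (p + 1) * ((3 * p + 1) / (2 * (p + 1) ^ 2))))).congr_left fun u => ?_
    ring
  set c := Ring.choose (1 / p) 2 with hc
  have hc' : c = -((p - 1) / (2 * p ^ 2)) := by
    rw [hc, choose_two_right]; field_simp; ring
  have hE1' : (fun u => (1 - u) * (((1 + Y u * u) ^ (1 / p)
      - ∑ k ∈ Finset.range 3, Ring.choose (1 / p) k * (Y u * u) ^ k) / u)) =O[l]
      fun u => u ^ 2 := by
    have a := h1.mul (hE1.mul (isBigO_refl (fun u : ℝ => u⁻¹) l))
    refine a.congr' (by simp [div_eq_mul_inv]) ?_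
    filter_upwards [self_mem_nhdsWithin] with u (hu : 0 < u)
    field_simp
  have h2 : (fun u => u * (Y u - p / (p + 1))) =O[l] fun u => u ^ 2 := by
    simpa [sq] using (isBigO_refl (fun u : ℝ => u) l).mul hdY
  have h3 : (fun u => u * (Y u - p / (p + 1)) * (Y u + p / (p + 1))) =O[l] fun u => u ^ 2 := by
    simpa using h2.mul ((hYt.add_const (p / (p + 1))).isBigO_one ℝ)
  have h4 : (fun u => (Y u * u) ^ 2) =O[l] fun u => u ^ 2 := hzO.pow 2
  refine (((((hE2.const_mul_left (-(1 + 1 / p))).add (h2.const_mul_left (1 / p))).sub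
    (h3.const_mul_left c)).add (h4.const_mul_left c)).sub hE1').congr' ?_ EventuallyEq.rfl
  filter_upwards [self_mem_nhdsWithin] with u (hu : 0 < u)
  rw [kf]
  simp only [Finset.sum_range_succ, Finset.sum_range_zero, Ring.choose_zero_right,
    Ring.choose_one_right, pow_zero, pow_one, ← hc]
  rw [hc']
  change _ = (1 - (1 - u) * (1 + Y u * u) ^ (1 / p)) / u - Y u
  field_simp
  ring

/-- The slow-start initialization lies in the region. -/
lemma exists_region_initial (hp : 3 ≤ p) :
    ∃ δ > 0, ∀ u ∈ Set.Ioc 0 δ, Region p u ((Cp p + Dp p * u) ^ qc p) := by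
  have hp0 : 0 < p / (p + 1) := by positivity
  have hu : Tendsto (fun u : ℝ => u) (𝓝[>] 0) (𝓝[>] 0) := tendsto_id
  have hYt := tendsto_initial hp
  have hY := hYt.eventually (Icc_mem_nhds (star_mem hp).1 (star_mem hp).2)
  have hν := isLittleO_nuf hp hu hY
  have hsq : (fun u : ℝ => u ^ 2) =o[𝓝[>] 0] fun u => u ^ (5 / 4 : ℝ) := by
    have h1 : Tendsto (fun u : ℝ => u ^ (3 / 4 : ℝ)) (𝓝[>] 0) (𝓝 0) := by
      simpa using tendsto_id_nhdsGT.rpow_const (p := 3 / 4) (Or.inr (by norm_num))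
    refine (((isLittleO_one_iff ℝ).2 h1).mul_isBigO
      (isBigO_refl (fun u : ℝ => u ^ (5 / 4 : ℝ)) (𝓝[>] 0))).congr' ?_ (by simp)
    filter_upwards [self_mem_nhdsWithin] with u (hu : 0 < u)
    rw [← rpow_add hu, ← rpow_natCast]
    norm_num
  have hk := (isBigO_kf_initial_sub hp).trans_isLittleO hsq
  have hkt : Tendsto (fun u => kf p u ((Cp p + Dp p * u) ^ qc p)) (𝓝[>] 0) (𝓝 (p / (p + 1))) := by
    simpa using (hk.isBigO.trans_tendsto (tendsto_rpow_five_fourths hu)).add hYt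
  have hlog := (isBigO_log_sub_log hp0 hkt hYt).trans_isLittleO hk
  have hn := isBigO_nf (p := p) hu hY
  have hnt := hn.trans_tendsto (tendsto_nuf hp hu hY)
  have hlogn := ((isBigO_log_sub_one (by simpa using hnt.const_add 1)).trans
    (hn.congr_left fun u => by ring)).trans_isLittleO hν
  have hlogs := (isBigO_log_sigf hp hu hY).trans_isLittleO hν
  have he := (((hlog.sub hlogn).const_mul_left (qc p)).sub hlogs).bound one_pos
  have key : ∀ᶠ u in 𝓝[>] 0, Region p u ((Cp p + Dp p * u) ^ qc p) := by
    filter_upwards [he, hY, eventually_kf_mem hp hu hY, eventually_nf_nonneg (p := p) hu hY,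
      self_mem_nhdsWithin] with u h1 h2 h3 h4 (h5 : 0 < u)
    refine ⟨h2, ?_⟩
    rw [one_mul, norm_eq_abs, norm_of_nonneg (rpow_nonneg h5.le _)] at h1
    have hk0 := h3.1
    have hY0 := h2.1
    rw [ef, Rf, log_div (by linarith) (by apply ne_of_gt; apply mul_pos <;> linarith),
      log_mul (by linarith) (by linarith), ← sub_sub]
    exact h1
  obtain ⟨δ, hδ, h⟩ := mem_nhdsGT_iff_exists_Ioc_subset.1 key
  exact ⟨δ, hδ, fun u hu => h hu⟩

end Initial

/-- Strict tangent inequality for `v ↦ |v| ^ p` at a positive point. -/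
lemma tangent_lt_abs_rpow {p b v : ℝ} (hp : 1 < p) (hb : 0 < b) (hv : v ≠ b) :
    b ^ p + p * b ^ (p - 1) * (v - b) < |v| ^ p := by
  have hc : 0 < p * b ^ (p - 1) := mul_pos (by linarith) (rpow_pos_of_pos hb _)
  by_cases h : |v| = b
  · have hlt : v < b := lt_of_le_of_ne (h ▸ le_abs_self v) hv
    rw [h]
    nlinarith
  · have hs : -1 ≤ |v| / b - 1 := by
      have : 0 ≤ |v| / b := by positivity
      linarith
    have hs0 : |v| / b - 1 ≠ 0 := by
      rw [sub_ne_zero, ne_eq, div_eq_one_iff_eq hb.ne']; exact h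
    have h1 := one_add_mul_self_lt_rpow_one_add hs hs0 hp
    rw [add_sub_cancel, div_rpow (abs_nonneg v) hb.le,
      lt_div_iff₀ (rpow_pos_of_pos hb p)] at h1
    have h2 : b ^ p = b ^ (p - 1) * b := by rw [← rpow_add_one hb.ne', sub_add_cancel]
    have h3 : (1 + p * (|v| / b - 1)) * b ^ p = b ^ p + p * b ^ (p - 1) * (|v| - b) := by
      rw [h2]; field_simp
    have h4 : p * b ^ (p - 1) * (v - b) ≤ p * b ^ (p - 1) * (|v| - b) :=
      mul_le_mul_of_nonneg_left (by linarith [le_abs_self v]) hc.le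
    linarith

lemma eq_of_mem_ball_of_le {p b₁ b₂ v₁ v₂ : ℝ} (hp : 1 < p) (hb₁ : 0 < b₁) (hb₂ : 0 < b₂)
    (hb : b₁ ^ p + b₂ ^ p = 1) (hv : |v₁| ^ p + |v₂| ^ p ≤ 1)
    (h : 0 ≤ b₁ ^ (p - 1) * (v₁ - b₁) + b₂ ^ (p - 1) * (v₂ - b₂)) : v₁ = b₁ ∧ v₂ = b₂ := by
  have weak {b v : ℝ} (hb : 0 < b) : b ^ p + p * b ^ (p - 1) * (v - b) ≤ |v| ^ p := by
    by_cases e : v = b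
    · simp [e, abs_of_pos hb]
    · exact (tangent_lt_abs_rpow hp hb e).le
  have h' : 0 ≤ p * (b₁ ^ (p - 1) * (v₁ - b₁) + b₂ ^ (p - 1) * (v₂ - b₂)) :=
    mul_nonneg (by linarith) h
  constructor
  · by_contra e
    linarith [tangent_lt_abs_rpow hp hb₁ e, weak (v := v₂) hb₂]
  · by_contra e
    linarith [tangent_lt_abs_rpow hp hb₂ e, weak (v := v₁) hb₁]

/-- The linear minimization oracle at a point of slope `ρ`. -/
lemma lmo_eq {p u ρ σ : ℝ} {v : ℝ × ℝ} (hp : 3 ≤ p) (hu : 0 < u) (hρ : 0 < ρ) (hσ : σ ^ 2 = 1)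
    (hv : inBp p v)
    (hopt : ∀ b : ℝ × ℝ, inBp p b →
      2 * (1 - u - 1) * v.1 + 2 * (σ * (ρ * u)) * v.2
        ≤ 2 * (1 - u - 1) * b.1 + 2 * (σ * (ρ * u)) * b.2) :
    v = (1 / (1 + ρ ^ qc p) ^ (1 / p),
      -(σ * (ρ ^ (qc p - 1) / (1 + ρ ^ qc p) ^ (1 / p)))) := by
  have hp0 : p ≠ 0 := by linarith
  have hp1 : p - 1 ≠ 0 := by linarith
  have hz : 0 < 1 + ρ ^ qc p := by positivity
  set A := (1 + ρ ^ qc p) ^ (1 / p) with hA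
  have hA0 : 0 < A := rpow_pos_of_pos hz _
  have hAp : A ^ p = 1 + ρ ^ qc p := by
    rw [hA, ← rpow_mul hz.le, one_div_mul_cancel hp0, rpow_one]
  have habs : |σ| = 1 := by
    rw [← sq_eq_sq₀ (abs_nonneg σ) zero_le_one, sq_abs, hσ, one_pow]
  set b₁ := 1 / A with hb₁
  set b₂ := ρ ^ (qc p - 1) / A with hb₂
  have hr : 0 < ρ ^ (qc p - 1) := rpow_pos_of_pos hρ _
  have hb₁0 : 0 < b₁ := by positivity
  have hb₂0 : 0 < b₂ := by positivity
  have e1 : (qc p - 1) * p = qc p := by rw [qc]; field_simp; ring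
  have e2 : (qc p - 1) * (p - 1) = 1 := by rw [qc]; field_simp; ring
  have hb : b₁ ^ p + b₂ ^ p = 1 := by
    rw [hb₁, hb₂, div_rpow zero_le_one hA0.le, div_rpow hr.le hA0.le, one_rpow,
      ← rpow_mul hρ.le, e1, ← add_div, hAp, div_self hz.ne']
  have hb' : b₂ ^ (p - 1) = ρ * b₁ ^ (p - 1) := by
    rw [hb₁, hb₂, div_rpow zero_le_one hA0.le, div_rpow hr.le hA0.le, one_rpow,
      ← rpow_mul hρ.le, e2, rpow_one, mul_one_div]
  have hσv : |-(σ * v.2)| = |v.2| := by rw [abs_neg, abs_mul, habs, one_mul]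
  have hmem : inBp p (b₁, -(σ * b₂)) := by
    rw [inBp, abs_neg, abs_mul, habs, one_mul, abs_of_pos hb₁0, abs_of_pos hb₂0, hb]
  have hle := hopt _ hmem
  simp only at hle
  have hkey : 0 ≤ (v.1 - b₁) + ρ * (-(σ * v.2) - b₂) := by
    have h2 : 0 ≤ 2 * u * ((v.1 - b₁) + ρ * (-(σ * v.2) - b₂)) := by
      have : σ * (ρ * u) * -(σ * b₂) = -(ρ * u * b₂) := by linear_combination -(ρ * u * b₂) * hσ
      linarith
    exact nonneg_of_mul_nonneg_right h2 (by linarith)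
  obtain ⟨f1, f2⟩ := eq_of_mem_ball_of_le (v₁ := v.1) (v₂ := -(σ * v.2)) (by linarith) hb₁0 hb₂0 hb
    (by rw [hσv]; exact hv) (by
      rw [hb']
      have := mul_nonneg (rpow_pos_of_pos hb₁0 (p - 1)).le hkey
      linarith)
  refine Prod.ext f1 ?_
  change v.2 = -(σ * b₂)
  rw [← f2]
  linear_combination -v.2 * hσ

/-- The point with `u = 1 - x.1`, slope `ρ = |x.2| / u` and `ρ ^ q = Y u`. -/
def IsState (p : ℝ) (x : ℝ × ℝ) (u Y : ℝ) : Prop :=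
  ∃ σ ρ : ℝ, σ ^ 2 = 1 ∧ 0 < ρ ∧ ρ ^ qc p = Y * u ∧ x = (1 - u, σ * (ρ * u))

lemma sq_eq_nuf {p u Y ρ : ℝ} (hp : 3 ≤ p) (hρ : 0 < ρ) (h : ρ ^ qc p = Y * u) :
    ρ ^ 2 = nuf p u Y := by
  have hp0 : p ≠ 0 := by linarith
  have hp1 : p - 1 ≠ 0 := by linarith
  have e : qc p * (2 - 2 / p) = (2 : ℕ) := by rw [qc]; push_cast; field_simp
  rw [nuf, ← h, ← rpow_mul hρ.le, e, rpow_natCast]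

lemma IsState.step {p u Y γ : ℝ} {x v : ℝ × ℝ} (hp : 3 ≤ p) (hx : IsState p x u Y) (hu : 0 < u)
    (hY : 0 < Y) (hk : 0 < kf p u Y) (hs : 0 < sigf p u Y)
    (hls : Rf p u Y * nuf p u Y * (1 + Y * u) ^ (1 / p) ≤ Y)
    (hv : inBp p v)
    (hopt : ∀ b : ℝ × ℝ, inBp p b →
      2 * (x.1 - 1) * v.1 + 2 * x.2 * v.2 ≤ 2 * (x.1 - 1) * b.1 + 2 * x.2 * b.2)
    (hγ : ∀ s ∈ Set.Icc (0:ℝ) 1, fobj (seg x v γ) ≤ fobj (seg x v s)) :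
    IsState p (seg x v γ) (uf p u Y) (Yf p u Y) := by
  obtain ⟨σ, ρ, hσ, hρ, hρY, rfl⟩ := hx
  have hν := sq_eq_nuf hp hρ hρY
  have hv' := lmo_eq hp hu hρ hσ hv hopt
  rw [hρY] at hv'
  have hz : 0 < 1 + Y * u := by positivity
  have hA0 : 0 < (1 + Y * u) ^ (1 / p) := rpow_pos_of_pos hz _
  have hB0 : 0 < ρ ^ (qc p - 1) := rpow_pos_of_pos hρ _
  have hB : ρ ^ (qc p - 1) * ρ = Y * u := by rw [← rpow_add_one hρ.ne', sub_add_cancel, hρY]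
  have hku : u * kf p u Y = 1 - (1 - u) * (1 + Y * u) ^ (1 / p) := by rw [kf]; field_simp
  have hR : Rf p u Y = kf p u Y / (Y + ρ ^ 2 * (1 + Y * u) ^ (1 / p)) := by
    rw [Rf, nf, ← hν]; congr 1; field_simp
  have hsig : sigf p u Y = (1 - Rf p u Y * ρ ^ 2) / (1 + Rf p u Y ^ 2 * ρ ^ 2) := by
    rw [sigf, ← hν]
  rw [← hν] at hls
  set A := (1 + Y * u) ^ (1 / p)
  set B := ρ ^ (qc p - 1)
  set R := Rf p u Y
  have hR0 : 0 < R := by rw [hR]; positivity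
  set m := B / A + ρ * u with hm
  have hm0 : 0 < m := by positivity
  have hρm : ρ * m = u * (Y + ρ ^ 2 * A) / A := by
    rw [hm]; field_simp; linear_combination hB
  have hd : 1 / A - (1 - u) = R * ρ * m := by
    rw [mul_assoc, hρm, hR]; field_simp; linear_combination -hku
  set s₀ := u * (R * ρ + ρ) / (m * (1 + (R * ρ) ^ 2)) with hs₀
  have hs₀m : s₀ * m * (1 + (R * ρ) ^ 2) = u * (R * ρ + ρ) := by
    rw [hs₀]; field_simp
  have hseg : ∀ s, seg (1 - u, σ * (ρ * u)) v s
      = (1 - (u - s * (R * ρ * m)), σ * (ρ * u - s * m)) := by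
    intro s
    rw [seg, hv', ← hd, hm]
    ext <;> simp only <;> ring
  have hf : ∀ s, fobj (seg (1 - u, σ * (ρ * u)) v s)
      = fobj (seg (1 - u, σ * (ρ * u)) v s₀) + m ^ 2 * (1 + (R * ρ) ^ 2) * (s - s₀) ^ 2 := by
    intro s
    rw [hseg, hseg, fobj, fobj]
    simp only [mul_pow, hσ]
    linear_combination 2 * m * (s - s₀) * hs₀m
  have hs₀1 : s₀ ≤ 1 := by
    have h1 : u * (R * ρ) ≤ B / A := by
      rw [le_div_iff₀ hA0]
      refine le_of_mul_le_mul_right ?_ hρ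
      rw [hB]
      nlinarith
    rw [hs₀, div_le_one (by positivity)]
    have : 0 ≤ m * (R * ρ) ^ 2 := by positivity
    linarith
  have hγ0 : γ = s₀ := by
    have h1 := hγ s₀ ⟨by positivity, hs₀1⟩
    rw [hf γ] at h1
    have h2 : m ^ 2 * (1 + (R * ρ) ^ 2) * (γ - s₀) ^ 2 ≤ 0 := by linarith
    have h3 : (γ - s₀) ^ 2 ≤ 0 := nonpos_of_mul_nonpos_right h2 (by positivity)
    exact sub_eq_zero.1 (pow_eq_zero_iff two_ne_zero |>.1 (le_antisymm h3 (sq_nonneg _)))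
  have hsm : s₀ * m = u * (R * ρ + ρ) / (1 + (R * ρ) ^ 2) := by
    rw [eq_div_iff (by positivity), hs₀m]
  have hu' : u - s₀ * (R * ρ * m) = uf p u Y := by
    rw [uf, hsig, show s₀ * (R * ρ * m) = R * ρ * (s₀ * m) by ring, hsm]
    field_simp
    ring
  have hw' : ρ * u - s₀ * m = -(R * ρ * uf p u Y) := by
    rw [uf, hsig, hsm]
    field_simp
    ring
  refine ⟨-σ, R * ρ, by rw [neg_sq, hσ], by positivity, ?_, ?_⟩
  · rw [mul_rpow hR0.le hρ.le, hρY, Yf, uf]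
    field_simp
    rfl
  · rw [hγ0, hseg, hu', hw']
    ext <;> simp

lemma isState_xslow {p u : ℝ} (hp : 3 ≤ p) (hu : 0 < u) :
    IsState p (xslow p u) u ((Cp p + Dp p * u) ^ qc p) := by
  have hp1 : 0 < p - 1 := by linarith
  have hC := Cp_pos hp
  have hD : 0 ≤ Dp p := by rw [Dp]; positivity
  have hα : alphac p * qc p = 1 := by rw [alphac, qc]; field_simp
  have hc : 0 < Cp p + Dp p * u := by positivity
  refine ⟨1, (Cp p + Dp p * u) * u ^ alphac p, one_pow 2, by positivity, ?_, ?_⟩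
  · rw [mul_rpow hc.le (rpow_nonneg hu.le _), ← rpow_mul hu.le, hα, rpow_one]
  · rw [xslow, one_mul, mul_assoc, add_comm 1, rpow_add_one hu.ne']

lemma IsState.rdist_eq {p u Y : ℝ} {x : ℕ → ℝ × ℝ} {t : ℕ} (hp : 3 ≤ p) (hu : 0 < u)
    (h : IsState p (x t) u Y) : rdist x t = u * √(1 + nuf p u Y) := by
  obtain ⟨σ, ρ, hσ, hρ, hρY, hx⟩ := h
  have e : fobj (x t) = u ^ 2 * (1 + nuf p u Y) := by
    rw [hx, fobj, ← sq_eq_nuf hp hρ hρY]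
    linear_combination (ρ * u) ^ 2 * hσ
  rw [rdist, e, sqrt_mul (sq_nonneg u), sqrt_sq hu.le]

lemma Rf_pos {p u Y : ℝ} (hu : 0 < u) (hY : 0 < Y) (hk : 0 < kf p u Y) : 0 < Rf p u Y := by
  have h1 : 0 < Y * u := mul_pos hY hu
  have h2 : 0 ≤ nf p u Y :=
    div_nonneg (mul_nonneg (rpow_nonneg h1.le _) (rpow_nonneg (by linarith) _)) hY.le
  exact div_pos hk (mul_pos hY (by linarith))

lemma uf_mul_le {p u Y : ℝ} (hp : 3 ≤ p) (hu : 0 < u) (hY : 0 < Y) (hk : 0 < kf p u Y)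
    (hs : 0 < sigf p u Y) :
    uf p u Y * (1 + nuf p (uf p u Y) (Yf p u Y)) ≤ u := by
  have hR := Rf_pos hu hY hk
  have hYu : 0 < Y * u := mul_pos hY hu
  have hν : 0 < nuf p u Y := rpow_pos_of_pos hYu _
  rw [nuf_uf_Yf hp hYu.le hR hs, uf, sigf, mul_assoc, div_mul_cancel₀ _ (by positivity)]
  have : 0 ≤ u * (Rf p u Y * nuf p u Y) := by positivity
  linarith

lemma nuf_nonneg {p u Y : ℝ} (hu : 0 ≤ u) (hY : 0 ≤ Y) : 0 ≤ nuf p u Y :=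
  rpow_nonneg (mul_nonneg hY hu) _

/-- The trajectory of a slow-start iterate in the coordinates `(u, Y)`. -/
lemma exists_coordinates {p : ℝ} (hp : 3 ≤ p) :
    ∃ u₁ > (0:ℝ), ∀ u₀ ∈ Set.Ioc (0:ℝ) u₁, ∀ x v : ℕ → ℝ × ℝ, ∀ γ : ℕ → ℝ,
      x 0 = xslow p u₀ → IsFWTraj p x v γ →
      ∃ u Y : ℕ → ℝ, ∀ t, 0 < u t ∧ Region p (u t) (Y t) ∧ IsState p (x t) (u t) (Y t) ∧
        0 < kf p (u t) (Y t) ∧ 0 < sigf p (u t) (Y t) ∧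
        u (t + 1) = uf p (u t) (Y t) ∧ Y (t + 1) = Yf p (u t) (Y t) := by
  obtain ⟨δ, hδ, hstep⟩ := exists_region_step hp
  obtain ⟨δ', hδ', hinit⟩ := exists_region_initial hp
  refine ⟨min δ δ', lt_min hδ hδ', fun u₀ hu₀ x v γ hx0 hT => ?_⟩
  let a : ℕ → ℝ × ℝ := fun t => (fun b : ℝ × ℝ => (uf p b.1 b.2, Yf p b.1 b.2))^[t]
    (u₀, (Cp p + Dp p * u₀) ^ qc p)
  have ha (t : ℕ) : a (t + 1) = (uf p (a t).1 (a t).2, Yf p (a t).1 (a t).2) :=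
    Function.iterate_succ_apply' _ _ _
  have hinv (t : ℕ) : (a t).1 ∈ Set.Ioc 0 δ ∧ Region p (a t).1 (a t).2 ∧
      IsState p (x t) (a t).1 (a t).2 := by
    induction t with
    | zero =>
      refine ⟨⟨hu₀.1, hu₀.2.trans (min_le_left _ _)⟩,
        hinit u₀ ⟨hu₀.1, hu₀.2.trans (min_le_right _ _)⟩, ?_⟩
      rw [hx0]
      exact isState_xslow hp hu₀.1
    | succ t ih =>
      obtain ⟨hu, hreg, hst⟩ := ih
      obtain ⟨-, hk, hs, hls, hreg'⟩ := hstep _ hu _ hreg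
      have hY : 0 < (a t).2 := by linarith [hreg.1.1]
      have hu' : 0 < uf p (a t).1 (a t).2 := mul_pos hu.1 hs
      rw [ha]
      refine ⟨⟨hu', le_trans ?_ hu.2⟩, hreg', ?_⟩
      · have h1 := uf_mul_le hp hu.1 hY hk hs
        have h2 : 0 ≤ nuf p (uf p (a t).1 (a t).2) (Yf p (a t).1 (a t).2) :=
          nuf_nonneg hu'.le (by linarith [hreg'.1.1])
        linarith [mul_nonneg hu'.le h2]
      · rw [hT.2.2 t]
        exact hst.step hp hu.1 hY hk hs hls (hT.1 t).1 (hT.1 t).2 (hT.2.1 t).2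
  refine ⟨fun t => (a t).1, fun t => (a t).2, fun t => ?_⟩
  obtain ⟨hu, hreg, hst⟩ := hinv t
  obtain ⟨-, hk, hs, -, -⟩ := hstep _ hu _ hreg
  exact ⟨hu.1, hreg, hst, hk, hs, congrArg Prod.fst (ha t), congrArg Prod.snd (ha t)⟩

lemma tendsto_coordinate {p : ℝ} (hp : 3 ≤ p) {u Y : ℕ → ℝ} (hu : ∀ t, 0 < u t)
    (hY : ∀ t, Y t ∈ Set.Icc (1 / 2) 1) (hk : ∀ t, 0 < kf p (u t) (Y t))
    (hs : ∀ t, 0 < sigf p (u t) (Y t)) (hu' : ∀ t, u (t + 1) = uf p (u t) (Y t))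
    (hY' : ∀ t, Y (t + 1) = Yf p (u t) (Y t)) : Tendsto u atTop (𝓝[>] 0) := by
  have hY0 (t : ℕ) : 0 < Y t := by linarith [(hY t).1]
  have hmul (t : ℕ) : u (t + 1) * (1 + nuf p (u (t + 1)) (Y (t + 1))) ≤ u t := by
    rw [hu', hY']
    exact uf_mul_le hp (hu t) (hY0 t) (hk t) (hs t)
  have hanti : Antitone u := antitone_nat_of_succ_le fun t => by
    have := mul_nonneg (hu (t + 1)).le (nuf_nonneg (p := p) (hu (t + 1)).le (hY0 (t + 1)).le)
    linarith [hmul t]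
  have hbdd : BddBelow (Set.range u) := ⟨0, by rintro _ ⟨t, rfl⟩; exact (hu t).le⟩
  have hlim := tendsto_atTop_ciInf hanti hbdd
  set L := ⨅ t, u t
  have hL0 : 0 ≤ L := le_ciInf fun t => (hu t).le
  have hL : L = 0 := by
    by_contra hne
    have hLpos : 0 < L := lt_of_le_of_ne hL0 (Ne.symm hne)
    have hexp : 0 ≤ 2 - 2 / p := by
      rw [sub_nonneg, div_le_iff₀ (by linarith)]; linarith
    have hc : 0 < (1 / 2 * L) ^ (2 - 2 / p) := rpow_pos_of_pos (by positivity) _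
    have hle (t : ℕ) : u (t + 1) * (1 + (1 / 2 * L) ^ (2 - 2 / p)) ≤ u t := by
      refine (mul_le_mul_of_nonneg_left ?_ (hu (t + 1)).le).trans (hmul t)
      rw [nuf]
      have : L ≤ u (t + 1) := ciInf_le hbdd _
      gcongr
      · exact (hY0 _).le
      · exact (hY _).1
    have := le_of_tendsto_of_tendsto' (((tendsto_add_atTop_iff_nat 1).2 hlim).mul_const _) hlim hle
    nlinarith
  rw [hL] at hlim
  exact tendsto_nhdsWithin_iff.2 ⟨hlim, Eventually.of_forall hu⟩

/-- `1 - s` in terms of `ν = ρ²` and the slope ratio `R`. -/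
lemma one_sub_contraction_eq {R ν : ℝ} (hν : 0 ≤ ν) (hs : 0 < (1 - R * ν) / (1 + R ^ 2 * ν)) :
    1 - (1 - R * ν) / (1 + R ^ 2 * ν) * √(1 + R ^ 2 * ν) / √(1 + ν)
      = ν * ((1 + R) ^ 2 / ((1 + R ^ 2 * ν) * (1 + ν) *
        (1 + (1 - R * ν) / (1 + R ^ 2 * ν) * √(1 + R ^ 2 * ν) / √(1 + ν)))) := by
  have h1 : 0 < 1 + R ^ 2 * ν := by positivity
  have h2 : 0 < 1 + ν := by positivity
  set s := (1 - R * ν) / (1 + R ^ 2 * ν) * √(1 + R ^ 2 * ν) / √(1 + ν) with hsdef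
  have hs0 : 0 < s := by positivity
  have hs2 : s ^ 2 * ((1 + R ^ 2 * ν) * (1 + ν)) = (1 - R * ν) ^ 2 := by
    rw [hsdef, div_pow, mul_pow, sq_sqrt h1.le, sq_sqrt h2.le]
    field_simp
  rw [mul_div_assoc', eq_div_iff (by positivity)]
  linear_combination -hs2

lemma tendsto_contraction {p : ℝ} (hp : 3 ≤ p) {u Y : ℕ → ℝ} (hu : ∀ t, 0 < u t)
    (hreg : ∀ t, Region p (u t) (Y t)) (hk : ∀ t, 0 < kf p (u t) (Y t))
    (hs : ∀ t, 0 < sigf p (u t) (Y t)) (hu' : ∀ t, u (t + 1) = uf p (u t) (Y t))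
    (hY' : ∀ t, Y (t + 1) = Yf p (u t) (Y t)) {r : ℕ → ℝ}
    (hr : ∀ t, r t = u t * √(1 + nuf p (u t) (Y t))) :
    Tendsto (fun t => (1 - r (t + 1) / r t) / (2 * Cp p ^ 2 * r t ^ (2 - 2 / p))) atTop (𝓝 1) := by
  have hY (t : ℕ) := (hreg t).1
  have hY0 (t : ℕ) : 0 < Y t := by linarith [(hY t).1]
  have hut := tendsto_coordinate hp hu hY hk hs hu' hY'
  have hYe : ∀ᶠ t in atTop, Y t ∈ Set.Icc (1 / 2) 1 := Eventually.of_forall hY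
  have he : (fun t => ef p (u t) (Y t)) =O[atTop] fun t => u t ^ (5 / 4 : ℝ) :=
    IsBigO.of_bound 1 (Eventually.of_forall fun t => by
      rw [one_mul]; exact (hreg t).2.trans (le_abs_self _))
  have hRt := tendsto_Rf hp hut hYe he
  have hνt := tendsto_nuf hp hut hYe
  have hYt := tendsto_Y hp hut hYe he
  have hst := tendsto_sigf hp hut hYe
  set R : ℕ → ℝ := fun t => Rf p (u t) (Y t)
  set ν : ℕ → ℝ := fun t => nuf p (u t) (Y t)
  have hν0 (t : ℕ) : 0 < ν t := rpow_pos_of_pos (mul_pos (hY0 t) (hu t)) _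
  have hsig (t : ℕ) : sigf p (u t) (Y t) = (1 - R t * ν t) / (1 + R t ^ 2 * ν t) := rfl
  simp only [hsig] at hst hs
  set s : ℕ → ℝ := fun t =>
    (1 - R t * ν t) / (1 + R t ^ 2 * ν t) * √(1 + R t ^ 2 * ν t) / √(1 + ν t) with hsdef
  have hr' (t : ℕ) : r (t + 1) / r t = s t := by
    have := nuf_uf_Yf hp (mul_pos (hY0 t) (hu t)).le (Rf_pos (hu t) (hY0 t) (hk t)) (by exact hs t)
    rw [hr, hr, hu', hY', this, uf, hsig, hsdef]
    rw [mul_assoc, mul_div_mul_left _ _ (hu t).ne']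
  have hC := Cp_pos hp
  have hC2 : Cp p ^ 2 = (p / (p + 1)) ^ (2 - 2 / p) := by
    have : p - 1 ≠ 0 := by linarith
    have : p ≠ 0 := by linarith
    rw [Cp, ← rpow_natCast, ← rpow_mul (by positivity), qc]
    congr 1
    push_cast
    field_simp
  have hden : Tendsto (fun t => 1 + R t ^ 2 * ν t) atTop (𝓝 1) := by
    simpa using ((hRt.pow 2).mul hνt).const_add 1
  have hone : Tendsto (fun t => 1 + ν t) atTop (𝓝 1) := by simpa using hνt.const_add 1
  have hsq : Tendsto (fun t => √(1 + ν t)) atTop (𝓝 1) := by simpa using hone.sqrt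
  have hslim : Tendsto s atTop (𝓝 1) := by
    have := (hst.mul hden.sqrt).div hsq one_ne_zero
    rwa [sqrt_one, mul_one, div_one] at this
  have hlim : Tendsto (fun t => (1 + R t) ^ 2 / ((1 + R t ^ 2 * ν t) * (1 + ν t) * (1 + s t)) *
      (Y t ^ (2 - 2 / p) / (2 * Cp p ^ 2 * √(1 + ν t) ^ (2 - 2 / p)))) atTop (𝓝 1) := by
    have a := ((hRt.const_add 1).pow 2).div ((hden.mul hone).mul (hslim.const_add 1)) (by norm_num)
    have b := (hYt.rpow_const (p := 2 - 2 / p) (Or.inl (by positivity))).div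
      ((hsq.rpow_const (p := 2 - 2 / p) (Or.inl one_ne_zero)).const_mul (2 * Cp p ^ 2))
      (by rw [one_rpow]; positivity)
    have e : (1 + 1 : ℝ) ^ 2 / (1 * 1 * (1 + 1)) *
        ((p / (p + 1)) ^ (2 - 2 / p) / (2 * Cp p ^ 2 * 1 ^ (2 - 2 / p))) = 1 := by
      rw [← hC2, one_rpow]; field_simp; norm_num
    have c := a.mul b
    rwa [e] at c
  refine hlim.congr fun t => ?_
  have hsν : ν t = Y t ^ (2 - 2 / p) * u t ^ (2 - 2 / p) := mul_rpow (hY0 t).le (hu t).le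
  have h1 : 0 < u t ^ (2 - 2 / p) := rpow_pos_of_pos (hu t) _
  have h2 : 0 < √(1 + ν t) := sqrt_pos.2 (by linarith [hν0 t])
  have h3 : 0 < √(1 + ν t) ^ (2 - 2 / p) := rpow_pos_of_pos h2 _
  rw [hr', one_sub_contraction_eq (hν0 t).le (hs t), hr, mul_rpow (hu t).le h2.le]
  change (1 + R t) ^ 2 / ((1 + R t ^ 2 * ν t) * (1 + ν t) * (1 + s t)) * _ =
    ν t * ((1 + R t) ^ 2 / ((1 + R t ^ 2 * ν t) * (1 + ν t) * (1 + s t))) / _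
  set X := (1 + R t) ^ 2 / ((1 + R t ^ 2 * ν t) * (1 + ν t) * (1 + s t))
  rw [mul_comm (ν t), mul_div_assoc]
  congr 1
  rw [mul_left_comm, ← mul_div_mul_left _ _ h1.ne', mul_comm (u t ^ (2 - 2 / p)) (Y t ^ (2 - 2 / p)),
    ← hsν]

end Trajectory

theorem contraction_asymptotics (p : ℝ) (hp : 3 ≤ p) :
    ∃ u₁ > (0:ℝ), ∀ u₀ ∈ Set.Ioc (0:ℝ) u₁, ∀ x v : ℕ → ℝ × ℝ, ∀ γ : ℕ → ℝ,
      x 0 = xslow p u₀ → IsFWTraj p x v γ →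
      Filter.Tendsto
        (fun t : ℕ => (1 - rdist x (t + 1) / rdist x t)
            / (2 * Cp p ^ 2 * (rdist x t) ^ (2 - 2 / p)))
        Filter.atTop (nhds 1) := by
  obtain ⟨u₁, hu₁, h⟩ := exists_coordinates hp
  refine ⟨u₁, hu₁, fun u₀ hu₀ x v γ hx0 hT => ?_⟩
  obtain ⟨u, Y, hc⟩ := h u₀ hu₀ x v γ hx0 hT
  choose hu hreg hst hk hs hu' hY' using hc
  exact tendsto_contraction hp hu hreg hk hs hu' hY' fun t => (hst t).rdist_eq hp (hu t)

end Stmt12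
end
end

section
/- For every p ≥ 3, consider the feasible set B_p ⊂ ℝ² and the smooth strongly convex objective f(x) = ‖x - e₁‖₂² with minimizer x* = e₁. For all sufficiently small u₀ > 0, the exact-line-search Frank–Wolfe iterates (x_t) started from the slow-start initialization x₀^slow(u₀) satisfy f(x_T) - f(x*) ~ ((p+1)/p)²·(p/(4(p-1)))^{p/(p-1)}·T^{-p/(p-1)} as T → ∞; in particular, f(x_T) - f(x*) = Ω(T^{-p/(p-1)}). -/
/-!
STATEMENT 13: Main lower bound. For every p ≥ 3, on B_p ⊂ ℝ² with
f(x) = ‖x - e₁‖₂² (minimizer x* = e₁, f(x*) = 0), the exact-line-search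
Frank–Wolfe iterates started from the slow-start initialization satisfy
f(x_T) - f(x*) ~ ((p+1)/p)²·(p/(4(p-1)))^{p/(p-1)}·T^{-p/(p-1)} as T → ∞;
in particular f(x_T) - f(x*) = Ω(T^{-p/(p-1)}).
-/

noncomputable section
open Real

namespace Stmt13

/-- Hölder conjugate q = p/(p-1). -/
def qc (p : ℝ) : ℝ := p / (p - 1)

/-- α = (p-1)/p = 1/q. -/
def alphac (p : ℝ) : ℝ := (p - 1) / p

/-- M = (u^q + |w|^q)^{1/q}. -/
def Mv (p u w : ℝ) : ℝ := (u ^ qc p + |w| ^ qc p) ^ (1 / qc p)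

/-- First coordinate of the LMO output: v₁ = u^{q-1}/M^{q-1}. -/
def v1f (p u w : ℝ) : ℝ := u ^ (qc p - 1) / Mv p u w ^ (qc p - 1)

/-- Second coordinate of the LMO output: v₂ = -sign(w)·|w|^{q-1}/M^{q-1}. -/
def v2f (p u w : ℝ) : ℝ := -(Real.sign w) * |w| ^ (qc p - 1) / Mv p u w ^ (qc p - 1)

/-- d₁ = v₁ - 1 + u. -/
def d1f (p u w : ℝ) : ℝ := v1f p u w - 1 + u

/-- d₂ = v₂ - w. -/
def d2f (p u w : ℝ) : ℝ := v2f p u w - w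

/-- Exact line-search step size γ = (M - u + u² + w²)/(d₁² + d₂²). -/
def gamf (p u w : ℝ) : ℝ :=
  (Mv p u w - u + u ^ 2 + w ^ 2) / (d1f p u w ^ 2 + d2f p u w ^ 2)

/-- u' = u - γ·d₁. -/
def uN (p u w : ℝ) : ℝ := u - gamf p u w * d1f p u w

/-- w' = w + γ·d₂. -/
def wN (p u w : ℝ) : ℝ := w + gamf p u w * d2f p u w

/-- Scaled one-step map Φ(u,y) = |w'|/(u')^{1+α} where w = y·u^{1+α}. -/
def Phi (p u y : ℝ) : ℝ :=
  |wN p u (y * u ^ (1 + alphac p))| /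
    (uN p u (y * u ^ (1 + alphac p))) ^ (1 + alphac p)

/-- C_p = (p/(p+1))^{1/q}. -/
def Cp (p : ℝ) : ℝ := (p / (p + 1)) ^ (1 / qc p)

/-- D_p = C_p·(p-1)(3p+1)/(2p(p+1)²). -/
def Dp (p : ℝ) : ℝ := Cp p * ((p - 1) * (3 * p + 1)) / (2 * p * (p + 1) ^ 2)

/-- Membership in the closed unit ℓ_p ball of ℝ². -/
def inBp (p : ℝ) (z : ℝ × ℝ) : Prop := |z.1| ^ p + |z.2| ^ p ≤ 1

/-- The objective f(x) = ‖x - e₁‖₂² on ℝ². -/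
def fobj (z : ℝ × ℝ) : ℝ := (z.1 - 1) ^ 2 + z.2 ^ 2

/-- The point a + s·(b - a). -/
def seg (a b : ℝ × ℝ) (s : ℝ) : ℝ × ℝ := (a.1 + s * (b.1 - a.1), a.2 + s * (b.2 - a.2))

/-- `IsFWTraj p x v γ`: (x,v,γ) is an exact-line-search Frank–Wolfe trajectory on B_p
for f(x) = ‖x - e₁‖₂² (whose gradient at z is (2(z₁-1), 2z₂)). -/
def IsFWTraj (p : ℝ) (x v : ℕ → ℝ × ℝ) (γ : ℕ → ℝ) : Prop :=
  (∀ t, inBp p (v t) ∧ ∀ b : ℝ × ℝ, inBp p b →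
      2 * ((x t).1 - 1) * (v t).1 + 2 * (x t).2 * (v t).2
        ≤ 2 * ((x t).1 - 1) * b.1 + 2 * (x t).2 * b.2) ∧
  (∀ t, γ t ∈ Set.Icc (0:ℝ) 1 ∧ ∀ s ∈ Set.Icc (0:ℝ) 1,
      fobj (seg (x t) (v t) (γ t)) ≤ fobj (seg (x t) (v t) s)) ∧
  (∀ t, x (t + 1) = seg (x t) (v t) (γ t))

/-- The slow-start initialization x₀^slow(u₀) = (1-u₀, (C_p + D_p·u₀)·u₀^{1+α}). -/
def xslow (p u₀ : ℝ) : ℝ × ℝ := (1 - u₀, (Cp p + Dp p * u₀) * u₀ ^ (1 + alphac p))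

/-- u_t = 1 - (x_t)₁. -/
def ucoord (x : ℕ → ℝ × ℝ) (t : ℕ) : ℝ := 1 - (x t).1

/-- y_t = |(x_t)₂| / u_t^{1+α}. -/
def ycoord (p : ℝ) (x : ℕ → ℝ × ℝ) (t : ℕ) : ℝ :=
  |(x t).2| / (ucoord x t) ^ (1 + alphac p)

lemma one_add_rpow_sub_le {b x y : ℝ} (hb0 : 0 ≤ b) (hb1 : b ≤ 1) (hx : 0 ≤ x) (hxy : x ≤ y) :
    (1 + y) ^ b - (1 + x) ^ b ≤ b * (y - x) := by
  have h1 : 0 < 1 + x := by linarith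
  have hs : 0 ≤ (y - x) / (1 + x) := div_nonneg (by linarith) h1.le
  have e : 1 + y = (1 + x) * (1 + (y - x) / (1 + x)) := by field_simp; ring
  have h2 := rpow_one_add_le_one_add_mul_self (s := (y - x) / (1 + x)) (by linarith) hb0 hb1
  have h3 : (1 + x) ^ b ≤ 1 + x := by
    calc (1 + x) ^ b ≤ (1 + x) ^ (1 : ℝ) := rpow_le_rpow_of_exponent_le (by linarith) hb1
      _ = 1 + x := rpow_one _
  rw [e, mul_rpow h1.le (by linarith)]
  have h4 : 0 < (1 + x) ^ b := rpow_pos_of_pos h1 b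
  calc (1 + x) ^ b * (1 + (y - x) / (1 + x)) ^ b - (1 + x) ^ b
      ≤ (1 + x) ^ b * (1 + b * ((y - x) / (1 + x))) - (1 + x) ^ b := by gcongr
    _ = (1 + x) ^ b * (b * ((y - x) / (1 + x))) := by ring
    _ ≤ (1 + x) * (b * ((y - x) / (1 + x))) := by gcongr
    _ = b * (y - x) := by field_simp

lemma one_add_rpow_scale_le {b x c : ℝ} (hb0 : 0 ≤ b) (hb1 : b ≤ 1) (hx : 0 ≤ x)
    (hc0 : 0 ≤ c) (hc1 : c ≤ 1) :
    (1 + c * x) ^ b - 1 - c * ((1 + x) ^ b - 1) ≤ (1 - c) * (b * x ^ 2) := by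
  have h1 : 0 < 1 + x := by linarith
  have hs : -1 ≤ -((1 - c) * x / (1 + x)) := by
    have : (1 - c) * x / (1 + x) ≤ 1 := by
      rw [div_le_one h1]; nlinarith
    linarith
  have e : 1 + c * x = (1 + x) * (1 + -((1 - c) * x / (1 + x))) := by field_simp; ring
  have h2 := rpow_one_add_le_one_add_mul_self hs hb0 hb1
  have h3 := rpow_one_add_le_one_add_mul_self (s := x) (by linarith) hb0 hb1
  have h4 : 1 ≤ (1 + x) ^ b := one_le_rpow (by linarith) hb0
  rw [e, mul_rpow h1.le (by linarith)]
  set g := (1 + x) ^ b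
  have h5 : 1 - x ≤ g / (1 + x) := by
    rw [le_div_iff₀ h1]; nlinarith
  have h6 : g * (1 + -((1 - c) * x / (1 + x))) ^ b
      ≤ g * (1 + b * -((1 - c) * x / (1 + x))) := by gcongr
  have h7 : g * (1 + b * -((1 - c) * x / (1 + x))) = g - (1 - c) * (b * x * (g / (1 + x))) := by
    ring
  have h8 : b * x * (1 - x) ≤ b * x * (g / (1 + x)) := by gcongr
  have h9 : (1 - c) * (g - 1 - b * x * (g / (1 + x))) ≤ (1 - c) * (b * x ^ 2) :=
    mul_le_mul_of_nonneg_left (by nlinarith) (by linarith)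
  nlinarith

lemma one_add_rpow_scale_nonneg {b x c : ℝ} (hb0 : 0 ≤ b) (hb1 : b ≤ 1) (hx : 0 ≤ x)
    (hc0 : 0 ≤ c) (hc1 : c ≤ 1) :
    0 ≤ (1 + c * x) ^ b - 1 - c * ((1 + x) ^ b - 1) := by
  have h := (concaveOn_rpow hb0 hb1).2 (show (1 : ℝ) ∈ Set.Ici 0 by simp)
    (show 1 + x ∈ Set.Ici 0 by simp only [Set.mem_Ici]; linarith) (show 0 ≤ 1 - c by linarith)
    hc0 (by ring)
  simp only [smul_eq_mul, one_rpow] at h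
  have e : (1 - c) * 1 + c * (1 + x) = 1 + c * x := by ring
  rw [e] at h
  linarith

lemma abs_log_sub_log_le {m x y : ℝ} (hm : 0 < m) (hx : m ≤ x) (hy : m ≤ y) :
    |log x - log y| ≤ |x - y| / m := by
  wlog hxy : y ≤ x generalizing x y
  · rw [abs_sub_comm, abs_sub_comm x y]; exact this hy hx (by linarith)
  have hx0 : 0 < x := by linarith
  have hy0 : 0 < y := by linarith
  rw [abs_of_nonneg (sub_nonneg.2 (log_le_log hy0 hxy)), abs_of_nonneg (by linarith),
    ← log_div hx0.ne' hy0.ne']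
  calc log (x / y) ≤ x / y - 1 := log_le_sub_one_of_pos (by positivity)
    _ = (x - y) / y := by field_simp
    _ ≤ (x - y) / m := by gcongr

lemma abs_sub_le_mul_abs_log {M x y : ℝ} (hx0 : 0 < x) (hy0 : 0 < y) (hx : x ≤ M) (hy : y ≤ M) :
    |x - y| ≤ M * |log x - log y| := by
  wlog hxy : y ≤ x generalizing x y
  · rw [abs_sub_comm, abs_sub_comm (log x)]; exact this hy0 hx0 hy hx (by linarith)
  rw [abs_of_nonneg (sub_nonneg.2 (log_le_log hy0 hxy)), abs_of_nonneg (by linarith),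
    ← log_div hx0.ne' hy0.ne']
  have h : 1 - (x / y)⁻¹ ≤ log (x / y) := one_sub_inv_le_log_of_pos (by positivity)
  have h0 : 0 ≤ log (x / y) := log_nonneg (by rwa [le_div_iff₀ hy0, one_mul])
  calc x - y = x * (1 - (x / y)⁻¹) := by field_simp
    _ ≤ x * log (x / y) := by gcongr
    _ ≤ M * log (x / y) := by gcongr

/-! The Frank–Wolfe step in the coordinates `u = 1 - x₁` and `θ = (|x₂| / u) ^ q`,
with `b = 1 / p`. -/

/-- `1 - (1 - u) (1 + θ) ^ b`. -/
def gapNum (b u θ : ℝ) : ℝ := 1 - (1 - u) * (1 + θ) ^ b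

/-- `u θ ^ (1 - 2 b) (1 + θ) ^ b`. -/
def gapDamp (b u θ : ℝ) : ℝ := u * θ ^ (1 - 2 * b) * (1 + θ) ^ b

/-- The damped gap. -/
def gapQuot (b u θ : ℝ) : ℝ := gapNum b u θ / (1 + gapDamp b u θ)

/-- Product of the slopes of two consecutive iterates. -/
def slopeProd (b u θ : ℝ) : ℝ := θ ^ (1 - 2 * b) * gapQuot b u θ

/-- The ratio `|x₂| / u` after the step. -/
def nextSlope (b u θ : ℝ) : ℝ := θ ^ (-b) * gapQuot b u θ

/-- The value of `u` after the step. -/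
def nextU (b u θ : ℝ) : ℝ := u * (1 - slopeProd b u θ) / (1 + nextSlope b u θ ^ 2)

/-- The value of `θ` after the step. -/
def nextTheta (b u θ : ℝ) : ℝ := nextSlope b u θ ^ (1 / (1 - b))

/-- Higher-order part of `logDrift`. -/
def driftErr (b u θ : ℝ) : ℝ :=
  1 / (1 - b) * log (1 + gapDamp b u θ) + log (1 - slopeProd b u θ)
    - log (1 + nextSlope b u θ ^ 2)

/-- Increment of `log (θ / u)` in one step. -/
def logDrift (b u θ : ℝ) : ℝ :=
  1 / (1 - b) * (log (gapNum b u θ) - log θ) - driftErr b u θ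

/-- The region in which the one-step estimates hold. -/
structure InRegion (b u θ : ℝ) : Prop where
  b_pos : 0 < b
  b_le : b ≤ 1 / 3
  u_pos : 0 < u
  u_le : u ≤ 1 / 10 ^ 18
  le_theta : u / 4 ≤ θ
  theta_le : θ ≤ 2 * u

lemma rpow_two_sub_le {b u : ℝ} (hb : b ≤ 1 / 3) (hu : 0 < u) (hu1 : u ≤ 1 / 10 ^ 18) :
    u ^ (2 - 2 * b) ≤ u / 10 ^ 6 := by
  have e : u ^ (2 - 2 * b) = u * u ^ (1 - 2 * b) := by
    rw [← rpow_one_add' hu.le (by linarith)]; congr 1; ring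
  have h : u ^ (1 - 2 * b) ≤ 1 / 10 ^ 6 := by
    calc u ^ (1 - 2 * b) ≤ u ^ (1 / 3 : ℝ) :=
          rpow_le_rpow_of_exponent_ge hu (by linarith [show (1:ℝ) / 10 ^ 18 ≤ 1 by norm_num])
            (by linarith)
      _ ≤ (1 / 10 ^ 18) ^ (1 / 3 : ℝ) := rpow_le_rpow hu.le hu1 (by norm_num)
      _ = ((1 / 10 ^ 6) ^ (3 : ℝ)) ^ (1 / 3 : ℝ) := by norm_num
      _ = 1 / 10 ^ 6 := by rw [← rpow_mul (by norm_num)]; norm_num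
  rw [e, div_eq_mul_one_div]
  gcongr

lemma le_rpow_of_le_one {c x : ℝ} (hx0 : 0 < x) (hx1 : x ≤ 1) (hc : c ≤ 1) : x ≤ x ^ c := by
  simpa using rpow_le_rpow_of_exponent_ge hx0 hx1 hc

namespace InRegion

variable {b u θ : ℝ} (h : InRegion b u θ)
include h

lemma q_bounds : 1 ≤ 1 / (1 - b) ∧ 1 / (1 - b) ≤ 3 / 2 := by
  have h1 := h.b_pos
  have h2 := h.b_le
  constructor
  · rw [le_div_iff₀ (by linarith)]; linarith
  · rw [div_le_iff₀ (by linarith)]; linarith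

lemma theta_pos : 0 < θ := by linarith [h.u_pos, h.le_theta]

lemma U_pos : 0 < u ^ (2 - 2 * b) := rpow_pos_of_pos h.u_pos _

lemma U_le : u ^ (2 - 2 * b) ≤ u / 10 ^ 6 := rpow_two_sub_le h.b_le h.u_pos h.u_le

lemma gapNum_bounds : u / 3 ≤ gapNum b u θ ∧ gapNum b u θ ≤ u := by
  have h1 := rpow_one_add_le_one_add_mul_self (s := θ) (by linarith [h.theta_pos]) h.b_pos.le
    (by linarith [h.b_le])
  have h2 : 1 ≤ (1 + θ) ^ b := one_le_rpow (by linarith [h.theta_pos]) h.b_pos.le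
  have h3 : b * θ ≤ 1 / 3 * (2 * u) :=
    mul_le_mul h.b_le h.theta_le h.theta_pos.le (by norm_num)
  have h4 := h.u_pos
  have h5 := h.u_le
  have h6 : 0 ≤ 1 - u := by norm_num at h5 ⊢; linarith
  have h7 : 0 ≤ b * θ := mul_nonneg h.b_pos.le h.theta_pos.le
  unfold gapNum
  constructor <;> nlinarith

lemma one_add_rpow_le : (1 + θ) ^ b ≤ 2 := by
  have h1 := rpow_one_add_le_one_add_mul_self (s := θ) (by linarith [h.theta_pos]) h.b_pos.le
    (by linarith [h.b_le])
  have h3 : b * θ ≤ 1 / 3 * (2 * u) :=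
    mul_le_mul h.b_le h.theta_le h.theta_pos.le (by norm_num)
  have h5 := h.u_le
  norm_num at h5
  linarith

lemma theta_rpow_le : θ ^ (1 - 2 * b) ≤ 2 * u ^ (1 - 2 * b) := by
  have h1 := h.b_pos
  have h2 := h.b_le
  calc θ ^ (1 - 2 * b) ≤ (2 * u) ^ (1 - 2 * b) :=
        rpow_le_rpow h.theta_pos.le h.theta_le (by linarith)
    _ = 2 ^ (1 - 2 * b) * u ^ (1 - 2 * b) := mul_rpow (by norm_num) h.u_pos.le
    _ ≤ 2 ^ (1 : ℝ) * u ^ (1 - 2 * b) := by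
        have := (rpow_pos_of_pos h.u_pos (1 - 2 * b)).le
        gcongr
        · norm_num
        · linarith
    _ = _ := by norm_num

lemma U_eq : u ^ (2 - 2 * b) = u * u ^ (1 - 2 * b) := by
  rw [← rpow_one_add' h.u_pos.le (by linarith [h.b_le])]; congr 1; ring

lemma U_eq' : u ^ (2 - 2 * b) = u ^ (-(2 * b)) * u ^ 2 := by
  rw [← rpow_natCast, ← rpow_add h.u_pos]; congr 1; push_cast; ring

lemma gapDamp_bounds : 0 < gapDamp b u θ ∧ gapDamp b u θ ≤ 4 * u ^ (2 - 2 * b) := by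
  have h1 := h.u_pos
  have h2 := rpow_pos_of_pos h.theta_pos (1 - 2 * b)
  have h3 : 0 < (1 + θ) ^ b := rpow_pos_of_pos (by linarith [h.theta_pos]) _
  refine ⟨by unfold gapDamp; positivity, ?_⟩
  rw [h.U_eq]
  calc gapDamp b u θ ≤ u * (2 * u ^ (1 - 2 * b)) * 2 := by
        unfold gapDamp
        gcongr
        · exact h.theta_rpow_le
        · exact h.one_add_rpow_le
    _ = _ := by ring

lemma damp_small : 4 * u ^ (2 - 2 * b) ≤ 1 / 10 ^ 18 := by
  have := h.U_le
  have := h.u_le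
  norm_num at *; linarith

lemma gapQuot_bounds : u / 4 ≤ gapQuot b u θ ∧ gapQuot b u θ ≤ u := by
  obtain ⟨h1, h2⟩ := h.gapNum_bounds
  obtain ⟨h3, h4⟩ := h.gapDamp_bounds
  have h5 := h.damp_small
  have h6 := h.u_pos
  unfold gapQuot
  constructor
  · rw [le_div_iff₀ (by linarith)]
    norm_num at h5
    nlinarith
  · rw [div_le_iff₀ (by linarith)]; nlinarith

lemma gapQuot_pos : 0 < gapQuot b u θ := by linarith [h.gapQuot_bounds.1, h.u_pos]

lemma gapNum_pos : 0 < gapNum b u θ := by linarith [h.gapNum_bounds.1, h.u_pos]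

lemma slopeProd_bounds : 0 < slopeProd b u θ ∧ slopeProd b u θ ≤ 2 * u ^ (2 - 2 * b) := by
  have h1 := h.u_pos
  have h2 := rpow_pos_of_pos h.theta_pos (1 - 2 * b)
  have h3 := h.gapQuot_pos
  have h4 := (rpow_pos_of_pos h.u_pos (1 - 2 * b)).le
  refine ⟨by unfold slopeProd; positivity, ?_⟩
  rw [h.U_eq]
  calc slopeProd b u θ ≤ (2 * u ^ (1 - 2 * b)) * u := by
        unfold slopeProd
        gcongr
        · exact h.theta_rpow_le
        · exact h.gapQuot_bounds.2
    _ = _ := by ring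

lemma nextSlope_pos : 0 < nextSlope b u θ :=
  mul_pos (rpow_pos_of_pos h.theta_pos _) h.gapQuot_pos

lemma nextSlope_sq : nextSlope b u θ ^ 2 = θ ^ (-(2 * b)) * gapQuot b u θ ^ 2 := by
  rw [nextSlope, mul_pow, ← rpow_mul_natCast h.theta_pos.le]
  congr 2; push_cast; ring

lemma nextSlope_sq_bounds : u ^ (2 - 2 * b) / 32 ≤ nextSlope b u θ ^ 2 ∧
    nextSlope b u θ ^ 2 ≤ 4 * u ^ (2 - 2 * b) := by
  have hb0 := h.b_pos
  have hb1 := h.b_le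
  have h1 := h.u_pos
  have hu := (rpow_pos_of_pos h.u_pos (-(2 * b))).le
  rw [h.nextSlope_sq, h.U_eq']
  constructor
  · have h2 : u ^ (-(2 * b)) / 2 ≤ θ ^ (-(2 * b)) := by
      calc u ^ (-(2 * b)) / 2 = 2 ^ (-1 : ℝ) * u ^ (-(2 * b)) := by
            rw [rpow_neg_one]; ring
        _ ≤ 2 ^ (-(2 * b)) * u ^ (-(2 * b)) := by
            gcongr
            · norm_num
            · linarith
        _ = (2 * u) ^ (-(2 * b)) := (mul_rpow (by norm_num) h1.le).symm
        _ ≤ θ ^ (-(2 * b)) := rpow_le_rpow_of_nonpos h.theta_pos h.theta_le (by linarith)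
    calc u ^ (-(2 * b)) * u ^ 2 / 32 = u ^ (-(2 * b)) / 2 * (u / 4) ^ 2 := by ring
      _ ≤ _ := by
        gcongr
        · exact rpow_nonneg h.theta_pos.le _
        · exact h.gapQuot_bounds.1
  · have h2 : θ ^ (-(2 * b)) ≤ 4 * u ^ (-(2 * b)) := by
      calc θ ^ (-(2 * b)) ≤ (u / 4) ^ (-(2 * b)) :=
            rpow_le_rpow_of_nonpos (by positivity) h.le_theta (by linarith)
        _ = (4 * u⁻¹) ^ (2 * b) := by
            rw [rpow_neg (by positivity), ← inv_rpow (by positivity)]; congr 1; field_simp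
        _ = 4 ^ (2 * b) * u ^ (-(2 * b)) := by
            rw [mul_rpow (by norm_num) (by positivity), inv_rpow h1.le, rpow_neg h1.le]
        _ ≤ 4 ^ (1 : ℝ) * u ^ (-(2 * b)) := by
            gcongr
            · norm_num
            · linarith
        _ = _ := by norm_num
    have h3 := h.gapQuot_pos.le
    calc θ ^ (-(2 * b)) * gapQuot b u θ ^ 2 ≤ (4 * u ^ (-(2 * b))) * u ^ 2 := by
          gcongr
          exact h.gapQuot_bounds.2
      _ = _ := by ring

end InRegion

namespace InRegion

variable {b u θ : ℝ} (h : InRegion b u θ)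
include h

lemma U_tiny : u ^ (2 - 2 * b) ≤ 1 / 10 ^ 24 := by
  have := h.U_le
  have := h.u_le
  norm_num at *; linarith

lemma log_nextU : log (nextU b u θ) =
    log u + log (1 - slopeProd b u θ) - log (1 + nextSlope b u θ ^ 2) := by
  have h1 := h.slopeProd_bounds
  have h2 := h.U_tiny
  norm_num at h2
  have h3 : 0 < 1 - slopeProd b u θ := by linarith
  have h4 := h.u_pos
  have h5 : 0 < 1 + nextSlope b u θ ^ 2 := by positivity
  rw [nextU, log_div (by positivity) h5.ne', log_mul h4.ne' h3.ne']

lemma nextU_pos : 0 < nextU b u θ := by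
  have h1 := h.slopeProd_bounds
  have h2 := h.U_tiny
  norm_num at h2
  have h3 : 0 < 1 - slopeProd b u θ := by linarith
  have h4 := h.u_pos
  unfold nextU
  positivity

lemma nextU_le : nextU b u θ ≤ u := by
  have h1 := h.slopeProd_bounds
  have h4 := h.u_pos
  unfold nextU
  rw [div_le_iff₀ (by positivity)]
  nlinarith [sq_nonneg (nextSlope b u θ)]

lemma log_one_sub_slopeProd : -(4 * u ^ (2 - 2 * b)) ≤ log (1 - slopeProd b u θ) ∧
    log (1 - slopeProd b u θ) ≤ 0 := by
  have h1 := h.slopeProd_bounds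
  have h2 := h.U_tiny
  norm_num at h2
  have h3 : 0 < 1 - slopeProd b u θ := by linarith
  refine ⟨?_, log_nonpos h3.le (by linarith)⟩
  have h4 := one_sub_inv_le_log_of_pos h3
  have h5 : (1 - slopeProd b u θ)⁻¹ ≤ 1 + 2 * slopeProd b u θ := by
    rw [inv_le_iff_one_le_mul₀ h3]; nlinarith
  linarith

lemma log_one_add_nextSlope_sq : 0 ≤ log (1 + nextSlope b u θ ^ 2) ∧
    log (1 + nextSlope b u θ ^ 2) ≤ 4 * u ^ (2 - 2 * b) := by
  have h1 := h.nextSlope_sq_bounds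
  have h3 := sq_nonneg (nextSlope b u θ)
  refine ⟨log_nonneg (by linarith), ?_⟩
  have := log_le_sub_one_of_pos (show 0 < 1 + nextSlope b u θ ^ 2 by linarith)
  linarith

lemma log_one_add_gapDamp : 0 ≤ log (1 + gapDamp b u θ) ∧
    log (1 + gapDamp b u θ) ≤ 4 * u ^ (2 - 2 * b) := by
  have h1 := h.gapDamp_bounds
  refine ⟨log_nonneg (by linarith), ?_⟩
  have := log_le_sub_one_of_pos (show 0 < 1 + gapDamp b u θ by linarith)
  linarith

lemma log_sub_log_nextU : 0 ≤ log u - log (nextU b u θ) ∧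
    log u - log (nextU b u θ) ≤ 8 * u ^ (2 - 2 * b) := by
  have h1 := h.log_one_sub_slopeProd
  have h2 := h.log_one_add_nextSlope_sq
  rw [h.log_nextU]
  constructor <;> linarith

lemma abs_driftErr_le : |driftErr b u θ| ≤ 14 * u ^ (2 - 2 * b) := by
  have h1 := h.log_one_sub_slopeProd
  have h2 := h.log_one_add_nextSlope_sq
  have h3 := h.log_one_add_gapDamp
  have h4 := h.q_bounds
  have h5 : 1 / (1 - b) * log (1 + gapDamp b u θ) ≤ 3 / 2 * (4 * u ^ (2 - 2 * b)) :=
    mul_le_mul h4.2 h3.2 h3.1 (by norm_num)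
  have h6 : 0 ≤ 1 / (1 - b) * log (1 + gapDamp b u θ) := mul_nonneg (by linarith) h3.1
  have h7 := h.U_pos
  rw [abs_le]
  unfold driftErr
  constructor <;> linarith

lemma log_nextTheta : log (nextTheta b u θ) = 1 / (1 - b) *
    (-b * log θ + (log (gapNum b u θ) - log (1 + gapDamp b u θ))) := by
  rw [nextTheta, log_rpow h.nextSlope_pos, nextSlope,
    log_mul (rpow_pos_of_pos h.theta_pos _).ne' h.gapQuot_pos.ne', log_rpow h.theta_pos, gapQuot,
    log_div h.gapNum_pos.ne' (by linarith [h.gapDamp_bounds.1])]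

lemma logDrift_eq : (log (nextTheta b u θ) - log (nextU b u θ)) - (log θ - log u) =
    logDrift b u θ := by
  have hb := h.b_le
  have : 1 - b ≠ 0 := by linarith
  rw [h.log_nextTheta, h.log_nextU, logDrift, driftErr]
  field_simp
  ring

lemma abs_log_gapNum_sub_le (hd : |logDrift b u θ| ≤ u / 16) :
    |log (gapNum b u θ) - log θ| ≤ u / 16 + 14 * u ^ (2 - 2 * b) := by
  have h1 := h.abs_driftErr_le
  have h2 := h.q_bounds
  have h3 : 1 / (1 - b) * (log (gapNum b u θ) - log θ) =
      logDrift b u θ + driftErr b u θ := by unfold logDrift; ring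
  calc |log (gapNum b u θ) - log θ| ≤ 1 / (1 - b) * |log (gapNum b u θ) - log θ| :=
        le_mul_of_one_le_left (abs_nonneg _) h2.1
    _ = |logDrift b u θ + driftErr b u θ| := by
        rw [← h3, abs_mul, abs_of_nonneg (a := 1 / (1 - b)) (by linarith)]
    _ ≤ _ := (abs_add_le _ _).trans (by linarith)

lemma theta_tight (hd : |logDrift b u θ| ≤ u / 16) : u / 2 ≤ θ ∧ θ ≤ 3 / 2 * u := by
  have h1 := abs_le.1 (h.abs_log_gapNum_sub_le hd)
  have h2 := h.U_le
  have h3 := h.u_le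
  have h4 := h.u_pos
  have ht := h.theta_pos
  have hg := h.gapNum_pos
  norm_num at h3
  have e1 := log_le_sub_one_of_pos (show 0 < θ / gapNum b u θ by positivity)
  have e2 := one_sub_inv_le_log_of_pos (show 0 < θ / gapNum b u θ by positivity)
  rw [log_div ht.ne' hg.ne'] at e1 e2
  rw [inv_div] at e2
  have e3 : gapNum b u θ / θ ≤ 11 / 10 := by
    have e4 := one_sub_inv_le_log_of_pos (show 0 < gapNum b u θ / θ by positivity)
    have e5 : (gapNum b u θ / θ)⁻¹ ≥ 99 / 100 := by
      rw [log_div hg.ne' ht.ne'] at e4; linarith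
    have e6 : gapNum b u θ / θ ≤ (99 / 100)⁻¹ := by
      rw [← inv_inv (gapNum b u θ / θ)]
      exact inv_anti₀ (by norm_num) e5
    linarith [show (99 / 100 : ℝ)⁻¹ ≤ 11 / 10 by norm_num]
  have e7 : 99 / 100 ≤ gapNum b u θ / θ := by linarith
  rw [div_le_iff₀ ht] at e3
  rw [le_div_iff₀ ht] at e7
  have h5 := rpow_one_add_le_one_add_mul_self (s := θ) (by linarith) h.b_pos.le
    (by linarith [h.b_le])
  have h6 : b * θ ≤ 1 / 3 * θ := mul_le_mul_of_nonneg_right h.b_le ht.le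
  have h7 : u - 1 / 3 * θ ≤ gapNum b u θ := by
    unfold gapNum
    have : 0 ≤ u * (b * θ) := by have := h.b_pos; positivity
    have h8 : (1 - u) * (1 + θ) ^ b ≤ (1 - u) * (1 + b * θ) := by
      gcongr
      linarith
    nlinarith
  have h9 := h.gapNum_bounds.2
  constructor <;> linarith

omit h in
lemma gapNum_scale {c : ℝ} (hb0 : 0 ≤ b) (hb1 : b ≤ 1) (hu : 0 ≤ u) (ht : 0 ≤ θ)
    (hc0 : 0 ≤ c) (hc1 : c ≤ 1) :
    |gapNum b (c * u) (c * θ) - c * gapNum b u θ| ≤ (1 - c) * (b * (θ * (θ + u))) := by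
  have h1 := one_add_rpow_scale_le hb0 hb1 ht hc0 hc1
  have h2 := one_add_rpow_scale_nonneg hb0 hb1 ht hc0 hc1
  have hct : c * θ ≤ θ := mul_le_of_le_one_left ht hc1
  have h3 := one_add_rpow_sub_le hb0 hb1 (mul_nonneg hc0 ht) hct
  have h4 : (1 + c * θ) ^ b ≤ (1 + θ) ^ b := rpow_le_rpow (by positivity) (by linarith) hb0
  have e : gapNum b (c * u) (c * θ) - c * gapNum b u θ =
      -((1 + c * θ) ^ b - 1 - c * ((1 + θ) ^ b - 1)) -
        c * u * ((1 + θ) ^ b - (1 + c * θ) ^ b) := by unfold gapNum; ring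
  have h5 : 0 ≤ c * u * ((1 + θ) ^ b - (1 + c * θ) ^ b) :=
    mul_nonneg (mul_nonneg hc0 hu) (by linarith)
  have h6 : c * u * ((1 + θ) ^ b - (1 + c * θ) ^ b) ≤ 1 * u * (b * (θ - c * θ)) := by
    gcongr
  rw [e, abs_of_nonpos (by linarith)]
  nlinarith

lemma log_gapNum_sub_le {θ₂ : ℝ} (h2 : InRegion b u θ₂) (hle : θ ≤ θ₂) :
    0 ≤ log (gapNum b u θ) - log (gapNum b u θ₂) ∧
    log (gapNum b u θ) - log (gapNum b u θ₂) ≤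
      (1 - u) * b * (θ₂ / gapNum b u θ₂) * (log θ₂ - log θ) := by
  have hu := h.u_le
  norm_num at hu
  have hu0 := h.u_pos
  have hb := h.b_pos
  have ht := h.theta_pos
  have ht2 := h2.theta_pos
  have hg1 := h.gapNum_pos
  have hg2 := h2.gapNum_pos
  have hmono : gapNum b u θ₂ ≤ gapNum b u θ := by
    unfold gapNum
    have : (1 + θ) ^ b ≤ (1 + θ₂) ^ b := rpow_le_rpow (by linarith) (by linarith) hb.le
    nlinarith
  have e1 := one_add_rpow_sub_le hb.le (by linarith [h.b_le]) ht.le hle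
  have e2 := abs_log_sub_log_le hg2 hmono le_rfl
  have e3 := abs_sub_le_mul_abs_log ht2 ht le_rfl hle
  rw [abs_of_nonneg (sub_nonneg.2 (log_le_log hg2 hmono)),
    abs_of_nonneg (sub_nonneg.2 hmono)] at e2
  rw [abs_of_nonneg (sub_nonneg.2 (log_le_log ht hle)), abs_of_nonneg (sub_nonneg.2 hle)] at e3
  refine ⟨sub_nonneg.2 (log_le_log hg2 hmono), e2.trans ?_⟩
  calc (gapNum b u θ - gapNum b u θ₂) / gapNum b u θ₂
      = (1 - u) * ((1 + θ₂) ^ b - (1 + θ) ^ b) / gapNum b u θ₂ := by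
        congr 1; unfold gapNum; ring
    _ ≤ (1 - u) * (b * (θ₂ * (log θ₂ - log θ))) / gapNum b u θ₂ := by
        have : 0 ≤ 1 - u := by linarith
        gcongr
        exact e1.trans (mul_le_mul_of_nonneg_left e3 hb.le)
    _ = _ := by ring

lemma abs_log_gapNum_sub_crude {θ₂ : ℝ} (h2 : InRegion b u θ₂) :
    |log (gapNum b u θ) - log (gapNum b u θ₂)| ≤ 2 * |log θ₂ - log θ| := by
  wlog hle : θ ≤ θ₂ generalizing θ θ₂
  · rw [abs_sub_comm, abs_sub_comm (log θ₂)]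
    exact this h2 h (by linarith)
  obtain ⟨e1, e2⟩ := h.log_gapNum_sub_le h2 hle
  have e3 : 0 ≤ log θ₂ - log θ := sub_nonneg.2 (log_le_log h.theta_pos hle)
  rw [abs_of_nonneg e1, abs_of_nonneg e3]
  refine e2.trans (mul_le_mul_of_nonneg_right ?_ e3)
  have hu := h.u_le
  norm_num at hu
  have hg2 := h2.gapNum_pos
  have hu0 := h.u_pos
  have e4 : θ₂ / gapNum b u θ₂ ≤ 6 := by
    rw [div_le_iff₀ hg2]; linarith [h2.theta_le, h2.gapNum_bounds.1]
  have e5 : 0 < θ₂ / gapNum b u θ₂ := div_pos h2.theta_pos hg2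
  calc (1 - u) * b * (θ₂ / gapNum b u θ₂) ≤ 1 * (1 / 3) * 6 := by
        have := h.b_le
        have := h.b_pos
        gcongr
        linarith
    _ = 2 := by norm_num

/-- The contraction estimate: the factor `1 - u / 2` is what makes the critical case converge. -/
lemma abs_log_gapNum_sub_le_contr {θ₂ : ℝ} (h2 : InRegion b u θ₂)
    (hg : |log (gapNum b u θ) - log θ| ≤ u / 16 + 14 * u ^ (2 - 2 * b))
    (hd : |log θ₂ - log θ| ≤ u / 16) :
    |log (gapNum b u θ) - log (gapNum b u θ₂)| ≤ b * (1 - u / 2) * |log θ₂ - log θ| := by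
  have hu := h.u_le
  norm_num at hu
  have hu0 := h.u_pos
  have hU := h.U_le
  have hb := h.b_pos
  have key : ∀ t, 0 < t → 0 < gapNum b u t → log t - log (gapNum b u t) ≤ u / 2 →
      (1 - u) * b * (t / gapNum b u t) ≤ b * (1 - u / 2) := by
    intro t ht hgt hlog
    have e1 := one_sub_inv_le_log_of_pos (show 0 < t / gapNum b u t by positivity)
    rw [log_div ht.ne' hgt.ne', inv_div] at e1
    have e2 : 1 - u / 2 ≤ gapNum b u t / t := by linarith
    rw [le_div_iff₀ ht] at e2
    have e3 : (1 - u) * (t / gapNum b u t) ≤ 1 - u / 2 := by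
      rw [← mul_div_assoc, div_le_iff₀ hgt]
      nlinarith [mul_le_mul_of_nonneg_left e2 (show 0 ≤ 1 - u / 2 by linarith),
        mul_nonneg (sq_nonneg u) ht.le]
    nlinarith
  have hcr := h.abs_log_gapNum_sub_crude h2
  rcases le_total θ θ₂ with hle | hle
  · obtain ⟨e1, e2⟩ := h.log_gapNum_sub_le h2 hle
    have e3 : 0 ≤ log θ₂ - log θ := sub_nonneg.2 (log_le_log h.theta_pos hle)
    rw [abs_of_nonneg e1, abs_of_nonneg e3] at *
    refine e2.trans (mul_le_mul_of_nonneg_right ?_ e3)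
    refine key _ h2.theta_pos h2.gapNum_pos ?_
    have := (abs_le.1 hg).1
    linarith
  · obtain ⟨e1, e2⟩ := h2.log_gapNum_sub_le h hle
    have e3 : 0 ≤ log θ - log θ₂ := sub_nonneg.2 (log_le_log h2.theta_pos hle)
    rw [abs_sub_comm, abs_sub_comm (log θ₂), abs_of_nonneg e1, abs_of_nonneg e3]
    refine e2.trans (mul_le_mul_of_nonneg_right ?_ e3)
    refine key _ h.theta_pos h.gapNum_pos ?_
    have := (abs_le.1 hg).1
    linarith

lemma abs_driftErr_sub_le {u₂ θ₂ N : ℝ} (h2 : InRegion b u₂ θ₂) (hle : u₂ ≤ u)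
    (hu : |log u₂ - log u| ≤ N) (ht : |log θ₂ - log θ| ≤ N)
    (hg : |log (gapNum b u₂ θ₂) - log (gapNum b u θ)| ≤ 2 * N) :
    |driftErr b u₂ θ₂ - driftErr b u θ| ≤ 200 * u ^ (2 - 2 * b) * N := by
  have hb := h.b_pos
  have hb1 := h.b_le
  have hN : 0 ≤ N := (abs_nonneg _).trans hu
  have hUU : u₂ ^ (2 - 2 * b) ≤ u ^ (2 - 2 * b) := rpow_le_rpow h2.u_pos.le hle (by linarith)
  have hU0 := h.U_pos
  have hUt := h.U_tiny
  norm_num at hUt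
  set U := u ^ (2 - 2 * b) with hU
  have hθ := h.theta_pos
  have hθ2 := h2.theta_pos
  have hlog1 : |log (1 + θ₂) - log (1 + θ)| ≤ N := by
    have e1 := abs_log_sub_log_le one_pos (show 1 ≤ 1 + θ₂ by linarith)
      (show 1 ≤ 1 + θ by linarith)
    have e2 := abs_sub_le_mul_abs_log (M := 1) hθ2 hθ
      (by have := h2.theta_le; have := h2.u_le; norm_num at this; linarith)
      (by have := h.theta_le; have := h.u_le; norm_num at this; linarith)
    have e3 : (1 + θ₂) - (1 + θ) = θ₂ - θ := by ring
    rw [e3, div_one] at e1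
    linarith
  have hDamp : |log (gapDamp b u₂ θ₂) - log (gapDamp b u θ)| ≤ 3 * N := by
    have e : ∀ {v t : ℝ}, InRegion b v t →
        log (gapDamp b v t) = log v + (1 - 2 * b) * log t + b * log (1 + t) := by
      intro v t hr
      have h1 := hr.u_pos
      have h2 := hr.theta_pos
      rw [gapDamp, log_mul (by positivity) (by positivity), log_mul (by positivity) (by positivity),
        log_rpow h2, log_rpow (by linarith)]
    rw [e h2, e h]
    rw [abs_le] at *
    constructor <;> nlinarith
  have hX1 : |log (1 + gapDamp b u₂ θ₂) - log (1 + gapDamp b u θ)| ≤ 12 * U * N := by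
    have a1 := h.gapDamp_bounds
    have a2 := h2.gapDamp_bounds
    have e1 := abs_log_sub_log_le one_pos (show 1 ≤ 1 + gapDamp b u₂ θ₂ by linarith)
      (show 1 ≤ 1 + gapDamp b u θ by linarith)
    have e2 := abs_sub_le_mul_abs_log (M := 4 * U) a2.1 a1.1 (by linarith) a1.2
    rw [add_sub_add_left_eq_sub, div_one] at e1
    nlinarith
  have hQ : |log (gapQuot b u₂ θ₂) - log (gapQuot b u θ)| ≤ 3 * N := by
    have e : ∀ {v t : ℝ}, InRegion b v t →
        log (gapQuot b v t) = log (gapNum b v t) - log (1 + gapDamp b v t) := by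
      intro v t hr
      rw [gapQuot, log_div hr.gapNum_pos.ne' (by linarith [hr.gapDamp_bounds.1])]
    rw [e h2, e h]
    have : 12 * U * N ≤ N := by nlinarith
    rw [abs_le] at *
    constructor <;> linarith
  have hX2 : |log (1 - slopeProd b u₂ θ₂) - log (1 - slopeProd b u θ)| ≤ 32 * U * N := by
    have a1 := h.slopeProd_bounds
    have a2 := h2.slopeProd_bounds
    have e : ∀ {v t : ℝ}, InRegion b v t →
        log (slopeProd b v t) = (1 - 2 * b) * log t + log (gapQuot b v t) := by
      intro v t hr
      have h2 := hr.theta_pos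
      rw [slopeProd, log_mul (by positivity) hr.gapQuot_pos.ne', log_rpow h2]
    have e0 : |log (slopeProd b u₂ θ₂) - log (slopeProd b u θ)| ≤ 4 * N := by
      rw [e h2, e h]
      rw [abs_le] at *
      constructor <;> nlinarith
    have e1 := abs_log_sub_log_le (m := 1 / 2) (by norm_num)
      (show 1 / 2 ≤ 1 - slopeProd b u₂ θ₂ by linarith)
      (show 1 / 2 ≤ 1 - slopeProd b u θ by linarith)
    have e2 := abs_sub_le_mul_abs_log (M := 4 * U) a2.1 a1.1 (by linarith) (by linarith)
    rw [sub_sub_sub_cancel_left, abs_sub_comm (slopeProd b u θ)] at e1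
    rw [le_div_iff₀ (by norm_num)] at e1
    nlinarith
  have hX3 : |log (1 + nextSlope b u₂ θ₂ ^ 2) - log (1 + nextSlope b u θ ^ 2)| ≤ 28 * U * N := by
    have a1 := h.nextSlope_sq_bounds
    have a2 := h2.nextSlope_sq_bounds
    have p1 := pow_pos h.nextSlope_pos 2
    have p2 := pow_pos h2.nextSlope_pos 2
    have e : ∀ {v t : ℝ}, InRegion b v t →
        log (nextSlope b v t ^ 2) = -(2 * b) * log t + 2 * log (gapQuot b v t) := by
      intro v t hr
      have h2 := hr.theta_pos
      have h3 := hr.gapQuot_pos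
      rw [hr.nextSlope_sq, log_mul (by positivity) (by positivity), log_rpow h2, log_pow]
      push_cast; ring
    have e0 : |log (nextSlope b u₂ θ₂ ^ 2) - log (nextSlope b u θ ^ 2)| ≤ 7 * N := by
      rw [e h2, e h]
      rw [abs_le] at *
      constructor <;> nlinarith
    have e1 := abs_log_sub_log_le one_pos (show 1 ≤ 1 + nextSlope b u₂ θ₂ ^ 2 by linarith)
      (show 1 ≤ 1 + nextSlope b u θ ^ 2 by linarith)
    have e2 := abs_sub_le_mul_abs_log (M := 4 * U) p2 p1 (by linarith) a1.2
    rw [add_sub_add_left_eq_sub, div_one] at e1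
    nlinarith
  have hq := h.q_bounds
  have hX1' : |1 / (1 - b) * (log (1 + gapDamp b u₂ θ₂) - log (1 + gapDamp b u θ))|
      ≤ 18 * U * N := by
    rw [abs_mul, abs_of_nonneg (a := 1 / (1 - b)) (by linarith)]
    calc _ ≤ 3 / 2 * (12 * U * N) := mul_le_mul hq.2 hX1 (abs_nonneg _) (by norm_num)
      _ = _ := by ring
  have hUN : 0 ≤ U * N := by positivity
  unfold driftErr
  rw [mul_sub] at hX1'
  rw [abs_le] at *
  constructor <;> linarith

lemma next (hd : |logDrift b u θ| ≤ u / 16) :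
    InRegion b (nextU b u θ) (nextTheta b u θ) := by
  have hu0 := h.u_pos
  have hu' := h.nextU_pos
  have hθ' : 0 < nextTheta b u θ := rpow_pos_of_pos h.nextSlope_pos _
  have hθ := h.theta_pos
  have hul := h.u_le
  norm_num at hul
  obtain ⟨t1, t2⟩ := h.theta_tight hd
  have e := h.logDrift_eq
  have e0 : log ((nextTheta b u θ / nextU b u θ) / (θ / u)) = logDrift b u θ := by
    rw [log_div (by positivity) (by positivity), log_div (by positivity) (by positivity),
      log_div (by positivity) (by positivity), e]
  have hr : 0 < (nextTheta b u θ / nextU b u θ) / (θ / u) := by positivity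
  have e1 := one_sub_inv_le_log_of_pos hr
  have e2 := one_sub_inv_le_log_of_pos (inv_pos.2 hr)
  rw [log_inv, inv_inv] at e2
  rw [e0] at e1 e2
  have e3 := abs_le.1 hd
  have e4 : 99 / 100 ≤ (nextTheta b u θ / nextU b u θ) / (θ / u) := by linarith
  have e5 : 99 / 100 ≤ ((nextTheta b u θ / nextU b u θ) / (θ / u))⁻¹ := by linarith
  rw [inv_div, le_div_iff₀ (by positivity)] at e5
  rw [le_div_iff₀ (by positivity)] at e4
  have s1 : 1 / 2 ≤ θ / u := by rw [le_div_iff₀ hu0]; linarith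
  have s2 : θ / u ≤ 3 / 2 := by rw [div_le_iff₀ hu0]; linarith
  have s3 : 1 / 4 ≤ nextTheta b u θ / nextU b u θ := by linarith
  have s4 : nextTheta b u θ / nextU b u θ ≤ 2 := by linarith
  rw [le_div_iff₀ hu'] at s3
  rw [div_le_iff₀ hu'] at s4
  exact ⟨h.b_pos, h.b_le, hu', h.nextU_le.trans h.u_le, by linarith, s4⟩

omit h in
lemma contraction_bound {u' q U e d x y z : ℝ} (hu0 : 0 < u) (hu : u ≤ 1 / 2) (hU0 : 0 < U)
    (hU : U ≤ u / 10 ^ 6) (hq1 : 1 ≤ q) (hq2 : q ≤ 3 / 2) (hqb : q - 1 = q * b)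
    (hu' : u * (1 - 8 * U) ≤ u') (he : |e| ≤ u / 16) (hx : |x| ≤ b * (1 - u / 2) * |e|)
    (hy : |y| ≤ 96 * u * U) (hz : |z| ≤ 200 * U * (|e| + 8 * U))
    (hd : d = (1 - q) * e + q * x + q * y - z) : |d| ≤ u' / 16 := by
  have g1 : |(1 - q) * e| = (q - 1) * |e| := by
    rw [abs_mul, abs_of_nonpos (by linarith)]; ring
  have g2 : |q * x| ≤ (q - 1) * (1 - u / 2) * |e| := by
    rw [abs_mul, abs_of_nonneg (by linarith), hqb]
    calc q * |x| ≤ q * (b * (1 - u / 2) * |e|) := by gcongr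
      _ = _ := by ring
  have g3 : |q * y| ≤ 3 / 2 * (96 * u * U) := by
    rw [abs_mul, abs_of_nonneg (by linarith)]
    gcongr
  have g4 : (q - 1) * |e| + (q - 1) * (1 - u / 2) * |e| ≤ (1 - u / 4) * |e| := by
    have g : (q - 1) * (2 - u / 2) ≤ 1 / 2 * (2 - u / 2) :=
      mul_le_mul_of_nonneg_right (by linarith) (by linarith)
    have := mul_le_mul_of_nonneg_right g (abs_nonneg e)
    linarith
  have g5 : |d| ≤ (1 - u / 4) * |e| + 3 / 2 * (96 * u * U) + 200 * U * (|e| + 8 * U) := by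
    rw [hd]
    refine (abs_sub _ _).trans ?_
    refine (add_le_add (abs_add_le _ _) hz).trans ?_
    have := abs_add_le ((1 - q) * e) (q * x)
    linarith
  have g6 : (1 - u / 4) * |e| ≤ (1 - u / 4) * (u / 16) :=
    mul_le_mul_of_nonneg_left he (by linarith)
  have g7 : 200 * U * (|e| + 8 * U) ≤ 200 * (u / 10 ^ 6) * (u / 16 + 8 * (u / 10 ^ 6)) := by
    gcongr
  have g9 : u * U ≤ u * (u / 10 ^ 6) := by gcongr
  have g10 := mul_pos hu0 hu0
  norm_num at g7 g9
  linarith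

lemma abs_logDrift_next_le (hd : |logDrift b u θ| ≤ u / 16) :
    |logDrift b (nextU b u θ) (nextTheta b u θ)| ≤ nextU b u θ / 16 := by
  have hC := h.next hd
  have hu0 := h.u_pos
  have hu' := h.nextU_pos
  have hul := h.u_le
  norm_num at hul
  have hb0 := h.b_pos
  have hb1 := h.b_le
  have hU := h.U_le
  have hU0 := h.U_pos
  have hℓ := h.log_sub_log_nextU
  have hle := h.nextU_le
  have hed := h.logDrift_eq
  have hgθ := h.abs_log_gapNum_sub_le hd
  obtain ⟨hq1, hq2⟩ := h.q_bounds
  have hθ := h.theta_pos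
  have hθ' := hC.theta_pos
  set u' := nextU b u θ with hu'_def
  set θ' := nextTheta b u θ with hθ'_def
  set U := u ^ (2 - 2 * b) with hU_def
  have he_def : logDrift b u θ =
    1 / (1 - b) * (log (gapNum b u θ) - log θ) - driftErr b u θ := rfl
  generalize logDrift b u θ = e at *
  clear_value u' θ'
  obtain ⟨c, hc⟩ : ∃ c, c = u' / u := ⟨_, rfl⟩
  have hc0 : 0 < c := by rw [hc]; positivity
  have hc1 : c ≤ 1 := by rw [hc, div_le_one hu0]; exact hle
  have hcu : c * u = u' := by rw [hc]; field_simp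
  have hlogc : log c = log u' - log u := by rw [hc, log_div hu'.ne' hu0.ne']
  have hc2 : 1 - c ≤ 8 * U := by linarith [log_le_sub_one_of_pos hc0]
  have hc3 : 1 / 2 ≤ c := by linarith
  obtain ⟨t, ht⟩ : ∃ t, t = θ' / c := ⟨_, rfl⟩
  have hct : c * t = θ' := by rw [ht]; field_simp
  have ht0 : 0 < t := by rw [ht]; positivity
  have hlogt : log t - log θ = e := by
    rw [ht, log_div hθ'.ne' hc0.ne', hlogc, ← hed]; ring
  have hB : InRegion b u t := by
    refine ⟨hb0, hb1, hu0, h.u_le, ?_, ?_⟩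
    · rw [ht, le_div_iff₀ hc0]; linarith [hC.le_theta]
    · rw [ht, div_le_iff₀ hc0]; linarith [hC.theta_le]
  have h1 := h.abs_log_gapNum_sub_le_contr hB hgθ (by rw [hlogt]; exact hd)
  rw [hlogt] at h1
  have h2 : |log (gapNum b u' θ') - log (gapNum b u t) - log c| ≤ 96 * u * U := by
    have hs := gapNum_scale hb0.le (by linarith) hu0.le ht0.le hc0.le hc1
    rw [hcu, hct] at hs
    have hBg := hB.gapNum_bounds
    have hl := abs_log_sub_log_le (m := u' / 3) (x := gapNum b u' θ') (y := c * gapNum b u t)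
      (by positivity) hC.gapNum_bounds.1 (by rw [← hcu]; nlinarith)
    rw [log_mul hc0.ne' hB.gapNum_pos.ne'] at hl
    have e1 : log (gapNum b u' θ') - log (gapNum b u t) - log c =
      log (gapNum b u' θ') - (log c + log (gapNum b u t)) := by ring
    rw [e1]
    refine hl.trans ?_
    rw [div_le_iff₀ (by positivity)]
    refine hs.trans ?_
    calc (1 - c) * (b * (t * (t + u))) ≤ 8 * U * (1 / 3 * (2 * u * (2 * u + u))) := by
          have := hB.theta_le
          gcongr
      _ ≤ 96 * u * U * (1 / 2 * u / 3) := by nlinarith [mul_pos hU0 (mul_pos hu0 hu0)]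
      _ ≤ 96 * u * U * (u' / 3) := by rw [← hcu]; gcongr
  have h3 : |driftErr b u' θ' - driftErr b u θ| ≤ 200 * U * (|e| + 8 * U) := by
    have he := abs_nonneg e
    refine h.abs_driftErr_sub_le hC hle ?_ ?_ ?_
    · rw [abs_le]; constructor <;> linarith
    · have : log θ' - log θ = e + log c := by
        rw [← hct, log_mul hc0.ne' ht0.ne']; linarith
      rw [this, hlogc, abs_le]
      constructor <;> linarith [neg_abs_le e, le_abs_self e]
    · have hb : b * (1 - u / 2) * |e| ≤ |e| :=
        mul_le_of_le_one_left he (mul_le_one₀ (by linarith) (by linarith) (by linarith))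
      have : 96 * u * U ≤ U := mul_le_of_le_one_left hU0.le (by linarith)
      rw [abs_le] at h1 h2 ⊢
      constructor <;> linarith
  have h4 : logDrift b u' θ' = (1 - 1 / (1 - b)) * e
      + 1 / (1 - b) * (log (gapNum b u t) - log (gapNum b u θ))
      + 1 / (1 - b) * (log (gapNum b u' θ') - log (gapNum b u t) - log c)
      - (driftErr b u' θ' - driftErr b u θ) := by
    have e1 : log θ' = log c + (e + log θ) := by
      rw [← hct, log_mul hc0.ne' ht0.ne']; linarith
    rw [logDrift, e1]
    linear_combination -he_def
  have hqb : 1 / (1 - b) - 1 = 1 / (1 - b) * b := by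
    have : 1 - b ≠ 0 := by linarith
    field_simp
    ring
  rw [abs_sub_comm] at h1
  refine contraction_bound hu0 (by linarith) hU0 hU hq1 hq2 hqb ?_ hd h1 h2 h3 h4
  · have : u * (1 - c) ≤ u * (8 * U) := by gcongr
    linarith

end InRegion

section
open Filter Topology

/-- A trajectory of the map `(u, θ) ↦ (nextU, nextTheta)` started in the trapping region. -/
structure IsOrbit (b : ℝ) (u θ : ℕ → ℝ) : Prop where
  init : InRegion b (u 0) (θ 0)
  init_drift : |logDrift b (u 0) (θ 0)| ≤ u 0 / 16
  next_u : ∀ t, u (t + 1) = nextU b (u t) (θ t)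
  next_theta : ∀ t, θ (t + 1) = nextTheta b (u t) (θ t)

namespace IsOrbit

variable {b : ℝ} {u θ : ℕ → ℝ} (h : IsOrbit b u θ)
include h

lemma inv (t : ℕ) : InRegion b (u t) (θ t) ∧ |logDrift b (u t) (θ t)| ≤ u t / 16 := by
  induction t with
  | zero => exact ⟨h.init, h.init_drift⟩
  | succ t ih =>
    rw [h.next_u, h.next_theta]
    exact ⟨ih.1.next ih.2, ih.1.abs_logDrift_next_le ih.2⟩

lemma region (t : ℕ) : InRegion b (u t) (θ t) := (h.inv t).1

lemma U_inv (t : ℕ) : u t ^ (-(2 - 2 * b)) * u t ^ (2 - 2 * b) = 1 := by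
  rw [← rpow_add (h.region t).u_pos]; simp

/-- The ratio `u t / u (t + 1)`. -/
lemma ratio_eq (t : ℕ) : u (t + 1) ^ (-(2 - 2 * b)) = u t ^ (-(2 - 2 * b)) *
    ((1 + nextSlope b (u t) (θ t) ^ 2) / (1 - slopeProd b (u t) (θ t))) ^ (2 - 2 * b) := by
  have hr := h.region t
  have h1 := hr.slopeProd_bounds
  have h2 := hr.U_tiny
  norm_num at h2
  have h3 : 0 < 1 - slopeProd b (u t) (θ t) := by linarith
  have h4 := hr.u_pos
  have h5 : 0 < 1 + nextSlope b (u t) (θ t) ^ 2 := by positivity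
  rw [h.next_u, nextU, rpow_neg (by positivity), rpow_neg h4.le,
    ← inv_rpow (by positivity), ← inv_rpow h4.le, ← mul_rpow (by positivity) (by positivity)]
  congr 1
  field_simp

lemma growth (t : ℕ) : u t ^ (-(2 - 2 * b)) + 1 / 32 ≤ u (t + 1) ^ (-(2 - 2 * b)) := by
  have hr := h.region t
  have h1 := hr.slopeProd_bounds
  have h2 := hr.U_tiny
  norm_num at h2
  have h3 : 0 < 1 - slopeProd b (u t) (θ t) := by linarith
  have h5 := hr.nextSlope_sq_bounds.1
  have h6 := hr.U_pos
  have hb := hr.b_le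
  rw [h.ratio_eq]
  have hV := rpow_pos_of_pos hr.u_pos (-(2 - 2 * b))
  have e1 : 1 + nextSlope b (u t) (θ t) ^ 2 ≤
      (1 + nextSlope b (u t) (θ t) ^ 2) / (1 - slopeProd b (u t) (θ t)) := by
    rw [le_div_iff₀ h3]; nlinarith
  have e2 := self_le_rpow_of_one_le
    (show 1 ≤ (1 + nextSlope b (u t) (θ t) ^ 2) / (1 - slopeProd b (u t) (θ t)) by linarith)
    (show 1 ≤ 2 - 2 * b by linarith)
  calc u t ^ (-(2 - 2 * b)) + 1 / 32
      = u t ^ (-(2 - 2 * b)) * (1 + u t ^ (2 - 2 * b) / 32) := by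
        linear_combination (-1 / 32) * h.U_inv t
    _ ≤ _ := by gcongr; linarith

lemma tendsto_V : Tendsto (fun t => u t ^ (-(2 - 2 * b))) atTop atTop := by
  have h1 : ∀ t : ℕ, (t : ℝ) * (1 / 32) ≤ u t ^ (-(2 - 2 * b)) := by
    intro t
    induction t with
    | zero => simpa using (rpow_pos_of_pos (h.region 0).u_pos _).le
    | succ t ih => have := h.growth t; push_cast; linarith
  exact tendsto_atTop_mono h1 (tendsto_natCast_atTop_atTop.atTop_mul_const (by norm_num))

lemma tendsto_U : Tendsto (fun t => u t ^ (2 - 2 * b)) atTop (𝓝 0) := by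
  refine (tendsto_inv_atTop_zero.comp h.tendsto_V).congr fun t => ?_
  simp only [Function.comp]
  rw [rpow_neg (h.region t).u_pos.le, inv_inv]

lemma tendsto_u : Tendsto u atTop (𝓝 0) := by
  have hb := h.init.b_le
  have h1 := h.tendsto_U.rpow_const (p := (2 - 2 * b)⁻¹) (Or.inr (by
    rw [inv_nonneg]; linarith))
  rw [zero_rpow (inv_ne_zero (by linarith))] at h1
  refine h1.congr fun t => ?_
  rw [← rpow_mul (h.region t).u_pos.le, mul_inv_cancel₀ (by linarith), rpow_one]

lemma tendsto_theta : Tendsto θ atTop (𝓝 0) := by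
  have h1 := h.tendsto_u.const_mul 2
  rw [mul_zero] at h1
  exact squeeze_zero (fun t => (h.region t).theta_pos.le) (fun t => (h.region t).theta_le) h1

lemma tendsto_gapNum_div : Tendsto (fun t => gapNum b (u t) (θ t) / θ t) atTop (𝓝 1) := by
  have h1 : Tendsto (fun t => log (gapNum b (u t) (θ t)) - log (θ t)) atTop (𝓝 0) := by
    have h2 : Tendsto (fun t => u t / 16 + 14 * u t ^ (2 - 2 * b)) atTop (𝓝 0) := by
      simpa using (h.tendsto_u.div_const 16).add (h.tendsto_U.const_mul 14)
    exact squeeze_zero_norm (fun t => (h.region t).abs_log_gapNum_sub_le (h.inv t).2) h2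
  have h3 := (continuous_exp.tendsto 0).comp h1
  rw [exp_zero] at h3
  refine h3.congr fun t => ?_
  simp only [Function.comp]
  rw [exp_sub, exp_log (h.region t).gapNum_pos, exp_log (h.region t).theta_pos]

lemma tendsto_theta_ne : Tendsto θ atTop (𝓝[≠] 0) :=
  tendsto_nhdsWithin_iff.2 ⟨h.tendsto_theta,
    Eventually.of_forall fun t => (h.region t).theta_pos.ne'⟩

lemma tendsto_ratio : Tendsto (fun t => θ t / u t) atTop (𝓝 (1 + b)⁻¹) := by
  have hd : HasDerivAt (fun x : ℝ => (1 + x) ^ b) b 0 := by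
    have := ((hasDerivAt_id (0 : ℝ)).const_add 1).rpow_const (p := b) (Or.inl (by simp))
    simpa using this
  have h1 : Tendsto (fun t => (θ t)⁻¹ * ((1 + θ t) ^ b - 1)) atTop (𝓝 b) := by
    have := (hasDerivAt_iff_tendsto_slope_zero.1 hd).comp h.tendsto_theta_ne
    simpa [Function.comp_def] using this
  have h2 : Tendsto (fun t => u t / θ t) atTop (𝓝 (1 + (1 - 0) * b)) := by
    refine (h.tendsto_gapNum_div.add ((h.tendsto_u.const_sub 1).mul h1)).congr fun t => ?_
    have := (h.region t).theta_pos
    unfold gapNum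
    field_simp
    ring
  have h3 := h2.inv₀ (by have := h.init.b_pos; simp; linarith)
  simpa using h3

lemma tendsto_gapQuot : Tendsto (fun t => gapQuot b (u t) (θ t) / u t) atTop
    (𝓝 (1 + b)⁻¹) := by
  have h1 : Tendsto (fun t => gapDamp b (u t) (θ t)) atTop (𝓝 0) := by
    refine squeeze_zero (fun t => (h.region t).gapDamp_bounds.1.le)
      (fun t => (h.region t).gapDamp_bounds.2) ?_
    simpa using h.tendsto_U.const_mul 4
  have h2 := (h.tendsto_gapNum_div.mul h.tendsto_ratio).div (h1.const_add 1) (by simp)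
  simp only [one_mul, add_zero, div_one] at h2
  refine h2.congr fun t => ?_
  have e1 := (h.region t).theta_pos
  have e2 := (h.region t).u_pos
  have e3 := (h.region t).gapDamp_bounds.1
  simp only [Pi.div_apply, gapQuot]
  field_simp

lemma tendsto_slopeProd : Tendsto (fun t => slopeProd b (u t) (θ t) / u t ^ (2 - 2 * b)) atTop
    (𝓝 ((1 + b)⁻¹ ^ (2 - 2 * b))) := by
  have hb := h.init.b_pos
  have hs : 0 < (1 + b)⁻¹ := by positivity
  have h1 := (h.tendsto_ratio.rpow_const (p := 1 - 2 * b) (Or.inl hs.ne')).mul h.tendsto_gapQuot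
  have e : (1 + b)⁻¹ ^ (1 - 2 * b) * (1 + b)⁻¹ = (1 + b)⁻¹ ^ (2 - 2 * b) := by
    rw [← rpow_add_one hs.ne']; congr 1; ring
  rw [e] at h1
  refine h1.congr fun t => ?_
  have hr := h.region t
  have e1 := hr.theta_pos
  have e2 := hr.u_pos
  have e3 := rpow_pos_of_pos hr.u_pos (1 - 2 * b)
  rw [hr.U_eq, div_rpow e1.le e2.le, slopeProd]
  field_simp

lemma tendsto_nextSlope_sq : Tendsto (fun t => nextSlope b (u t) (θ t) ^ 2 / u t ^ (2 - 2 * b))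
    atTop (𝓝 ((1 + b)⁻¹ ^ (2 - 2 * b))) := by
  have hb := h.init.b_pos
  have hs : 0 < (1 + b)⁻¹ := by positivity
  have h1 := (h.tendsto_ratio.rpow_const (p := -(2 * b)) (Or.inl hs.ne')).mul
    (h.tendsto_gapQuot.pow 2)
  have e : (1 + b)⁻¹ ^ (-(2 * b)) * (1 + b)⁻¹ ^ 2 = (1 + b)⁻¹ ^ (2 - 2 * b) := by
    rw [← rpow_natCast, ← rpow_add hs]; congr 1; push_cast; ring
  rw [e] at h1
  refine h1.congr fun t => ?_
  have hr := h.region t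
  have e1 := hr.theta_pos
  have e2 := hr.u_pos
  have e3 := rpow_pos_of_pos hr.u_pos (-(2 * b))
  rw [hr.U_eq', div_rpow e1.le e2.le, hr.nextSlope_sq]
  field_simp

lemma tendsto_increment : Tendsto (fun t => u (t + 1) ^ (-(2 - 2 * b)) - u t ^ (-(2 - 2 * b)))
    atTop (𝓝 (4 * (1 - b) * (1 + b)⁻¹ ^ (2 - 2 * b))) := by
  set S := (1 + b)⁻¹ ^ (2 - 2 * b)
  have hX2 : Tendsto (fun t => slopeProd b (u t) (θ t)) atTop (𝓝 0) := by
    refine squeeze_zero (fun t => (h.region t).slopeProd_bounds.1.le)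
      (fun t => (h.region t).slopeProd_bounds.2) ?_
    simpa using h.tendsto_U.const_mul 2
  obtain ⟨ρ, hρ⟩ : ∃ ρ : ℕ → ℝ, ∀ t, ρ t =
      (1 + nextSlope b (u t) (θ t) ^ 2) / (1 - slopeProd b (u t) (θ t)) := ⟨_, fun _ => rfl⟩
  have hden : ∀ t, 0 < 1 - slopeProd b (u t) (θ t) := fun t => by
    have h1 := (h.region t).slopeProd_bounds
    have h2 := (h.region t).U_tiny
    norm_num at h2
    linarith
  have hρ1 : Tendsto (fun t => (ρ t - 1) / u t ^ (2 - 2 * b)) atTop (𝓝 (S + S)) := by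
    have h1 := (h.tendsto_nextSlope_sq.add h.tendsto_slopeProd).div (hX2.const_sub 1) (by simp)
    simp only [sub_zero, div_one] at h1
    refine h1.congr fun t => ?_
    have e1 := hden t
    have e2 := (h.region t).U_pos
    simp only [Pi.div_apply]
    rw [hρ]
    field_simp
    ring
  have hρne : ∀ t, ρ t - 1 ≠ 0 := fun t => by
    have e1 := hden t
    have e2 := (h.region t).slopeProd_bounds.1
    have : 1 < ρ t := by
      rw [hρ, lt_div_iff₀ e1]; nlinarith [sq_nonneg (nextSlope b (u t) (θ t))]
    linarith
  have hρ0 : Tendsto (fun t => ρ t - 1) atTop (𝓝[≠] 0) := by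
    refine tendsto_nhdsWithin_iff.2 ⟨?_, Eventually.of_forall hρne⟩
    have h1 := hρ1.mul h.tendsto_U
    rw [mul_zero] at h1
    exact h1.congr fun t => div_mul_cancel₀ _ (h.region t).U_pos.ne'
  have hd : HasDerivAt (fun x : ℝ => (1 + x) ^ (2 - 2 * b)) (2 - 2 * b) 0 := by
    have := ((hasDerivAt_id (0 : ℝ)).const_add 1).rpow_const (p := 2 - 2 * b) (Or.inl (by simp))
    simpa using this
  have h1 : Tendsto (fun t => (ρ t - 1)⁻¹ * (ρ t ^ (2 - 2 * b) - 1)) atTop (𝓝 (2 - 2 * b)) := by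
    have := (hasDerivAt_iff_tendsto_slope_zero.1 hd).comp hρ0
    simpa [Function.comp_def] using this
  have h2 := h1.mul hρ1
  have e : (2 - 2 * b) * (S + S) = 4 * (1 - b) * S := by ring
  rw [e] at h2
  refine h2.congr fun t => ?_
  have e1 := hρne t
  have e2 := (h.region t).U_pos
  rw [h.ratio_eq, ← hρ, rpow_neg (h.region t).u_pos.le]
  field_simp

lemma tendsto_V_div : Tendsto (fun T : ℕ => u T ^ (-(2 - 2 * b)) / T)
    atTop (𝓝 (4 * (1 - b) * (1 + b)⁻¹ ^ (2 - 2 * b))) := by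
  have h1 := h.tendsto_increment.cesaro
  have h2 : Tendsto (fun T : ℕ => u 0 ^ (-(2 - 2 * b)) / (T : ℝ)) atTop (𝓝 0) :=
    tendsto_const_div_atTop_nhds_zero_nat _
  have h3 := h1.add h2
  rw [add_zero] at h3
  refine h3.congr fun T => ?_
  rw [Finset.sum_range_sub (fun t => u t ^ (-(2 - 2 * b)))]
  ring

lemma tendsto_sq_div : Tendsto (fun T : ℕ => u T ^ 2 / (T : ℝ) ^ (-(1 / (1 - b))))
    atTop (𝓝 ((1 + b) ^ 2 * (1 / (4 * (1 - b))) ^ (1 / (1 - b)))) := by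
  have hb := h.init.b_pos
  have hb1 := h.init.b_le
  have hs : 0 < (1 + b)⁻¹ := by positivity
  have hα : 0 < 1 - b := by linarith
  have hK : 0 < 4 * (1 - b) * (1 + b)⁻¹ ^ (2 - 2 * b) := by
    have := rpow_pos_of_pos hs (2 - 2 * b); positivity
  have h1 := h.tendsto_V_div.rpow_const (p := -(1 / (1 - b))) (Or.inl hK.ne')
  have e : (4 * (1 - b) * (1 + b)⁻¹ ^ (2 - 2 * b)) ^ (-(1 / (1 - b))) =
      (1 + b) ^ 2 * (1 / (4 * (1 - b))) ^ (1 / (1 - b)) := by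
    rw [mul_rpow (by positivity) (rpow_nonneg hs.le _), ← rpow_mul hs.le,
      show (2 - 2 * b) * -(1 / (1 - b)) = -(2 : ℕ) by push_cast; field_simp,
      rpow_neg hs.le, rpow_natCast, rpow_neg (by positivity), ← inv_rpow (by positivity),
      one_div (4 * (1 - b))]
    field_simp
  rw [e] at h1
  refine h1.congr fun T => ?_
  have hu := (h.region T).u_pos
  rw [div_rpow (rpow_nonneg hu.le _) (Nat.cast_nonneg T), ← rpow_mul hu.le,
    show -(2 - 2 * b) * -(1 / (1 - b)) = (2 : ℕ) by push_cast; field_simp, rpow_natCast]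

end IsOrbit

lemma tangent_lt_abs_rpow {p a x : ℝ} (hp : 1 < p) (ha : 0 < a) (hx : x ≠ a) :
    a ^ p + p * a ^ (p - 1) * (x - a) < |x| ^ p := by
  have hap : 0 < a ^ (p - 1) := rpow_pos_of_pos ha _
  have e : a ^ p = a ^ (p - 1) * a := by rw [← rpow_add_one ha.ne']; congr 1; ring
  rcases lt_or_ge x 0 with h | h
  · have h1 : 0 ≤ |x| ^ p := rpow_nonneg (abs_nonneg x) p
    have h2 : 0 < a ^ (p - 1) * ((p - 1) * a) := mul_pos hap (mul_pos (by linarith) ha)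
    have h3 : 0 < a ^ (p - 1) * (p * -x) := mul_pos hap (mul_pos (by linarith) (by linarith))
    rw [e]
    linarith
  · have hs : x / a - 1 ≠ 0 := by
      rw [sub_ne_zero, Ne, div_eq_one_iff_eq ha.ne']; exact hx
    have h0 : 0 ≤ x / a := by positivity
    have h1 := one_add_mul_self_lt_rpow_one_add (by linarith) hs hp
    rw [add_sub_cancel, div_rpow h ha.le, lt_div_iff₀ (by positivity)] at h1
    rw [abs_of_nonneg h]
    calc a ^ p + p * a ^ (p - 1) * (x - a) = (1 + p * (x / a - 1)) * a ^ p := by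
          rw [e]; field_simp
      _ < x ^ p := h1

lemma lmo_unique {p u w κ V₁ V₂ z₁ z₂ : ℝ} (hp : 1 < p) (hκ : 0 < κ)
    (h1 : 0 < V₁) (h2 : 0 < V₂) (hV : V₁ ^ p + V₂ ^ p = 1) (hV1 : V₁ ^ (p - 1) = κ * u)
    (hV2 : V₂ ^ (p - 1) = κ * w) (hz : |z₁| ^ p + |z₂| ^ p ≤ 1)
    (hmax : u * V₁ + w * V₂ ≤ u * z₁ + w * z₂) : z₁ = V₁ ∧ z₂ = V₂ := by
  have hge : ∀ {a x : ℝ}, 0 < a → a ^ p + p * a ^ (p - 1) * (x - a) ≤ |x| ^ p := by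
    intro a x ha
    rcases eq_or_ne x a with rfl | hx
    · simp [abs_of_pos ha]
    · exact (tangent_lt_abs_rpow hp ha hx).le
  have hs : 0 ≤ p * V₁ ^ (p - 1) * (z₁ - V₁) + p * V₂ ^ (p - 1) * (z₂ - V₂) := by
    rw [hV1, hV2]
    have : 0 ≤ p * κ * ((u * z₁ + w * z₂) - (u * V₁ + w * V₂)) :=
      mul_nonneg (by positivity) (by linarith)
    linarith
  constructor
  · by_contra hne
    have := tangent_lt_abs_rpow hp h1 hne
    have := hge (x := z₂) h2
    linarith
  · by_contra hne
    have := tangent_lt_abs_rpow hp h2 hne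
    have := hge (x := z₁) h1
    linarith

lemma seg_eq_of_lineSearch {u W V₁ V₂ ε g : ℝ} (hε : ε * ε = 1) (hu : 0 < u) (hW : 0 < W)
    (hV2 : 0 < V₂) (hd1 : 0 < V₁ - 1 + u) (hle : V₁ - 1 + u ≤ V₂ + W) (hV : 1 - V₁ ≤ V₂)
    (hmin : ∀ s ∈ Set.Icc (0 : ℝ) 1, fobj (seg (1 - u, ε * W) (V₁, -ε * V₂) g) ≤
      fobj (seg (1 - u, ε * W) (V₁, -ε * V₂) s)) :
    seg (1 - u, ε * W) (V₁, -ε * V₂) g =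
      (1 - (u - W * ((V₁ - 1 + u) / (V₂ + W))) / (1 + ((V₁ - 1 + u) / (V₂ + W)) ^ 2),
        -ε * ((V₁ - 1 + u) / (V₂ + W) * ((u - W * ((V₁ - 1 + u) / (V₂ + W))) /
          (1 + ((V₁ - 1 + u) / (V₂ + W)) ^ 2)))) := by
  obtain ⟨d, hd⟩ : ∃ d, d = V₁ - 1 + u := ⟨_, rfl⟩
  obtain ⟨δ, hδ⟩ : ∃ δ, δ = V₂ + W := ⟨_, rfl⟩
  rw [← hd, ← hδ]
  rw [← hd] at hd1 hle
  rw [← hδ] at hle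
  have hδ0 : 0 < δ := by linarith
  have hf : ∀ s, fobj (seg (1 - u, ε * W) (V₁, -ε * V₂) s) = (u - s * d) ^ 2 + (W - s * δ) ^ 2 := by
    intro s
    simp only [fobj, seg, hd, hδ]
    linear_combination (W - s * (V₂ + W)) ^ 2 * hε
  have hD : 0 < d ^ 2 + δ ^ 2 := by positivity
  obtain ⟨γ, hγ⟩ : ∃ γ, γ = (u * d + W * δ) / (d ^ 2 + δ ^ 2) := ⟨_, rfl⟩
  have hγD : γ * (d ^ 2 + δ ^ 2) = u * d + W * δ := by rw [hγ]; field_simp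
  have hγ0 : 0 ≤ γ := by rw [hγ]; positivity
  have hγ1 : γ ≤ 1 := by
    rw [hγ, div_le_one hD]
    have : (1 - V₁) * d ≤ V₂ * δ := mul_le_mul hV hle hd1.le hV2.le
    have e1 : u = d + 1 - V₁ := by rw [hd]; ring
    have e2 : W = δ - V₂ := by rw [hδ]; ring
    rw [e1, e2]
    linarith
  have h1 := hmin γ ⟨hγ0, hγ1⟩
  rw [hf, hf] at h1
  have h2 : (d ^ 2 + δ ^ 2) * (g - γ) ^ 2 ≤ 0 := by
    have : (u - g * d) ^ 2 + (W - g * δ) ^ 2 - ((u - γ * d) ^ 2 + (W - γ * δ) ^ 2) =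
      (d ^ 2 + δ ^ 2) * (g - γ) ^ 2 := by linear_combination (2 * g - 2 * γ) * hγD
    linarith
  have h3 : g = γ := by
    have : (g - γ) ^ 2 ≤ 0 := by
      by_contra! hc
      have := mul_pos hD hc
      linarith
    have := pow_eq_zero_iff (two_ne_zero) |>.1 (le_antisymm this (sq_nonneg _))
    linarith
  have e1 : V₁ = d + 1 - u := by rw [hd]; ring
  have e2 : V₂ = δ - W := by rw [hδ]; ring
  have hD' : δ ^ 2 + d ^ 2 ≠ 0 := by positivity
  rw [h3, hγ, e1, e2]
  simp only [seg, Prod.mk.injEq]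
  constructor
  · field_simp
    ring
  · field_simp
    ring

/-- One Frank–Wolfe step in the coordinates `(u, θ)`. -/
lemma fw_step {p b u θ ε g : ℝ} {v : ℝ × ℝ} (hbp : b * p = 1) (hp : 3 ≤ p)
    (h : InRegion b u θ)
    (hε : ε * ε = 1) (hv : inBp p v)
    (hvmin : ∀ z : ℝ × ℝ, inBp p z →
      2 * ((1 - u) - 1) * v.1 + 2 * (ε * (θ ^ (1 - b) * u)) * v.2
        ≤ 2 * ((1 - u) - 1) * z.1 + 2 * (ε * (θ ^ (1 - b) * u)) * z.2)
    (hmin : ∀ s ∈ Set.Icc (0 : ℝ) 1,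
      fobj (seg (1 - u, ε * (θ ^ (1 - b) * u)) v g) ≤
        fobj (seg (1 - u, ε * (θ ^ (1 - b) * u)) v s)) :
    seg (1 - u, ε * (θ ^ (1 - b) * u)) v g =
      (1 - nextU b u θ,
        -ε * (nextTheta b u θ ^ (1 - b) * nextU b u θ)) := by
  have hp0 : 0 < p := by linarith
  have hb0 := h.b_pos
  have hb1 := h.b_le
  have hu := h.u_pos
  have hul := h.u_le
  norm_num at hul
  have hθ := h.theta_pos
  have hθu := h.theta_le
  have hm := rpow_pos_of_pos (show 0 < 1 + θ by linarith) b
  have hm1 : 1 ≤ (1 + θ) ^ b := one_le_rpow (by linarith) hb0.le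
  have hm2 := rpow_one_add_le_one_add_mul_self (s := θ) (by linarith) hb0.le (by linarith)
  have ha := rpow_pos_of_pos hθ b
  have hr := rpow_pos_of_pos hθ (1 - b)
  have hW : 0 < θ ^ (1 - b) * u := by positivity
  obtain ⟨V₁, hV₁⟩ : ∃ V₁, V₁ = ((1 + θ) ^ b)⁻¹ := ⟨_, rfl⟩
  obtain ⟨V₂, hV₂⟩ : ∃ V₂, V₂ = θ ^ b * ((1 + θ) ^ b)⁻¹ := ⟨_, rfl⟩
  have hV₁0 : 0 < V₁ := by rw [hV₁]; positivity
  have hV₂0 : 0 < V₂ := by rw [hV₂]; positivity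
  have e1 : (1 + θ) ^ b * V₁ = 1 := by rw [hV₁]; field_simp
  have e2 : V₂ = θ ^ b * V₁ := by rw [hV₁, hV₂]
  have hV₁p : V₁ ^ p = (1 + θ)⁻¹ := by
    rw [hV₁, inv_rpow hm.le, ← rpow_mul (by linarith), hbp, rpow_one]
  have hnorm : V₁ ^ p + V₂ ^ p = 1 := by
    rw [e2, mul_rpow ha.le hV₁0.le, hV₁p, ← rpow_mul hθ.le, hbp, rpow_one]
    field_simp
  have hκ := rpow_pos_of_pos hV₁0 (p - 1)
  have hmem : inBp p (V₁, -ε * V₂) := by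
    have : |(-ε * V₂)| = V₂ := by
      rw [abs_mul, abs_neg, abs_of_pos hV₂0, (mul_self_eq_one_iff.1 hε).elim
        (fun h => by simp [h]) (fun h => by simp [h] : ε = -1 → |ε| = 1), one_mul]
    simp only [inBp]
    rw [this, abs_of_pos hV₁0, hnorm]
  have hopt := hvmin _ hmem
  have hVeq : v.1 = V₁ ∧ -ε * v.2 = V₂ := by
    refine lmo_unique (p := p) (u := u) (w := θ ^ (1 - b) * u) (κ := V₁ ^ (p - 1) / u)
      (by linarith) (by positivity) hV₁0 hV₂0 hnorm (by field_simp) ?_ ?_ ?_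
    · rw [e2, mul_rpow ha.le hV₁0.le, ← rpow_mul hθ.le,
        show b * (p - 1) = 1 - b by linear_combination hbp]
      field_simp
    · have : |(-ε * v.2)| = |v.2| := by
        rw [abs_mul, abs_neg, (mul_self_eq_one_iff.1 hε).elim
          (fun h => by simp [h]) (fun h => by simp [h] : ε = -1 → |ε| = 1), one_mul]
      rw [this]
      exact hv
    · simp only at hopt
      linear_combination hopt / 2 - (θ ^ (1 - b) * u * V₂) * hε
  have hv_eq : v = (V₁, -ε * V₂) := by
    refine Prod.ext hVeq.1 ?_
    simp only
    rw [← hVeq.2]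
    linear_combination -v.2 * hε
  have hd : V₁ - 1 + u = gapNum b u θ * V₁ := by
    unfold gapNum; linear_combination (1 - u) * e1
  have hsplit : θ ^ (1 - b) = θ ^ b * θ ^ (1 - 2 * b) := by
    rw [← rpow_add hθ]; congr 1; ring
  have hsplit' : θ ^ (1 - 2 * b) = θ ^ (1 - b) * θ ^ (-b) := by
    rw [← rpow_add hθ]; congr 1; ring
  have hδ : V₂ + θ ^ (1 - b) * u = θ ^ b * (1 + gapDamp b u θ) * V₁ := by
    rw [e2, hsplit]
    unfold gapDamp
    linear_combination (-(θ ^ b * θ ^ (1 - 2 * b) * u)) * e1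
  have hdamp := h.gapDamp_bounds.1
  have hratio : (V₁ - 1 + u) / (V₂ + θ ^ (1 - b) * u) = nextSlope b u θ := by
    rw [hd, hδ, nextSlope, gapQuot, rpow_neg hθ.le]
    field_simp
  have hprod : slopeProd b u θ = θ ^ (1 - b) * nextSlope b u θ := by
    rw [slopeProd, nextSlope, hsplit']; ring
  have hδ0 : 0 < V₂ + θ ^ (1 - b) * u := by positivity
  have hslope1 : nextSlope b u θ ≤ 1 := by
    have h1 := h.nextSlope_sq_bounds.2
    have h2 := h.damp_small
    have : nextSlope b u θ ^ 2 ≤ 1 := by norm_num at h2; linarith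
    exact (sq_le_one_iff₀ h.nextSlope_pos.le).1 this
  have hthb : θ ≤ θ ^ b := le_rpow_of_le_one hθ (by linarith) (by linarith)
  have hVle : 1 - V₁ ≤ V₂ := by
    have h1 : (1 - V₁) = ((1 + θ) ^ b - 1) * V₁ := by linear_combination -e1
    rw [h1, e2]
    have : b * θ ≤ θ := mul_le_of_le_one_left hθ.le (by linarith)
    gcongr
    linarith
  rw [hv_eq] at hmin ⊢
  have hseg := seg_eq_of_lineSearch hε hu hW hV₂0
    (by rw [hd]; exact mul_pos h.gapNum_pos hV₁0)
    (by rw [← div_le_one hδ0, hratio]; exact hslope1) hVle hmin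
  rw [hseg, hratio]
  have hU : (u - θ ^ (1 - b) * u * nextSlope b u θ) / (1 + nextSlope b u θ ^ 2) =
      nextU b u θ := by
    rw [nextU, hprod]; ring
  have hT : nextTheta b u θ ^ (1 - b) = nextSlope b u θ := by
    rw [nextTheta, ← rpow_mul h.nextSlope_pos.le, one_div, inv_mul_cancel₀ (by linarith), rpow_one]
  rw [hU, hT]

lemma tendsto_one_add_rpow_taylor (b : ℝ) :
    Tendsto (fun x : ℝ => ((1 + x) ^ b - 1 - b * x) / x ^ 2) (𝓝[>] 0) (𝓝 (b * (b - 1) / 2)) := by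
  have hd : ∀ c x : ℝ, 0 < 1 + x → HasDerivAt (fun y : ℝ => (1 + y) ^ c) (c * (1 + x) ^ (c - 1)) x := by
    intro c x hx
    have := ((hasDerivAt_id x).const_add 1).rpow_const (p := c) (Or.inl hx.ne')
    simpa using this
  have hpos : ∀ᶠ x : ℝ in 𝓝[>] 0, 0 < x := self_mem_nhdsWithin
  refine HasDerivAt.lhopital_zero_nhdsGT (f' := fun x => b * (1 + x) ^ (b - 1) - b)
    (g' := fun x => 2 * x) ?_ ?_ ?_ ?_ ?_ ?_
  · filter_upwards [hpos] with x hx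
    have := ((hd b x (by linarith)).sub_const 1).sub ((hasDerivAt_id x).const_mul b)
    exact this.congr_deriv (by rw [mul_one])
  · filter_upwards [hpos] with x hx
    simpa using hasDerivAt_pow 2 x
  · filter_upwards [hpos] with x hx
    positivity
  · have h1 := ((hd b 0 (by simp)).continuousAt.tendsto.sub_const 1).sub
      ((continuous_const_mul b).tendsto 0)
    simp only [add_zero, one_rpow, sub_self, mul_zero] at h1
    exact h1.mono_left nhdsWithin_le_nhds
  · have h1 := (continuous_pow (M := ℝ) 2).tendsto 0
    simp only [ne_eq, OfNat.ofNat_ne_zero, not_false_eq_true, zero_pow] at h1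
    exact h1.mono_left nhdsWithin_le_nhds
  · have h1 := (hasDerivAt_iff_tendsto_slope_zero.1 (hd (b - 1) 0 (by simp))).mono_left
      (nhdsWithin_mono 0 (fun x (hx : (0 : ℝ) < x) => hx.ne'))
    have h2 := h1.const_mul (b / 2)
    simp only [add_zero, one_rpow, zero_add, smul_eq_mul, mul_one] at h2
    rw [show b * (b - 1) / 2 = b / 2 * (b - 1) by ring]
    refine h2.congr' ?_
    filter_upwards [hpos] with x hx
    field_simp

lemma tendsto_gapNum_sub_div_sq {b : ℝ} {s : ℝ → ℝ} (hb : 0 < b) (hs0 : s 0 = (1 + b)⁻¹)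
    (hs : HasDerivAt s (b * (3 + b) / (2 * (1 + b) ^ 3)) 0) :
    Tendsto (fun u => (gapNum b u (u * s u) - u * s u) / u ^ 2) (𝓝[>] 0) (𝓝 0) := by
  have hpos : ∀ᶠ x : ℝ in 𝓝[>] 0, 0 < x := self_mem_nhdsWithin
  have hsc : Tendsto s (𝓝[>] 0) (𝓝 (1 + b)⁻¹) := by
    have := hs.continuousAt.tendsto
    rw [hs0] at this
    exact this.mono_left nhdsWithin_le_nhds
  have hu : Tendsto (fun u : ℝ => u) (𝓝[>] 0) (𝓝 0) := nhdsWithin_le_nhds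
  have hspos : ∀ᶠ u in 𝓝[>] 0, 0 < s u := hsc.eventually_const_lt (by positivity)
  have hθ : Tendsto (fun u => u * s u) (𝓝[>] 0) (𝓝[>] 0) := by
    refine tendsto_nhdsWithin_iff.2 ⟨by simpa using hu.mul hsc, ?_⟩
    filter_upwards [hpos, hspos] with u h1 h2
    exact mul_pos h1 h2
  have hk := (tendsto_one_add_rpow_taylor b).comp hθ
  have hsl := (hasDerivAt_iff_tendsto_slope_zero.1 hs).mono_left
    (nhdsWithin_mono 0 (fun x (hx : (0 : ℝ) < x) => hx.ne'))
  have hlim := (((hsl.const_mul (-(1 + b))).add (hsc.const_mul b)).sub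
    ((hsc.pow 2).mul hk)).add (hu.mul ((hsc.pow 2).mul hk))
  have e0 : -(1 + b) * (b * (3 + b) / (2 * (1 + b) ^ 3)) + b * (1 + b)⁻¹ -
      (1 + b)⁻¹ ^ 2 * (b * (b - 1) / 2) + 0 * ((1 + b)⁻¹ ^ 2 * (b * (b - 1) / 2)) = 0 := by
    field_simp
    ring
  rw [e0] at hlim
  refine hlim.congr' ?_
  filter_upwards [hpos, hspos] with u h1 h2
  simp only [zero_add, smul_eq_mul, hs0, Function.comp, gapNum]
  field_simp
  ring

/-- Initial points with the right second-order expansion lie in the trapping region. -/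
lemma exists_init {b : ℝ} {s : ℝ → ℝ} (hb : 0 < b) (hb3 : b ≤ 1 / 3) (hs0 : s 0 = (1 + b)⁻¹)
    (hs : HasDerivAt s (b * (3 + b) / (2 * (1 + b) ^ 3)) 0) :
    ∃ u₁ > (0 : ℝ), ∀ u ∈ Set.Ioc (0 : ℝ) u₁,
      InRegion b u (u * s u) ∧ |logDrift b u (u * s u)| ≤ u / 16 := by
  have hpos : ∀ᶠ x : ℝ in 𝓝[>] 0, 0 < x := self_mem_nhdsWithin
  have hsc : Tendsto s (𝓝[>] 0) (𝓝 (1 + b)⁻¹) := by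
    have := hs.continuousAt.tendsto
    rw [hs0] at this
    exact this.mono_left nhdsWithin_le_nhds
  have hlo : (1 / 4 : ℝ) < (1 + b)⁻¹ := by
    rw [lt_inv_comm₀ (by norm_num) (by positivity)]; linarith
  have hhi : (1 + b)⁻¹ < 2 := by
    rw [inv_lt_comm₀ (by positivity) (by norm_num)]; linarith
  have hgap := (tendsto_gapNum_sub_div_sq hb hs0 hs).abs
  rw [abs_zero] at hgap
  have hev : ∀ᶠ u in 𝓝[>] (0 : ℝ),
      InRegion b u (u * s u) ∧ |logDrift b u (u * s u)| ≤ u / 16 := by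
    filter_upwards [hpos, hsc.eventually_const_lt hlo, hsc.eventually_lt_const hhi,
      (nhdsWithin_le_nhds : 𝓝[>] (0 : ℝ) ≤ 𝓝 0) (Iio_mem_nhds (show (0 : ℝ) < 1 / 10 ^ 18 by positivity)),
      hgap.eventually_lt_const (show (0 : ℝ) < 1 / 1000 by norm_num)] with u h1 h2 h3 h4 h5
    have hr : InRegion b u (u * s u) :=
      ⟨hb, hb3, h1, le_of_lt h4, by nlinarith, by nlinarith⟩
    refine ⟨hr, ?_⟩
    rw [abs_div, abs_of_pos (show (0 : ℝ) < u ^ 2 by positivity), div_lt_iff₀ (by positivity)] at h5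
    have hl := abs_log_sub_log_le (show 0 < u / 4 by linarith)
      (show u / 4 ≤ gapNum b u (u * s u) by linarith [hr.gapNum_bounds.1]) hr.le_theta
    have h6 : |gapNum b u (u * s u) - u * s u| / (u / 4) ≤ u / 250 := by
      rw [div_le_iff₀ (by positivity)]
      linarith
    have hq := hr.q_bounds
    have hde := hr.abs_driftErr_le
    have hU := hr.U_le
    norm_num at hU
    unfold logDrift
    have h7 : |1 / (1 - b) * (log (gapNum b u (u * s u)) - log (u * s u))| ≤ 3 / 2 * (u / 250) := by
      rw [abs_mul, abs_of_pos (show 0 < 1 / (1 - b) by linarith)]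
      exact mul_le_mul hq.2 (hl.trans h6) (abs_nonneg _) (by norm_num)
    have h8 := abs_sub (1 / (1 - b) * (log (gapNum b u (u * s u)) - log (u * s u)))
      (driftErr b u (u * s u))
    linarith
  obtain ⟨u₁, hu₁, hsub⟩ := mem_nhdsGT_iff_exists_Ioc_subset.1 hev
  exact ⟨u₁, hu₁, fun u hu => hsub hu⟩

/-- The slow-start initialization in the coordinates `(u, θ)`. -/
lemma exists_init_xslow {p b : ℝ} (hp : 3 ≤ p) (hbp : b * p = 1) :
    ∃ u₁ > (0 : ℝ), ∀ u ∈ Set.Ioc (0 : ℝ) u₁, ∃ θ : ℝ,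
      InRegion b u θ ∧ |logDrift b u θ| ≤ u / 16 ∧ xslow p u = (1 - u, θ ^ (1 - b) * u) := by
  have hp0 : 0 < p := by linarith
  have hb : 0 < b := by
    by_contra! h
    nlinarith
  have hb3 : b ≤ 1 / 3 := by nlinarith
  have hC : 0 < Cp p := rpow_pos_of_pos (by positivity) _
  have hD : 0 < Dp p := by
    unfold Dp
    have : 0 < p - 1 := by linarith
    positivity
  have hqc : 1 / qc p = 1 - b := by
    have : p - 1 ≠ 0 := by linarith
    unfold qc
    field_simp
    linear_combination hbp
  have halpha : alphac p = 1 - b := by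
    unfold alphac
    field_simp
    linear_combination hbp
  have hb1 : 1 - b ≠ 0 := by linarith
  have hpb : p / (p + 1) = (1 + b)⁻¹ := by
    field_simp
    linear_combination hbp
  have hCs : Cp p ^ (1 / (1 - b)) = (1 + b)⁻¹ := by
    rw [Cp, hqc, hpb, ← rpow_mul (by positivity), mul_one_div_cancel hb1, rpow_one]
  have hDs : Dp p = Cp p * ((1 - b) * (b * (3 + b) / (2 * (1 + b) ^ 2))) := by
    have : p = b⁻¹ := by field_simp; linear_combination hbp
    rw [Dp, mul_div_assoc]
    congr 1
    rw [this]
    field_simp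
  obtain ⟨u₁, hu₁, h⟩ := exists_init (b := b) (s := fun u => (Cp p + Dp p * u) ^ (1 / (1 - b)))
    hb hb3 (by simp only [mul_zero, add_zero, hCs]) (by
      have h1 := (((hasDerivAt_id (0 : ℝ)).const_mul (Dp p)).const_add (Cp p)).rpow_const
        (p := 1 / (1 - b)) (Or.inl (by simpa using hC.ne'))
      refine h1.congr_deriv ?_
      simp only [id_eq, mul_zero, add_zero, mul_one]
      rw [rpow_sub_one hC.ne', hCs, hDs]
      field_simp)
  refine ⟨u₁, hu₁, fun u hu => ⟨_, (h u hu).1, (h u hu).2, ?_⟩⟩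
  have hu0 : 0 < u := hu.1
  have hCD : 0 < Cp p + Dp p * u := by positivity
  simp only [xslow, halpha]
  rw [mul_rpow hu0.le (by positivity), ← rpow_mul hCD.le, one_div_mul_cancel hb1, rpow_one,
    add_comm 1 (1 - b), rpow_add_one hu0.ne']
  congr 1
  ring

/-- A slow-start Frank–Wolfe trajectory is an orbit in the coordinates `(u, θ)`. -/
lemma exists_isOrbit {p b u₀ θ₀ : ℝ} {x v : ℕ → ℝ × ℝ} {γ : ℕ → ℝ} (hp : 3 ≤ p)
    (hbp : b * p = 1) (hr : InRegion b u₀ θ₀) (hd : |logDrift b u₀ θ₀| ≤ u₀ / 16)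
    (hx : x 0 = (1 - u₀, θ₀ ^ (1 - b) * u₀)) (h : IsFWTraj p x v γ) :
    ∃ u θ : ℕ → ℝ, IsOrbit b u θ ∧ ∀ t, x t = (1 - u t, (-1) ^ t * (θ t ^ (1 - b) * u t)) := by
  let z : ℕ → ℝ × ℝ := fun t =>
    Nat.rec (u₀, θ₀) (fun _ y => (nextU b y.1 y.2, nextTheta b y.1 y.2)) t
  have horb : IsOrbit b (fun t => (z t).1) (fun t => (z t).2) :=
    ⟨hr, hd, fun _ => rfl, fun _ => rfl⟩
  refine ⟨_, _, horb, fun t => ?_⟩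
  induction t with
  | zero => rw [pow_zero, one_mul]; exact hx
  | succ t ih =>
    obtain ⟨hlmo, hls, hstep⟩ := h
    have h1 := (hlmo t).2
    have h2 := (hls t).2
    rw [ih] at h1 h2
    rw [hstep, ih, fw_step hbp hp (horb.region t) (by rw [← mul_pow]; simp) (hlmo t).1 h1 h2,
      horb.next_u, horb.next_theta, pow_succ, mul_neg_one]

lemma fobj_orbit (t : ℕ) (u W : ℝ) : fobj (1 - u, (-1) ^ t * (W * u)) = u ^ 2 * (1 + W ^ 2) := by
  have : ((-1 : ℝ) ^ t) ^ 2 = 1 := by rw [← pow_mul, mul_comm, pow_mul]; simp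
  simp only [fobj]
  linear_combination (W * u) ^ 2 * this

/-- Positive values with a positive limiting ratio dominate a multiple of the gauge. -/
lemma exists_mul_le_of_tendsto {a r : ℕ → ℝ} (ha : ∀ t, 0 < a t)
    (hr : ∀ t, 0 < t → 0 < r t) {l : ℝ} (hl : 0 < l)
    (h : Tendsto (fun t => a t / r t) atTop (𝓝 l)) : ∃ c > 0, ∀ t, c * r t ≤ a t := by
  have h1 := h.inv₀ hl.ne'
  obtain ⟨M, hM⟩ := h1.bddAbove_range
  have hM' : ∀ t, r t ≤ M * a t := by
    intro t
    have := hM (Set.mem_range_self t)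
    simp only [inv_div] at this
    rwa [div_le_iff₀ (ha t)] at this
  have hMpos : 0 < M := by
    have h2 := hM' 1
    have h3 := hr 1 one_pos
    by_contra! hc
    have := mul_nonpos_of_nonpos_of_nonneg hc (ha 1).le
    linarith
  refine ⟨M⁻¹, inv_pos.2 hMpos, fun t => ?_⟩
  rw [inv_mul_le_iff₀ hMpos]
  exact hM' t

end

theorem fw_lower_bound (p : ℝ) (hp : 3 ≤ p) :
    ∃ u₁ > (0:ℝ), ∀ u₀ ∈ Set.Ioc (0:ℝ) u₁, ∀ x v : ℕ → ℝ × ℝ, ∀ γ : ℕ → ℝ,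
      x 0 = xslow p u₀ → IsFWTraj p x v γ →
      -- f(x_T) - f(x*) ~ ((p+1)/p)²·(p/(4(p-1)))^{p/(p-1)}·T^{-p/(p-1)}
      Filter.Tendsto
        (fun T : ℕ => fobj (x T) /
          (((p + 1) / p) ^ 2 * (p / (4 * (p - 1))) ^ (p / (p - 1))
            * (T : ℝ) ^ (-(p / (p - 1)))))
        Filter.atTop (nhds 1) ∧
      -- in particular f(x_T) - f(x*) = Ω(T^{-p/(p-1)})
      ∃ c > (0:ℝ), ∀ T : ℕ, c * (T : ℝ) ^ (-(p / (p - 1))) ≤ fobj (x T) := by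
  have hp0 : 0 < p := by linarith
  have hp1 : 0 < p - 1 := by linarith
  obtain ⟨b, hb⟩ : ∃ b, b = 1 / p := ⟨_, rfl⟩
  have hbp : b * p = 1 := by rw [hb]; field_simp
  have hq : p / (p - 1) = 1 / (1 - b) := by rw [hb]; field_simp
  have hA : (p + 1) / p = 1 + b := by rw [hb]; field_simp
  have hB : p / (4 * (p - 1)) = 1 / (4 * (1 - b)) := by rw [hb]; field_simp
  rw [hq, hA, hB]
  obtain ⟨u₁, hu₁, hinit⟩ := exists_init_xslow hp hbp
  refine ⟨u₁, hu₁, fun u₀ hu₀ x v γ hx h => ?_⟩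
  obtain ⟨θ₀, hr, hd, hx0⟩ := hinit u₀ hu₀
  obtain ⟨u, θ, horb, hxt⟩ := exists_isOrbit hp hbp hr hd (hx.trans hx0) h
  have hb1 : b ≤ 1 / 3 := hr.b_le
  have hb0 := hr.b_pos
  have hf : ∀ t, fobj (x t) = u t ^ 2 * (1 + (θ t ^ (1 - b)) ^ 2) := fun t => by
    rw [hxt, fobj_orbit]
  have hpos : ∀ t, 0 < fobj (x t) := fun t => by
    have := (horb.region t).u_pos
    rw [hf]
    positivity
  obtain ⟨K, hK⟩ : ∃ K, K = (1 + b) ^ 2 * (1 / (4 * (1 - b))) ^ (1 / (1 - b)) := ⟨_, rfl⟩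
  have hK0 : 0 < K := by
    rw [hK]
    have : 0 < 1 - b := by linarith
    positivity
  have hθ := horb.tendsto_theta.rpow_const (p := 1 - b) (Or.inr (by linarith))
  rw [zero_rpow (by linarith)] at hθ
  have hlim := horb.tendsto_sq_div.mul ((hθ.pow 2).const_add 1)
  rw [← hK, zero_pow two_ne_zero, add_zero, mul_one] at hlim
  rw [← hK]
  have hlim' : Filter.Tendsto (fun T : ℕ => fobj (x T) / (T : ℝ) ^ (-(1 / (1 - b))))
      Filter.atTop (nhds K) := by
    refine hlim.congr fun t => ?_
    rw [hf]
    ring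
  refine ⟨?_, exists_mul_le_of_tendsto hpos ?_ hK0 hlim'⟩
  · have h1 := hlim'.const_mul K⁻¹
    rw [inv_mul_cancel₀ hK0.ne'] at h1
    refine h1.congr fun t => ?_
    rw [div_mul_eq_div_div_swap, inv_mul_eq_div]
  · intro t ht
    exact rpow_pos_of_pos (Nat.cast_pos.2 ht) _

end Stmt13
end
end
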